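/- Let F ∈ ℤ[x₁,…,xₙ] be a form (homogeneous polynomial) of degree d ≥ 3 whose singular locus over ℚ has dimension σ. Suppose that n − σ ≥ (d − (1/2)√d)·2^d. Then F satisfies the smooth Hasse principle: if the system F(x) = 0, ∇F(x) ≠ 0 has a solution over ℝ and over ℚ_p for every prime p, then it has a solution x ∈ ℤⁿ. -/

import Mathlib

noncomputable section
open scoped Classical
open MvPolynomial MeasureTheory

/-- Distance from a real number to the nearest integer. -/
def nint (x : ℝ) : ℝ := |x - round x|

/-- `α ∈ 𝕋` and `q ∈ ℕ` are *primitive* if there is `a` coprime to `q`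
with `‖qα‖ = |qα - a|`. -/
def Primitive (α : ℝ) (q : ℕ) : Prop :=
  ∃ a : ℤ, Int.gcd a q = 1 ∧ nint (q * α) = |q * α - a|

/-- `e(t) = exp(2πit)`. -/
def eC (t : ℝ) : ℂ := Complex.exp (2 * Real.pi * Complex.I * t)

/-- The exponential sum `S(α, P) = Σ_{x ∈ ℤⁿ} ω(x/P) e(α f(x))`. -/
def expSum (n : ℕ) (f : MvPolynomial (Fin n) ℤ) (ω : (Fin n → ℝ) → ℝ) (α P : ℝ) : ℂ :=
  ∑' x : Fin n → ℤ, (ω (fun i => (x i : ℝ) / P) : ℂ) * eC (α * (MvPolynomial.eval x f : ℝ))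

/-- Mixed partial derivative `∂^ε g`. -/
def mpderiv (n : ℕ) (ε : Fin n → ℕ) (g : (Fin n → ℝ) → ℝ) : (Fin n → ℝ) → ℝ :=
  (List.finRange n).foldr
    (fun i h => (fun u : (Fin n → ℝ) → ℝ => fun x => fderiv ℝ u x (Pi.single i 1))^[ε i] h) g

/-- A super-exponential increasing tuple of positive constants `(c, c₀, c₁, …)`. -/
def SuperSeq (c : ℝ) (cs : ℕ → ℝ) : Prop :=
  0 < c ∧ c ≤ cs 0 ∧ Monotone cs ∧ ∀ i j, cs i * cs j ≤ cs (i + j)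

/-- Membership of `ω` in the class `𝒮⁺(𝐜)` of smooth weight functions. -/
def SmoothWeight (n : ℕ) (c : ℝ) (cs : ℕ → ℝ) (ω : (Fin n → ℝ) → ℝ) : Prop :=
  ContDiff ℝ (⊤ : ℕ∞) ω ∧ (∀ x, 0 ≤ ω x) ∧ (∀ x, ω x ≠ 0 → ∀ i, |x i| ≤ c) ∧
    ∀ (ε : Fin n → ℕ) (x : Fin n → ℝ), |mpderiv n ε ω x| ≤ cs (∑ i, ε i)

/-- Dimension of the singular locus of `g` over `K`, i.e. the Krull dimension
of the coordinate ring of the affine set cut out by `∇g = 0`. -/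
def singDim (n : ℕ) (K : Type) [CommRing K] (g : MvPolynomial (Fin n) K) : WithBot (WithTop ℕ) :=
  ringKrullDim (MvPolynomial (Fin n) K ⧸ Ideal.span (Set.range fun i => MvPolynomial.pderiv i g))

/-- `Height f ≤ H`: all coefficients of `f` are at most `H` in absolute value. -/
def HeightLe (n : ℕ) (f : MvPolynomial (Fin n) ℤ) (H : ℝ) : Prop :=
  ∀ m : Fin n →₀ ℕ, |((f.coeff m : ℤ) : ℝ)| ≤ H

/-- `Height_{P,k} f ≤ H`: the relative height of `f` w.r.t. `P` at scale `k` is at most `H`. -/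
def HeightPLe (n k : ℕ) (P : ℝ) (f : MvPolynomial (Fin n) ℤ) (H : ℝ) : Prop :=
  ∀ m : Fin n →₀ ℕ, |((f.coeff m : ℤ) : ℝ)| * P ^ (m.sum fun _ e => e) ≤ H * P ^ k

/-- `b = ∏_{p^e ∥ q, e ≤ 2} p^e`. -/
def bOf (q : ℕ) : ℕ :=
  ∏ p ∈ q.primeFactors, if q.factorization p ≤ 2 then p ^ q.factorization p else 1

/-- `c₁ = ∏_{p^e ∥ q, e > 2} p^⌊e/2⌋`. -/
def c1Of (q : ℕ) : ℕ :=
  ∏ p ∈ q.primeFactors, if 2 < q.factorization p then p ^ (q.factorization p / 2) else 1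

/-- `c₂ = ∏_{p^e ∥ q, e > 2, e odd} p`. -/
def c2Of (q : ℕ) : ℕ :=
  ∏ p ∈ q.primeFactors, if 2 < q.factorization p ∧ Odd (q.factorization p) then p else 1

/-- `η_q = max{(b³c₁c₂²)^{1/(2^d−2)}, (b³c₁²c₂)^{1/(5·2^{d−2}−4)}}`. -/
def etaOf (d q : ℕ) : ℝ :=
  max (((bOf q : ℝ) ^ 3 * (c1Of q : ℝ) * (c2Of q : ℝ) ^ 2) ^ ((1 : ℝ) / ((2:ℝ) ^ (d : ℝ) - 2)))
      (((bOf q : ℝ) ^ 3 * (c1Of q : ℝ) ^ 2 * (c2Of q : ℝ)) ^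
        ((1 : ℝ) / (5 * (2:ℝ) ^ ((d : ℝ) - 2) - 4)))

/-- The `r`-values `r_i = ∏_{p^e ∥ kb, σ_p(g^{[k]}) = i} p^e` of `g` w.r.t. `q`. -/
def rOf (n k q : ℕ) (g : MvPolynomial (Fin n) ℤ) (i : ℕ) : ℕ :=
  ∏ p ∈ (k * bOf q).primeFactors,
    if singDim n (ZMod p)
        (MvPolynomial.map (Int.castRingHom (ZMod p)) (MvPolynomial.homogeneousComponent k g))
        = (i : WithBot (WithTop ℕ))
    then p ^ ((k * bOf q).factorization p) else 1

/-- `R^{[k]}_ζ(g, q) = ∏_{ζ ≤ i ≤ n} r_i^{i−ζ}`. -/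
def ROf (n k q : ℕ) (g : MvPolynomial (Fin n) ℤ) (ζ : ℕ) : ℕ :=
  ∏ i ∈ Finset.Icc ζ n, (rOf n k q g i) ^ (i - ζ)

/-- `ξ = (5 − 2^{4−d})/(3 − 2^{3−d})`. -/
def xiOf (d : ℕ) : ℝ := (5 - (2:ℝ) ^ ((4 : ℝ) - d)) / (3 - (2:ℝ) ^ ((3 : ℝ) - d))

/-- `γ = 1/(3·2^{d−2} − 2)`. -/
def gamOf (d : ℕ) : ℝ := 1 / (3 * (2:ℝ) ^ ((d : ℝ) - 2) - 2)

/-- `A_d = 7·2^{d−4} − 5/4`. -/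
def AdOf (d : ℕ) : ℝ := 7 * (2:ℝ) ^ ((d : ℝ) - 4) - 5 / 4

/-- `B_k = (k−1)·2^{d−1}`. -/
def BkOf (d k : ℕ) : ℝ := ((k : ℝ) - 1) * (2:ℝ) ^ ((d : ℝ) - 1)

/-- `V_k = 2^{d+1−k} − 2`. -/
def VkOf (d k : ℕ) : ℝ := (2:ℝ) ^ ((d : ℝ) + 1 - (k : ℝ)) - 2

/-- `C(α, q) = (‖qα‖P)^{1/(2^{d−1}−2)} + (qP^{−2})^{1/2^{d−2}} + η_q⁻¹`. -/
def CCof (d : ℕ) (P : ℝ) (q : ℕ) (α : ℝ) : ℝ :=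
  (nint (q * α) * P) ^ (1 / ((2:ℝ) ^ ((d : ℝ) - 1) - 2)) +
    ((q : ℝ) * P ^ (-(2 : ℝ))) ^ (1 / (2:ℝ) ^ ((d : ℝ) - 2)) + (etaOf d q)⁻¹

/-- `W_k(α, q)`; the term `(‖qα‖P^k)^{−1/B_k}` is interpreted as `+∞` when `‖qα‖ = 0`. -/
def WWof (d k : ℕ) (P : ℝ) (q : ℕ) (α : ℝ) : ℝ :=
  P ^ (-((2:ℝ) ^ (1 - (d : ℝ)))) + nint (q * α) ^ (1 / (BkOf d k + VkOf d k)) +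
    ((q : ℝ) * P ^ (-(k : ℝ))) ^ (1 / BkOf d k) +
    min ((q : ℝ) ^ (-(1 / (BkOf d k + VkOf d k))))
      (if nint (q * α) = 0 then (q : ℝ) ^ (-(1 / (BkOf d k + VkOf d k)))
       else (nint (q * α) * P ^ (k : ℝ)) ^ (-(1 / BkOf d k)))

/-- `M(α, q) = min{C(α, q), W₃(α, q), …, W_d(α, q)}`. -/
def MMof (d : ℕ) (P : ℝ) (q : ℕ) (α : ℝ) : ℝ :=
  min (CCof d P q α) (sInf ((fun k => WWof d k P q α) '' Set.Icc 3 d))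

/-- `W_k*(α, q)`; the term `(‖qα‖P^k)^{−1/B_k}` is interpreted as `+∞` when `‖qα‖ = 0`. -/
def WSof (d k : ℕ) (P : ℝ) (q : ℕ) (α : ℝ) : ℝ :=
  max (nint (q * α) ^ (1 / (BkOf d k + VkOf d k)))
    (min ((etaOf d q)⁻¹)
      (if nint (q * α) = 0 then (etaOf d q)⁻¹
       else (nint (q * α) * P ^ (k : ℝ)) ^ (-(1 / BkOf d k))))

/-- `M*(α, q) = min{W₃*(α, q), …, W_d*(α, q)}`. -/
def MSof (d : ℕ) (P : ℝ) (q : ℕ) (α : ℝ) : ℝ :=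
  sInf ((fun k => WSof d k P q α) '' Set.Icc 3 d)

/-- The major arcs `𝔐(Δ)`, viewed inside a fundamental domain `[0,1)` for `𝕋 = ℝ/ℤ`. -/
def majorArcs (d : ℕ) (Δ P : ℝ) : Set ℝ :=
  {α | ∃ q : ℕ, 0 < q ∧ (q : ℝ) ≤ P ^ Δ ∧
    ∃ a : ℕ, a ≤ q ∧ Nat.gcd a q = 1 ∧ nint (α - (a : ℝ) / q) ≤ P ^ (Δ - d)}

/-- The minor arcs `𝔪 = 𝕋 ∖ 𝔐(Δ)`. -/
def minorArcs (d : ℕ) (Δ P : ℝ) : Set ℝ := Set.Ico (0 : ℝ) 1 \ majorArcs d Δ P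

namespace BirchHasse

open scoped ENNReal

theorem summable_norm_pi {n : ℕ} (f : Fin n → ℤ → ℂ) (hf : ∀ i, Summable fun k => ‖f i k‖) :
    Summable fun x : Fin n → ℤ => ‖∏ i, f i (x i)‖ := by
  induction n with
  | zero => exact (hasSum_fintype _).summable
  | succ n ih =>
    rw [← (Fin.consEquiv fun _ : Fin (n + 1) => ℤ).summable_iff]
    have := (hf 0).mul_of_nonneg (ih (fun i => f i.succ) fun i => hf i.succ)
      (fun _ => norm_nonneg _) (fun _ => norm_nonneg _)
    refine this.congr fun x => ?_
    simp [Fin.consEquiv, Fin.prod_univ_succ]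

theorem tsum_pi {n : ℕ} (f : Fin n → ℤ → ℂ) (hf : ∀ i, Summable fun k => ‖f i k‖) :
    ∑' x : Fin n → ℤ, ∏ i, f i (x i) = ∏ i, ∑' k, f i k := by
  induction n with
  | zero => simp [tsum_fintype]
  | succ n ih =>
    rw [← (Fin.consEquiv fun _ : Fin (n + 1) => ℤ).tsum_eq, Fin.prod_univ_succ,
      ← ih (fun i => f i.succ) fun i => hf i.succ,
      tsum_mul_tsum_of_summable_norm (hf 0) (summable_norm_pi _ fun i => hf i.succ)]
    refine tsum_congr fun x => ?_
    simp [Fin.consEquiv, Fin.prod_univ_succ]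

/-- The Gaussian `exp (-π t |x|²)` on `ℝⁿ`. -/
def gau {n : ℕ} (t : ℝ) (x : Fin n → ℝ) : ℝ := Real.exp (-Real.pi * t * ∑ i, x i ^ 2)

/-- The real vector of an integer vector. -/
def toR {n : ℕ} (x : Fin n → ℤ) : Fin n → ℝ := fun i => (x i : ℝ)

theorem gau_pos {n : ℕ} (t : ℝ) (x : Fin n → ℝ) : 0 < gau t x := Real.exp_pos _

theorem gau_eq_prod {n : ℕ} (t : ℝ) (x : Fin n → ℝ) :
    gau t x = ∏ i, Real.exp (-Real.pi * t * x i ^ 2) := by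
  rw [gau, Finset.mul_sum, Real.exp_sum]

theorem gau_neg {n : ℕ} (t : ℝ) (x : Fin n → ℝ) : gau t (-x) = gau t x := by simp [gau]

theorem norm_eC (t : ℝ) : ‖eC t‖ = 1 := by
  rw [eC, show (2 * Real.pi * Complex.I * t : ℂ) = ((2 * Real.pi * t : ℝ) : ℂ) * Complex.I by
    push_cast; ring]
  exact Complex.norm_exp_ofReal_mul_I _

theorem eC_add (s t : ℝ) : eC (s + t) = eC s * eC t := by
  rw [eC, eC, eC, ← Complex.exp_add]; push_cast; ring_nf

theorem eC_sum {ι : Type*} (s : Finset ι) (f : ι → ℝ) : eC (∑ i ∈ s, f i) = ∏ i ∈ s, eC (f i) := by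
  simp only [eC, ← Complex.exp_sum, ← Finset.mul_sum, Complex.ofReal_sum]

theorem eC_int (k : ℤ) : eC k = 1 := by
  rw [eC]; convert Complex.exp_int_mul_two_pi_mul_I k using 2; push_cast; ring

theorem eC_zero : eC 0 = 1 := by simpa using eC_int 0

theorem conj_eC (t : ℝ) : (starRingEnd ℂ) (eC t) = eC (-t) := by
  rw [eC, eC, ← Complex.exp_conj]; simp [Complex.conj_ofNat]

theorem poisson_one {t : ℝ} (ht : 0 < t) (c θ : ℝ) :
    ∑' k : ℤ, (Real.exp (-Real.pi * t * ((k : ℝ) - c) ^ 2) : ℂ) * eC (θ * k) =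
      ((t ^ (-(1 / 2) : ℝ) : ℝ) : ℂ) * ∑' v : ℤ,
        (Real.exp (-Real.pi * t⁻¹ * (θ - v) ^ 2) : ℂ) * eC (c * (θ - v)) := by
  have h := Complex.tsum_exp_neg_quadratic (a := (t : ℂ)) (by simpa using ht)
    ((t : ℂ) * c + Complex.I * θ)
  have htc : (t : ℂ) ≠ 0 := by exact_mod_cast ht.ne'
  have e1 : ∀ k : ℤ, (Real.exp (-Real.pi * t * ((k : ℝ) - c) ^ 2) : ℂ) * eC (θ * k) =
      Complex.exp (-Real.pi * t * c ^ 2) * Complex.exp (-Real.pi * t * k ^ 2 +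
        2 * Real.pi * ((t : ℂ) * c + Complex.I * θ) * k) := by
    intro k
    rw [eC, Complex.ofReal_exp, ← Complex.exp_add, ← Complex.exp_add]
    push_cast; ring_nf
  simp_rw [e1]
  rw [tsum_mul_left, h, mul_left_comm]
  congr 1
  · rw [Real.rpow_neg ht.le, Complex.ofReal_inv, Complex.ofReal_cpow ht.le, one_div]; simp
  rw [← tsum_mul_left, ← (Equiv.neg ℤ).tsum_eq, ← (Equiv.neg ℤ).tsum_eq]
  refine tsum_congr fun v => ?_
  rw [eC, Complex.ofReal_exp, ← Complex.exp_add, ← Complex.exp_add, ← sub_eq_zero]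
  simp only [Equiv.neg_apply]
  rw [sub_eq_zero]
  congr 1
  push_cast
  field_simp
  ring_nf
  linear_combination (-2 * t * c * θ * Complex.I - t ^ 2 * c ^ 2 - 2 * v * θ -
    θ ^ 2 * (Complex.I ^ 2 - 1)) * Complex.I_sq

theorem summable_gauss_one {t : ℝ} (ht : 0 < t) (c : ℝ) :
    Summable fun k : ℤ => Real.exp (-Real.pi * t * ((k : ℝ) - c) ^ 2) := by
  have h := ((summable_jacobiTheta₂_term_iff (-(Complex.I * t * c)) (Complex.I * t)).2
    (by simpa using ht)).norm
  refine (h.mul_left (Real.exp (-Real.pi * t * c ^ 2))).congr fun k => ?_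
  rw [norm_jacobiTheta₂_term, ← Real.exp_add]
  simp
  ring

/-- A bound for the one-dimensional theta constant. -/
def thetaC : ℝ := ∑' k : ℤ, Real.exp (-Real.pi * (k : ℝ) ^ 2)

theorem one_le_thetaC : 1 ≤ thetaC := by
  have := (summable_gauss_one one_pos 0).le_tsum (0 : ℤ) fun _ _ => (Real.exp_pos _).le
  simpa [thetaC] using this

theorem tsum_gauss_one_le {t : ℝ} (ht : 0 < t) (c : ℝ) :
    ∑' k : ℤ, Real.exp (-Real.pi * t * ((k : ℝ) - c) ^ 2) ≤ thetaC * max 1 (t ^ (-(1 / 2) : ℝ)) := by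
  have key : ∀ {t : ℝ}, 0 < t → t ≤ 1 → ∀ c : ℝ,
      ∑' k : ℤ, Real.exp (-Real.pi * t * ((k : ℝ) - c) ^ 2) ≤ thetaC * t ^ (-(1 / 2) : ℝ) := by
    intro t ht ht1 c
    have h := congrArg norm (poisson_one ht c 0)
    simp only [zero_mul, eC_zero, mul_one] at h
    rw [← Complex.ofReal_tsum, Complex.norm_real, Real.norm_of_nonneg
      (tsum_nonneg fun _ => (Real.exp_pos _).le)] at h
    rw [h, norm_mul, Complex.norm_real, Real.norm_of_nonneg (Real.rpow_nonneg ht.le _), mul_comm]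
    gcongr
    refine tsum_of_norm_bounded (g := fun k : ℤ => Real.exp (-Real.pi * (k : ℝ) ^ 2))
      (by simpa [thetaC] using (summable_gauss_one one_pos 0).hasSum) fun v => ?_
    rw [norm_mul, norm_eC, mul_one, Complex.norm_real, Real.norm_of_nonneg (Real.exp_pos _).le]
    refine Real.exp_le_exp.2 ?_
    have h1 : 1 ≤ t⁻¹ := (one_le_inv₀ ht).2 ht1
    have h2 : 0 ≤ Real.pi * (v : ℝ) ^ 2 := by positivity
    nlinarith
  rcases le_total t 1 with h | h
  · exact (key ht h c).trans (mul_le_mul_of_nonneg_left (le_max_right _ _)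
      (zero_le_one.trans one_le_thetaC))
  · calc _ ≤ ∑' k : ℤ, Real.exp (-Real.pi * 1 * ((k : ℝ) - c) ^ 2) := by
          refine (summable_gauss_one ht c).tsum_le_tsum (fun k => Real.exp_le_exp.2 ?_)
            (summable_gauss_one one_pos c)
          have h2 : 0 ≤ Real.pi * ((k : ℝ) - c) ^ 2 := by positivity
          nlinarith
      _ ≤ thetaC * 1 := by simpa using key one_pos le_rfl c
      _ ≤ _ := mul_le_mul_of_nonneg_left (le_max_left _ _) (zero_le_one.trans one_le_thetaC)

theorem summable_gau {n : ℕ} {t : ℝ} (ht : 0 < t) (c : Fin n → ℝ) :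
    Summable fun x : Fin n → ℤ => gau t (toR x - c) := by
  refine (summable_norm_pi (n := n) (fun i k => (Real.exp (-Real.pi * t * ((k : ℝ) - c i) ^ 2) : ℂ))
    fun i => ?_).congr fun x => ?_
  · refine (summable_gauss_one ht (c i)).congr fun k => ?_
    rw [Complex.norm_real, Real.norm_of_nonneg (Real.exp_pos _).le]
  · rw [norm_prod, gau_eq_prod]
    refine Finset.prod_congr rfl fun i _ => ?_
    rw [Complex.norm_real, Real.norm_of_nonneg (Real.exp_pos _).le]
    rfl

theorem tsum_gau_le {n : ℕ} {t : ℝ} (ht : 0 < t) (c : Fin n → ℝ) :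
    ∑' x : Fin n → ℤ, gau t (toR x - c) ≤ (thetaC * max 1 (t ^ (-(1 / 2) : ℝ))) ^ n := by
  have h := tsum_pi (n := n) (fun i k => (Real.exp (-Real.pi * t * ((k : ℝ) - c i) ^ 2) : ℂ))
    fun i => (summable_gauss_one ht (c i)).norm.congr fun k => by
      rw [Complex.norm_real]
  have h2 : ∑' x : Fin n → ℤ, gau t (toR x - c) =
      ∏ i, ∑' k : ℤ, Real.exp (-Real.pi * t * ((k : ℝ) - c i) ^ 2) := by
    apply Complex.ofReal_injective
    push_cast [gau_eq_prod]
    simpa [toR] using h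
  rw [h2]
  refine (Finset.prod_le_prod (fun i _ => tsum_nonneg fun _ => (Real.exp_pos _).le)
    fun i _ => tsum_gauss_one_le ht (c i)).trans ?_
  simp

theorem summable_gau_mul {n : ℕ} {t : ℝ} (ht : 0 < t) (c : Fin n → ℝ) {g : (Fin n → ℤ) → ℂ}
    (hg : ∀ x, ‖g x‖ ≤ 1) : Summable fun x => (gau t (toR x - c) : ℂ) * g x := by
  refine Summable.of_norm_bounded (summable_gau ht c) fun x => ?_
  rw [norm_mul, Complex.norm_real, Real.norm_of_nonneg (gau_pos _ _).le]
  exact mul_le_of_le_one_right (gau_pos _ _).le (hg x)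

theorem poisson_pi {n : ℕ} {t : ℝ} (ht : 0 < t) (c θ : Fin n → ℝ) :
    ∑' y : Fin n → ℤ, (gau t (toR y - c) : ℂ) * eC (∑ i, θ i * y i) =
      (((t ^ (-(1 / 2) : ℝ)) ^ n : ℝ) : ℂ) * ∑' v : Fin n → ℤ,
        (gau t⁻¹ (θ - toR v) : ℂ) * eC (∑ i, c i * (θ i - v i)) := by
  have hs : ∀ i, Summable fun k : ℤ =>
      ‖(Real.exp (-Real.pi * t * ((k : ℝ) - c i) ^ 2) : ℂ) * eC (θ i * k)‖ := fun i =>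
    (summable_gauss_one ht (c i)).congr fun k => by
      rw [norm_mul, norm_eC, mul_one, Complex.norm_real, Real.norm_of_nonneg (Real.exp_pos _).le]
  have hs' : ∀ i, Summable fun k : ℤ =>
      ‖(Real.exp (-Real.pi * t⁻¹ * (θ i - k) ^ 2) : ℂ) * eC (c i * (θ i - k))‖ := fun i =>
    (summable_gauss_one (inv_pos.2 ht) (θ i)).congr fun k => by
      rw [norm_mul, norm_eC, mul_one, Complex.norm_real, Real.norm_of_nonneg (Real.exp_pos _).le,
        ← neg_sub, neg_sq]
  have h1 := tsum_pi _ hs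
  have h2 := tsum_pi _ hs'
  simp only [Finset.prod_mul_distrib, ← eC_sum] at h1 h2
  have h3 : ∀ y : Fin n → ℤ, (gau t (toR y - c) : ℂ) =
      ∏ i, (Real.exp (-Real.pi * t * ((y i : ℝ) - c i) ^ 2) : ℂ) := fun y => by
    rw [gau_eq_prod, Complex.ofReal_prod]; rfl
  have h4 : ∀ v : Fin n → ℤ, (gau t⁻¹ (θ - toR v) : ℂ) =
      ∏ i, (Real.exp (-Real.pi * t⁻¹ * (θ i - v i) ^ 2) : ℂ) := fun y => by
    rw [gau_eq_prod, Complex.ofReal_prod]; rfl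
  simp only [h3, h4]
  rw [h1, h2]
  simp only [poisson_one ht, Finset.prod_mul_distrib, Finset.prod_const, Finset.card_univ,
    Fintype.card_fin]
  push_cast
  rfl

section Lattice

variable {Λ : Type*} [AddCommGroup Λ]

/-- The quotient of a lattice by its doubled sublattice. -/
abbrev ModTwo (Λ : Type*) [AddCommGroup Λ] : Type _ := Λ ⧸ (nsmulAddMonoidHom (α := Λ) 2).range

theorem modTwo_eq_iff {a b : Λ} : (a : ModTwo Λ) = b ↔ ∃ w, b = a + 2 • w := by
  rw [QuotientAddGroup.eq]
  constructor
  · rintro ⟨w, hw⟩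
    refine ⟨w, ?_⟩
    have hw' : 2 • w = -a + b := hw
    rw [hw', add_neg_cancel_left]
  · rintro ⟨w, rfl⟩
    exact ⟨w, by simp⟩

theorem tsum_add_sub (h2 : ∀ a : Λ, 2 • a = 0 → a = 0) (g : Λ → Λ → ℝ≥0∞) :
    ∑' (u : Λ) (v : Λ), g (u + v) (u - v) =
      ∑' (a : Λ) (b : Λ), if (a : ModTwo Λ) = b then g a b else 0 := by
  rw [← ENNReal.tsum_prod, ← ENNReal.tsum_prod]
  have hinj : Function.Injective fun p : Λ × Λ => (p.1 + p.2, p.1 - p.2) := by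
    rintro ⟨u, v⟩ ⟨u', v'⟩ h
    simp only [Prod.mk.injEq] at h
    have e1 : u - u' = 0 := h2 _ (by
      rw [smul_sub, two_nsmul, two_nsmul, sub_eq_zero, ← add_add_sub_cancel u u v, h.1, h.2]; abel)
    have e2 : v - v' = 0 := h2 _ (by
      have : 2 • (v - v') = (u + v) - (u - v) - ((u' + v') - (u' - v')) := by
        simp only [two_nsmul]; abel
      rw [this, h.1, h.2, sub_self])
    rw [sub_eq_zero.1 e1, sub_eq_zero.1 e2]
  have hsupp : Function.support (fun p : Λ × Λ => if (p.1 : ModTwo Λ) = p.2 then g p.1 p.2 else 0)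
      ⊆ Set.range fun p : Λ × Λ => (p.1 + p.2, p.1 - p.2) := by
    rintro ⟨a, b⟩ hab
    have hab' : (a : ModTwo Λ) = b := by
      by_contra h
      simp [h] at hab
    obtain ⟨w, rfl⟩ := modTwo_eq_iff.1 hab'
    exact ⟨(a + w, -w), by ext <;> simp [two_nsmul, add_assoc]⟩
  rw [← hinj.tsum_eq hsupp]
  refine tsum_congr fun p => ?_
  rw [if_pos]
  rw [modTwo_eq_iff]
  exact ⟨-p.2, by simp only [smul_neg, two_nsmul]; abel⟩

theorem tsum_mul_classes (f : Λ → ℝ≥0∞) (k : ModTwo Λ → ModTwo Λ) (g : Λ → ℝ≥0∞) :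
    ∑' (a : Λ) (b : Λ), (if k a = (b : ModTwo Λ) then f a * g b else 0) =
      ∑' c : ModTwo Λ, (∑' a : Λ, if (a : ModTwo Λ) = c then f a else 0) *
        ∑' b : Λ, if (b : ModTwo Λ) = k c then g b else 0 := by
  simp_rw [← ENNReal.tsum_mul_right]
  conv_rhs => rw [ENNReal.tsum_comm]
  refine tsum_congr fun a => ?_
  rw [tsum_eq_single (a : ModTwo Λ) ?_]
  · rw [if_pos rfl, ← ENNReal.tsum_mul_left]
    refine tsum_congr fun b => ?_
    by_cases h : k a = (b : ModTwo Λ)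
    · simp [h]
    · simp [h, Ne.symm h]
  · intro c hc
    simp [Ne.symm hc]

variable (Q : Λ → ℝ)

/-- The Gaussian weight of a lattice vector. -/
def latW (y : ℝ) (a : Λ) : ℝ≥0∞ := ENNReal.ofReal (Real.exp (-Real.pi * y * Q a))

/-- The theta series of the form `Q`. -/
def latTheta (y : ℝ) : ℝ≥0∞ := ∑' a, latW Q y a

/-- The part of the theta series in a class modulo `2`. -/
def latClass (y : ℝ) (c : ModTwo Λ) : ℝ≥0∞ := ∑' a : Λ, if (a : ModTwo Λ) = c then latW Q y a else 0

variable {Q}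

theorem latW_mul (hQ : ∀ a b, Q (a + b) + Q (a - b) = 2 * Q a + 2 * Q b)
    (y : ℝ) (a b : Λ) :
    latW Q y (a + b) * latW Q y (a - b) = latW Q (2 * y) a * latW Q (2 * y) b := by
  rw [latW, latW, latW, latW, ← ENNReal.ofReal_mul (Real.exp_pos _).le,
    ← ENNReal.ofReal_mul (Real.exp_pos _).le, ← Real.exp_add, ← Real.exp_add]
  congr 2
  linear_combination (-Real.pi * y) * hQ a b

theorem latClass_sum (y : ℝ) : ∑' c, latClass Q y c = latTheta Q y := by
  simp only [latClass]
  rw [ENNReal.tsum_comm]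
  exact tsum_congr fun a => by rw [tsum_eq_single (a : ModTwo Λ)] <;> simp +contextual [eq_comm]

theorem latClass_zero (hQ : ∀ a b, Q (a + b) + Q (a - b) = 2 * Q a + 2 * Q b)
    (h2 : ∀ a : Λ, 2 • a = 0 → a = 0) (y : ℝ) :
    latClass Q y 0 = latTheta Q (4 * y) := by
  have h0 : Q 0 = 0 := by have := hQ 0 0; simp at this; linarith
  have hd : ∀ a, Q (2 • a) = 4 * Q a := fun a => by
    have := hQ a a; rw [sub_self, h0, ← two_nsmul] at this; linarith
  have hinj : Function.Injective fun a : Λ => 2 • a := fun a b h =>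
    sub_eq_zero.1 (h2 _ (by rw [smul_sub]; exact sub_eq_zero.2 h))
  rw [latClass, latTheta, ← hinj.tsum_eq]
  · refine tsum_congr fun a => ?_
    rw [if_pos, latW, latW, hd]
    · ring_nf
    · rw [← QuotientAddGroup.mk_zero, eq_comm, modTwo_eq_iff]
      exact ⟨a, by simp⟩
  · intro a ha
    have : (a : ModTwo Λ) = ((0 : Λ) : ModTwo Λ) := by
      by_contra h
      exact ha (if_neg h)
    obtain ⟨w, hw⟩ := modTwo_eq_iff.1 this.symm
    exact ⟨w, by simp [hw]⟩

theorem ennreal_two_mul_le (a b : ℝ≥0∞) : 2 * (a * b) ≤ a * a + b * b := by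
  rcases eq_or_ne a ⊤ with rfl | ha
  · simp
  rcases eq_or_ne b ⊤ with rfl | hb
  · simp
  lift a to NNReal using ha
  lift b to NNReal using hb
  norm_cast
  have := two_mul_le_add_sq a b
  nlinarith

theorem latClass_le (hQ : ∀ a b, Q (a + b) + Q (a - b) = 2 * Q a + 2 * Q b)
    (h2 : ∀ a : Λ, 2 • a = 0 → a = 0) (y : ℝ) (s : ModTwo Λ) :
    latClass Q y s * latClass Q y s ≤ latClass Q y 0 * latClass Q y 0 := by
  have key : ∀ s : ModTwo Λ, latClass Q y s * latClass Q y s =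
      ∑' c, latClass Q (2 * y) c * latClass Q (2 * y) (s - c) := by
    intro s
    have h := tsum_add_sub h2 fun a b =>
      if (a : ModTwo Λ) = s then latW Q y a * latW Q y b else 0
    have e := tsum_mul_classes (latW Q (2 * y)) (fun c => s - c) (latW Q (2 * y))
    simp only [latClass]
    rw [← e]
    refine Eq.trans ?_ (h.symm.trans ?_)
    · rw [← ENNReal.tsum_mul_right]
      refine tsum_congr fun a => ?_
      rw [← ENNReal.tsum_mul_left]
      refine tsum_congr fun b => ?_
      by_cases h1 : (a : ModTwo Λ) = s <;> by_cases h2 : (b : ModTwo Λ) = s <;>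
        simp [h1, h2, eq_comm (a := s)]
    · refine tsum_congr fun u => tsum_congr fun v => ?_
      rw [latW_mul hQ]
      have : ((u + v : Λ) : ModTwo Λ) = s ↔ s - (u : ModTwo Λ) = v := by
        rw [QuotientAddGroup.mk_add, sub_eq_iff_eq_add, add_comm, eq_comm]
      simp only [this]
  have hz : latClass Q y 0 * latClass Q y 0 = ∑' c, latClass Q (2 * y) c * latClass Q (2 * y) c := by
    rw [key]
    refine tsum_congr fun c => ?_
    have : (0 : ModTwo Λ) - c = c := by
      induction c using QuotientAddGroup.induction_on with
      | H a =>
        rw [zero_sub, ← QuotientAddGroup.mk_neg, modTwo_eq_iff]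
        exact ⟨a, by rw [two_nsmul]; abel⟩
    rw [this]
  have h3 : 2 * (latClass Q y s * latClass Q y s) ≤ 2 * (latClass Q y 0 * latClass Q y 0) := by
    rw [key s, hz, ← ENNReal.tsum_mul_left]
    calc _ ≤ ∑' c, (latClass Q (2 * y) c * latClass Q (2 * y) c +
          latClass Q (2 * y) (s - c) * latClass Q (2 * y) (s - c)) :=
            ENNReal.tsum_le_tsum fun c => ennreal_two_mul_le _ _
      _ = _ := by
        rw [ENNReal.tsum_add, two_mul (∑' c, _)]
        congr 1
        exact (Equiv.subLeft s).tsum_eq fun c => latClass Q (2 * y) c * latClass Q (2 * y) c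
  exact (ENNReal.mul_le_mul_iff_right (by norm_num) (by norm_num)).1 h3

theorem latTheta_sq_le (hQ : ∀ a b, Q (a + b) + Q (a - b) = 2 * Q a + 2 * Q b)
    (h2 : ∀ a : Λ, 2 • a = 0 → a = 0) (y : ℝ) :
    latTheta Q (2 * y) * latTheta Q (2 * y) ≤ latTheta Q (4 * y) * latTheta Q y := by
  have h := tsum_add_sub h2 fun a b => latW Q y a * latW Q y b
  have e := tsum_mul_classes (latW Q y) id (latW Q y)
  have h1 : latTheta Q (2 * y) * latTheta Q (2 * y) = ∑' c, latClass Q y c * latClass Q y c := by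
    refine Eq.trans ?_ (h.trans e)
    rw [latTheta, ← ENNReal.tsum_mul_right]
    refine tsum_congr fun a => ?_
    rw [← ENNReal.tsum_mul_left]
    exact tsum_congr fun b => (latW_mul hQ y a b).symm
  rw [h1, ← latClass_zero hQ h2, ← latClass_sum, ← ENNReal.tsum_mul_left]
  refine ENNReal.tsum_le_tsum fun c => ?_
  gcongr
  by_contra hlt
  push Not at hlt
  exact absurd (latClass_le hQ h2 y c) (not_le.2 (ENNReal.mul_lt_mul hlt hlt))

end Lattice

section Theta

variable {n : ℕ}

/-- The quadratic form attached to a scale `P` and a matrix `L`. -/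
def thetaForm (P : ℝ) (L : Matrix (Fin n) (Fin n) ℝ) (a : (Fin n → ℤ) × (Fin n → ℤ)) : ℝ :=
  (P ^ 2)⁻¹ * ∑ i, toR a.1 i ^ 2 + P ^ 2 * ∑ i, (L.mulVec (toR a.1) - toR a.2) i ^ 2

theorem toR_add (x y : Fin n → ℤ) : toR (x + y) = toR x + toR y := by ext; simp [toR]

theorem toR_sub (x y : Fin n → ℤ) : toR (x - y) = toR x - toR y := by ext; simp [toR]

theorem toR_neg (x : Fin n → ℤ) : toR (-x) = -toR x := by ext; simp [toR]

theorem thetaForm_parallelogram (P : ℝ) (L : Matrix (Fin n) (Fin n) ℝ)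
    (a b : (Fin n → ℤ) × (Fin n → ℤ)) :
    thetaForm P L (a + b) + thetaForm P L (a - b) = 2 * thetaForm P L a + 2 * thetaForm P L b := by
  simp only [thetaForm, Prod.fst_add, Prod.snd_add, Prod.fst_sub, Prod.snd_sub, toR_add, toR_sub,
    Matrix.mulVec_add, Matrix.mulVec_sub, Pi.add_apply, Pi.sub_apply, Finset.mul_sum,
    ← Finset.sum_add_distrib]
  exact Finset.sum_congr rfl fun i _ => by ring

theorem latW_thetaForm (P : ℝ) (L : Matrix (Fin n) (Fin n) ℝ) (y : ℝ) (h v : Fin n → ℤ) :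
    latW (thetaForm P L) y (h, v) = ENNReal.ofReal (gau (y * (P ^ 2)⁻¹) (toR h) *
      gau (y * P ^ 2) (L.mulVec (toR h) - toR v)) := by
  rw [latW, gau, gau, ← Real.exp_add, thetaForm]
  congr 2
  ring

theorem summable_gau_sub {t : ℝ} (ht : 0 < t) (c : Fin n → ℝ) :
    Summable fun x : Fin n → ℤ => gau t (c - toR x) :=
  (summable_gau ht c).congr fun x => by rw [← gau_neg, neg_sub]

theorem tsum_gau_sub_le {t : ℝ} (ht : 0 < t) (c : Fin n → ℝ) :
    ∑' x : Fin n → ℤ, gau t (c - toR x) ≤ (thetaC * max 1 (t ^ (-(1 / 2) : ℝ))) ^ n := by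
  refine le_trans (le_of_eq ?_) (tsum_gau_le ht c)
  exact tsum_congr fun x => by rw [← gau_neg, neg_sub]

theorem summable_theta (L : Matrix (Fin n) (Fin n) ℝ) {a b : ℝ} (ha : 0 < a) (hb : 0 < b) :
    Summable fun p : (Fin n → ℤ) × (Fin n → ℤ) =>
      gau a (toR p.1) * gau b (L.mulVec (toR p.1) - toR p.2) := by
  refine (summable_prod_of_nonneg fun p => mul_nonneg (gau_pos a (toR p.1)).le
    (gau_pos b (L.mulVec (toR p.1) - toR p.2)).le).2 ⟨fun h =>
      (summable_gau_sub hb (L.mulVec (toR h))).mul_left (gau a (toR h)), ?_⟩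
  have h1 := (summable_gau ha (0 : Fin n → ℝ)).mul_right ((thetaC * max 1 (b ^ (-(1 / 2) : ℝ))) ^ n)
  simp only [sub_zero] at h1
  have h2 : ∀ h : Fin n → ℤ, ∑' v : Fin n → ℤ, gau a (toR h) * gau b (L.mulVec (toR h) - toR v) ≤
      gau a (toR h) * (thetaC * max 1 (b ^ (-(1 / 2) : ℝ))) ^ n := fun h => by
    rw [tsum_mul_left]
    exact mul_le_mul_of_nonneg_left (tsum_gau_sub_le hb _) (gau_pos _ _).le
  exact Summable.of_nonneg_of_le (fun h => tsum_nonneg fun v =>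
    mul_nonneg (gau_pos _ _).le (gau_pos _ _).le) h2 h1

theorem latTheta_thetaForm {P : ℝ} (hP : 0 < P) (L : Matrix (Fin n) (Fin n) ℝ) {y : ℝ}
    (hy : 0 < y) : latTheta (thetaForm P L) y = ENNReal.ofReal
      (∑' (h : Fin n → ℤ) (v : Fin n → ℤ), gau (y * (P ^ 2)⁻¹) (toR h) *
        gau (y * P ^ 2) (L.mulVec (toR h) - toR v)) := by
  have hs := summable_theta L (a := y * (P ^ 2)⁻¹) (b := y * P ^ 2) (by positivity) (by positivity)
  rw [← hs.tsum_prod, ENNReal.ofReal_tsum_of_nonneg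
    (fun p => mul_nonneg (gau_pos _ _).le (gau_pos _ _).le) hs, latTheta]
  exact tsum_congr fun p => latW_thetaForm P L y p.1 p.2

theorem gau_double_sum_poisson (L : Matrix (Fin n) (Fin n) ℝ) (hL : L.IsSymm) {a b : ℝ}
    (ha : 0 < a) (hb : 0 < b) :
    ∑' (h : Fin n → ℤ) (v : Fin n → ℤ), gau a (toR h) * gau b (L.mulVec (toR h) - toR v) =
      (b ^ (-(1 / 2) : ℝ)) ^ n * (a ^ (-(1 / 2) : ℝ)) ^ n *
      ∑' (h : Fin n → ℤ) (v : Fin n → ℤ), gau b⁻¹ (toR h) * gau a⁻¹ (L.mulVec (toR h) - toR v) := by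
  apply Complex.ofReal_injective
  push_cast
  have e1 : ∀ h : Fin n → ℤ, ∑' v : Fin n → ℤ, (gau a (toR h) : ℂ) *
      (gau b (L.mulVec (toR h) - toR v) : ℂ) = (((b ^ (-(1 / 2) : ℝ)) ^ n : ℝ) : ℂ) *
        ∑' u : Fin n → ℤ, (gau a (toR h) : ℂ) * ((gau b⁻¹ (toR u) : ℂ) *
          eC (∑ i, L.mulVec (toR u) i * h i)) := by
    intro h
    have := poisson_pi hb (L.mulVec (toR h)) 0
    simp only [Pi.zero_apply, zero_mul, Finset.sum_const_zero, eC_zero, mul_one, zero_sub] at this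
    rw [tsum_mul_left, tsum_mul_left, mul_left_comm]
    congr 1
    refine Eq.trans (tsum_congr fun v => ?_) (this.trans ?_)
    · rw [← gau_neg, neg_sub]
    · congr 1
      rw [← (Equiv.neg (Fin n → ℤ)).tsum_eq]
      refine tsum_congr fun u => ?_
      simp only [Equiv.neg_apply, toR_neg, neg_neg]
      congr 2
      have : L.mulVec (toR h) ⬝ᵥ toR u = L.mulVec (toR u) ⬝ᵥ toR h := by
        rw [dotProduct_comm, Matrix.dotProduct_mulVec, ← Matrix.mulVec_transpose, hL.eq]
      simpa [dotProduct, toR] using this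
  have e2 : ∀ u : Fin n → ℤ, ∑' h : Fin n → ℤ, (gau a (toR h) : ℂ) * ((gau b⁻¹ (toR u) : ℂ) *
      eC (∑ i, L.mulVec (toR u) i * h i)) = (((a ^ (-(1 / 2) : ℝ)) ^ n : ℝ) : ℂ) *
        ∑' w : Fin n → ℤ, (gau b⁻¹ (toR u) : ℂ) * (gau a⁻¹ (L.mulVec (toR u) - toR w) : ℂ) := by
    intro u
    have := poisson_pi ha 0 (L.mulVec (toR u))
    simp only [Pi.zero_apply, zero_mul, Finset.sum_const_zero, eC_zero, mul_one, sub_zero] at this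
    rw [tsum_mul_left, mul_left_comm, ← this, ← tsum_mul_left]
    exact tsum_congr fun h => by ring
  have hs : Summable (Function.uncurry fun (h u : Fin n → ℤ) => (gau a (toR h) : ℂ) *
      ((gau b⁻¹ (toR u) : ℂ) * eC (∑ i, L.mulVec (toR u) i * h i))) := by
    have h1 := (summable_gau ha (0 : Fin n → ℝ)).mul_of_nonneg
      (summable_gau (inv_pos.2 hb) (0 : Fin n → ℝ)) (fun _ => (gau_pos _ _).le)
      (fun _ => (gau_pos _ _).le)
    refine Summable.of_norm_bounded h1 fun p => ?_
    simp [Function.uncurry, norm_eC, abs_of_pos (gau_pos _ _)]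
  simp_rw [e1]
  rw [tsum_mul_left, ← hs.tsum_comm]
  simp_rw [e2]
  rw [tsum_mul_left]
  push_cast
  ring

theorem latTheta_functional {P : ℝ} (hP : 0 < P) {L : Matrix (Fin n) (Fin n) ℝ} (hL : L.IsSymm) :
    latTheta (thetaForm P L) (1 / 2) = 2 ^ n * latTheta (thetaForm P L) 2 := by
  rw [latTheta_thetaForm hP L (by norm_num), latTheta_thetaForm hP L (by norm_num),
    gau_double_sum_poisson L hL (by positivity) (by positivity)]
  have h1 : (1 / 2 * P ^ 2)⁻¹ = 2 * (P ^ 2)⁻¹ := by rw [mul_inv]; norm_num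
  have h2 : (1 / 2 * (P ^ 2)⁻¹)⁻¹ = 2 * P ^ 2 := by rw [mul_inv, inv_inv]; norm_num
  rw [h1, h2, ← mul_pow, ← Real.mul_rpow (by positivity) (by positivity),
    show (1 / 2 * P ^ 2 * (1 / 2 * (P ^ 2)⁻¹)) = (2 : ℝ) ^ (-2 : ℝ) by
      rw [Real.rpow_neg (by norm_num)]; field_simp; norm_num,
    ← Real.rpow_mul (by norm_num), ENNReal.ofReal_mul (by positivity)]
  congr 1
  norm_num

theorem pair_two_nsmul (a : (Fin n → ℤ) × (Fin n → ℤ)) (h : 2 • a = 0) : a = 0 := by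
  rcases a with ⟨x, y⟩
  simp only [Prod.smul_mk, Prod.mk_eq_zero] at h
  refine Prod.mk_eq_zero.2 ⟨?_, ?_⟩
  · ext i; have := congrFun h.1 i; simpa using this
  · ext i; have := congrFun h.2 i; simpa using this

theorem latTheta_pos {P : ℝ} (L : Matrix (Fin n) (Fin n) ℝ) (y : ℝ) :
    latTheta (thetaForm P L) y ≠ 0 := by
  intro h
  have := ENNReal.tsum_eq_zero.1 h 0
  rw [latW, ENNReal.ofReal_eq_zero] at this
  exact absurd this (not_le.2 (Real.exp_pos _))

theorem latTheta_shrink {P : ℝ} (hP : 0 < P) {L : Matrix (Fin n) (Fin n) ℝ} (hL : L.IsSymm)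
    (r : ℕ) : latTheta (thetaForm P L) (2 ^ r) ≤
      ENNReal.ofReal (√2 ^ n) * latTheta (thetaForm P L) (2 ^ (r + 1)) := by
  set κ := ENNReal.ofReal (√2 ^ n)
  have hκ : κ * κ = 2 ^ n := by
    rw [← ENNReal.ofReal_mul (by positivity), ← mul_pow, Real.mul_self_sqrt (by norm_num),
      ENNReal.ofReal_pow (by norm_num)]
    simp
  have hfin : ∀ {y : ℝ}, 0 < y → latTheta (thetaForm P L) y ≠ ⊤ := fun hy => by
    rw [latTheta_thetaForm hP L hy]; exact ENNReal.ofReal_ne_top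
  induction r with
  | zero =>
    have h := latTheta_sq_le (thetaForm_parallelogram P L) pair_two_nsmul (1 / 2)
    rw [latTheta_functional hP hL, ← hκ] at h
    by_contra hlt
    push Not at hlt
    norm_num at h hlt
    refine absurd h (not_le.2 ?_)
    calc _ = (κ * latTheta (thetaForm P L) 2) * (κ * latTheta (thetaForm P L) 2) := by ring
      _ < _ := ENNReal.mul_lt_mul hlt hlt
  | succ r ih =>
    have h := latTheta_sq_le (thetaForm_parallelogram P L) pair_two_nsmul (2 ^ r)
    have e1 : (2 : ℝ) * 2 ^ r = 2 ^ (r + 1) := by ring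
    have e2 : (4 : ℝ) * 2 ^ r = 2 ^ (r + 1 + 1) := by ring
    rw [e1, e2] at h
    have h' := h.trans (mul_le_mul_right ih _)
    rw [← mul_assoc] at h'
    rw [mul_comm κ]
    exact (ENNReal.mul_le_mul_iff_left (latTheta_pos _ _) (hfin (by positivity))).1 h'

theorem latTheta_half_le {P : ℝ} (hP : 0 < P) {L : Matrix (Fin n) (Fin n) ℝ} (hL : L.IsSymm)
    (r : ℕ) : latTheta (thetaForm P L) (1 / 2) ≤
      ENNReal.ofReal (√2 ^ n) ^ (r + 2) * latTheta (thetaForm P L) (2 ^ (r + 1)) := by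
  induction r with
  | zero =>
    rw [latTheta_functional hP hL]
    refine le_of_eq ?_
    rw [zero_add, zero_add, pow_one, sq, ← ENNReal.ofReal_mul (by positivity), ← mul_pow,
      Real.mul_self_sqrt (by norm_num), ENNReal.ofReal_pow (by norm_num)]
    simp
  | succ r ih =>
    refine ih.trans ?_
    rw [pow_succ _ (r + 2), mul_assoc]
    gcongr
    exact latTheta_shrink hP hL (r + 1)

end Theta

section Weyl

variable {n : ℕ}

/-- The exponential sum of `g` with Gaussian weight of width `P` centred at `c`. -/
def gsum (P : ℝ) (c : Fin n → ℝ) (g : (Fin n → ℤ) → ℂ) : ℂ :=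
  ∑' x : Fin n → ℤ, (gau (P ^ 2)⁻¹ (toR x - c) : ℂ) * g x

theorem inv_sq_rpow_neg_half {P : ℝ} (hP : 0 < P) : ((P ^ 2)⁻¹ : ℝ) ^ (-(1 / 2) : ℝ) = P := by
  rw [Real.inv_rpow (by positivity), Real.rpow_neg (by positivity), inv_inv, ← Real.sqrt_eq_rpow,
    Real.sqrt_sq hP.le]

theorem tsum_gau_scale_le {P : ℝ} (hP : 1 ≤ P) (c : Fin n → ℝ) :
    ∑' x : Fin n → ℤ, gau (P ^ 2)⁻¹ (toR x - c) ≤ (thetaC * P) ^ n := by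
  have hP0 : 0 < P := by linarith
  have := tsum_gau_le (t := (P ^ 2)⁻¹) (by positivity) c
  rwa [inv_sq_rpow_neg_half hP0, max_eq_right hP] at this

theorem norm_gsum_le {P : ℝ} (hP : 1 ≤ P) (c : Fin n → ℝ) {g : (Fin n → ℤ) → ℂ}
    (hg : ∀ x, ‖g x‖ ≤ 1) : ‖gsum P c g‖ ≤ (thetaC * P) ^ n := by
  have hP0 : 0 < P := by linarith
  refine (tsum_of_norm_bounded (summable_gau (t := (P ^ 2)⁻¹) (by positivity) c).hasSum
    fun x => ?_).trans (tsum_gau_scale_le hP c)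
  rw [norm_mul, Complex.norm_real, Real.norm_of_nonneg (gau_pos _ _).le]
  exact mul_le_of_le_one_right (gau_pos _ _).le (hg x)

theorem gau_mul_gau_shift (t : ℝ) (y w : Fin n → ℝ) :
    gau t (y + w) * gau t y = gau (t / 2) w * gau (2 * t) (y + (2 : ℝ)⁻¹ • w) := by
  simp only [gau, ← Real.exp_add, Finset.mul_sum, ← Finset.sum_add_distrib]
  congr 1
  refine Finset.sum_congr rfl fun i _ => ?_
  simp only [Pi.add_apply, Pi.smul_apply, smul_eq_mul]
  ring

set_option maxHeartbeats 1000000 in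
theorem weyl_theta {P : ℝ} (hP : 0 < P) (c : Fin n → ℝ) {g : (Fin n → ℤ) → ℂ}
    (hg : ∀ x, ‖g x‖ ≤ 1) (L : Matrix (Fin n) (Fin n) ℝ) (κ : (Fin n → ℤ) → ℂ)
    (hκ : ∀ w, ‖κ w‖ ≤ 1) (hgL : ∀ w x, g (x + w) * (starRingEnd ℂ) (g x) =
      κ w * eC (∑ i, L.mulVec (toR w) i * x i)) :
    ‖gsum P c g‖ ^ 2 ≤ (P / √2) ^ n * ∑' (w : Fin n → ℤ) (v : Fin n → ℤ),
      gau (1 / 2 * (P ^ 2)⁻¹) (toR w) * gau (1 / 2 * P ^ 2) (L.mulVec (toR w) - toR v) := by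
  set t := (P ^ 2)⁻¹ with ht
  have ht0 : 0 < t := by positivity
  set a : (Fin n → ℤ) → ℂ := fun x => (gau t (toR x - c) : ℂ) * g x with ha
  have hsa : Summable a := summable_gau_mul ht0 c hg
  have hsa' : Summable fun x => ‖a x‖ := hsa.norm
  have hsc : Summable fun x => ‖(starRingEnd ℂ) (a x)‖ := hsa'.congr fun x => by
    rw [RCLike.norm_conj]
  have hprod : Summable fun p : (Fin n → ℤ) × (Fin n → ℤ) => a p.1 * (starRingEnd ℂ) (a p.2) :=
    summable_mul_of_summable_norm (f := a) (g := fun x => (starRingEnd ℂ) (a x)) hsa' hsc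
  let e : (Fin n → ℤ) × (Fin n → ℤ) ≃ (Fin n → ℤ) × (Fin n → ℤ) :=
    { toFun := fun p => (p.2 + p.1, p.2)
      invFun := fun p => (p.1 - p.2, p.2)
      left_inv := fun p => by simp
      right_inv := fun p => by simp }
  have hprod' := e.summable_iff.2 hprod
  have h1 : ((‖gsum P c g‖ ^ 2 : ℝ) : ℂ) =
      ∑' w : Fin n → ℤ, ∑' y : Fin n → ℤ, a (y + w) * (starRingEnd ℂ) (a y) := by
    have : (∑' p, a (e p).1 * (starRingEnd ℂ) (a (e p).2)) =
        ∑' p : (Fin n → ℤ) × (Fin n → ℤ), a p.1 * (starRingEnd ℂ) (a p.2) :=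
      e.tsum_eq fun p => a p.1 * (starRingEnd ℂ) (a p.2)
    have h2 := hprod'.tsum_prod
    have h3 : ∑' p : (Fin n → ℤ) × (Fin n → ℤ), a p.1 * (starRingEnd ℂ) (a p.2) =
        (∑' x, a x) * ∑' x, (starRingEnd ℂ) (a x) :=
      (tsum_mul_tsum_of_summable_norm hsa' hsc).symm
    have h4 : ∑' x, (starRingEnd ℂ) (a x) = (starRingEnd ℂ) (∑' x, a x) :=
      (Complex.conj_tsum a).symm
    rw [h4, Complex.mul_conj, Complex.normSq_eq_norm_sq] at h3
    exact (h3.symm.trans this.symm).trans h2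
  have h2 : ∀ w : Fin n → ℤ, ‖∑' y : Fin n → ℤ, a (y + w) * (starRingEnd ℂ) (a y)‖ ≤
      (P / √2) ^ n * ∑' v : Fin n → ℤ, gau (1 / 2 * t) (toR w) *
        gau (1 / 2 * P ^ 2) (L.mulVec (toR w) - toR v) := by
    intro w
    have e1 : ∀ y : Fin n → ℤ, a (y + w) * (starRingEnd ℂ) (a y) =
        ((gau (1 / 2 * t) (toR w) : ℂ) * κ w) *
          ((gau (2 * t) (toR y - (c - (2 : ℝ)⁻¹ • toR w)) : ℂ) *
            eC (∑ i, L.mulVec (toR w) i * y i)) := by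
      intro y
      have e2 := gau_mul_gau_shift t (toR y - c) (toR w)
      rw [show toR y - c + toR w = toR (y + w) - c by rw [toR_add]; abel,
        show toR y - c + (2 : ℝ)⁻¹ • toR w = toR y - (c - (2 : ℝ)⁻¹ • toR w) by abel,
        show t / 2 = 1 / 2 * t by ring] at e2
      simp only [ha, map_mul, Complex.conj_ofReal]
      rw [mul_mul_mul_comm, hgL, ← Complex.ofReal_mul, e2]
      push_cast
      ring
    simp_rw [e1]
    rw [tsum_mul_left, poisson_pi (by positivity), norm_mul, norm_mul, norm_mul,
      Complex.norm_real, Complex.norm_real, Real.norm_of_nonneg (gau_pos _ _).le,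
      Real.norm_of_nonneg (by positivity), tsum_mul_left]
    have e3 : ((2 * t) ^ (-(1 / 2) : ℝ)) = P / √2 := by
      rw [Real.mul_rpow (by norm_num) ht0.le, inv_sq_rpow_neg_half hP, Real.rpow_neg (by norm_num),
        ← Real.sqrt_eq_rpow]
      ring
    have e4 : (2 * t)⁻¹ = 1 / 2 * P ^ 2 := by rw [ht, mul_inv, inv_inv]; norm_num
    rw [e3, e4, mul_left_comm]
    gcongr
    · exact (gau_pos _ _).le
    · exact mul_le_of_le_one_right (gau_pos _ _).le (hκ w)
    · refine tsum_of_norm_bounded (summable_gau_sub (t := 1 / 2 * P ^ 2) (by positivity)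
        (L.mulVec (toR w))).hasSum fun v => ?_
      rw [norm_mul, norm_eC, mul_one, Complex.norm_real, Real.norm_of_nonneg (gau_pos _ _).le]
  have h3 := (summable_theta L (a := 1 / 2 * t) (b := 1 / 2 * P ^ 2) (by positivity)
    (by positivity)).prod.mul_left ((P / √2) ^ n)
  have h4 := tsum_of_norm_bounded h3.hasSum h2
  rw [← h1, tsum_mul_left] at h4
  rwa [Complex.norm_real, Real.norm_of_nonneg (by positivity)] at h4

theorem norm_tsum_sq_le {ι : Type*} {K : ι → ℝ} (hK : ∀ x, 0 < K x) (hsK : Summable K)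
    {f : ι → ℂ} (hf : Summable f) (hs : Summable fun x => ‖f x‖ ^ 2 / K x) :
    ‖∑' x, f x‖ ^ 2 ≤ (∑' x, K x) * ∑' x, ‖f x‖ ^ 2 / K x := by
  refine le_of_tendsto_of_tendsto' ((hf.hasSum.norm).pow 2)
    (Filter.Tendsto.mul hsK.hasSum hs.hasSum) fun s => ?_
  calc ‖∑ x ∈ s, f x‖ ^ 2 ≤ (∑ x ∈ s, ‖f x‖) ^ 2 := by gcongr; exact norm_sum_le _ _
    _ ≤ _ := Finset.sum_sq_le_sum_mul_sum_of_sq_le_mul s (fun x _ => (hK x).le)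
      (fun x _ => div_nonneg (sq_nonneg _) (hK x).le) fun x _ => by
        rw [mul_div_cancel₀ _ (hK x).ne']

/-- The box of integer vectors with `|k_i| < H`. -/
def boxIoo (n H : ℕ) : Finset (Fin n → ℤ) := Fintype.piFinset fun _ => Finset.Ioo (-(H : ℤ)) H

theorem gau_vdc (t b : ℝ) (y h h' : Fin n → ℝ) :
    gau t (y + b • h) * gau t (y + b • h') / gau t y =
      Real.exp (2 * Real.pi * t * b ^ 2 * ∑ i, h i * h' i) * gau t (y + b • (h + h')) := by
  simp only [gau, ← Real.exp_add, ← Real.exp_sub, Finset.mul_sum, ← Finset.sum_add_distrib,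
    ← Finset.sum_sub_distrib]
  congr 1
  refine Finset.sum_congr rfl fun i _ => ?_
  simp only [Pi.add_apply, Pi.smul_apply, smul_eq_mul]
  ring

set_option maxHeartbeats 1000000 in
theorem vdc {P : ℝ} (hP : 1 ≤ P) (c : Fin n → ℝ) {g : (Fin n → ℤ) → ℂ}
    (hg : ∀ x, ‖g x‖ ≤ 1) {b H : ℕ} (hH : 0 < H) (hbH : (b * H : ℝ) ≤ P) (A : (Fin n → ℤ) → ℝ)
    (hA : ∀ k, 0 ≤ A k)
    (hgA : ∀ k ∈ boxIoo n H, ∀ c', ‖gsum P c' fun x => g (x + (b : ℤ) • k) * (starRingEnd ℂ) (g x)‖ ≤ A k) :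
    ‖gsum P c g‖ ^ 2 ≤ (thetaC * P) ^ n * (Real.exp (2 * Real.pi * n) *
      (((H : ℝ) ^ n)⁻¹ * ∑ k ∈ boxIoo n H, A k)) := by
  have hP0 : 0 < P := by linarith
  set t := (P ^ 2)⁻¹ with ht
  have ht0 : 0 < t := by positivity
  let S : Finset (Fin n → ℤ) := Fintype.piFinset fun _ => Finset.Ico 0 (H : ℤ)
  have hScard : (S.card : ℝ) = (H : ℝ) ^ n := by simp [S]
  set a : (Fin n → ℤ) → ℂ := fun x => (gau t (toR x - c) : ℂ) * g x with ha
  have hsa : Summable a := summable_gau_mul ht0 c hg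
  set f : (Fin n → ℤ) → ℂ := fun x => ∑ h ∈ S, a (x + (b : ℤ) • h) with hfdef
  have hsh : ∀ h : Fin n → ℤ, Summable fun x => a (x + h) := fun h =>
    (Equiv.addRight h).summable_iff.2 hsa
  have hsf : Summable f := summable_sum fun h _ => hsh _
  have hf1 : ∑' x, f x = (H : ℂ) ^ n * gsum P c g := by
    rw [Summable.tsum_finsetSum fun h _ => hsh _]
    have : ∀ h ∈ S, ∑' x, a (x + (b : ℤ) • h) = gsum P c g := fun h _ =>
      (Equiv.addRight ((b : ℤ) • h)).tsum_eq a
    rw [Finset.sum_congr rfl this, Finset.sum_const, nsmul_eq_mul]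
    congr 1
    exact_mod_cast hScard
  set K : (Fin n → ℤ) → ℝ := fun x => gau t (toR x - c) with hK
  let E : (Fin n → ℤ) → (Fin n → ℤ) → ℝ := fun h h' =>
    Real.exp (2 * Real.pi * t * (b : ℝ) ^ 2 * ∑ i, toR h i * toR h' i)
  let D : (Fin n → ℤ) → (Fin n → ℤ) → (Fin n → ℤ) → ℂ := fun h h' x =>
    (gau t (toR x - (c - (b : ℝ) • toR h)) : ℂ) *
      (g (x + (b : ℤ) • (h - h')) * (starRingEnd ℂ) (g x))
  have hD : ∀ h h', Summable (D h h') := fun h h' => summable_gau_mul ht0 _ fun x => by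
    rw [norm_mul, RCLike.norm_conj]
    exact mul_le_one₀ (hg _) (norm_nonneg _) (hg _)
  have hexp : ∀ x, ((‖f x‖ ^ 2 / K x : ℝ) : ℂ) =
      ∑ h ∈ S, ∑ h' ∈ S, (E h h' : ℂ) * D h h' (x + (b : ℤ) • h') := by
    intro x
    push_cast
    rw [← Complex.ofReal_pow, ← Complex.normSq_eq_norm_sq, ← Complex.mul_conj, hfdef, map_sum,
      Finset.sum_mul_sum, Finset.sum_div]
    refine Finset.sum_congr rfl fun h _ => ?_
    rw [Finset.sum_div]
    refine Finset.sum_congr rfl fun h' _ => ?_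
    have e1 := gau_vdc t b (toR x - c) (toR h) (toR h')
    have e2 : ∀ k : Fin n → ℤ, toR (x + (b : ℤ) • k) - c = toR x - c + (b : ℝ) • toR k := by
      intro k; ext i; simp [toR]; ring
    have e3 : toR (x + (b : ℤ) • h') - (c - (b : ℝ) • toR h) =
        toR x - c + (b : ℝ) • (toR h + toR h') := by
      ext i; simp [toR]; ring
    have e4 : x + (b : ℤ) • h' + (b : ℤ) • (h - h') = x + (b : ℤ) • h := by
      rw [smul_sub]; abel
    simp only [ha, D, E, e2, e3, e4, map_mul, Complex.conj_ofReal, hK]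
    rw [mul_mul_mul_comm, ← Complex.ofReal_mul, mul_div_right_comm, ← Complex.ofReal_div, e1]
    push_cast
    ring
  have hDs : ∀ h h', Summable fun x => (E h h' : ℂ) * D h h' (x + (b : ℤ) • h') := fun h h' =>
    ((Equiv.addRight ((b : ℤ) • h')).summable_iff.2 (hD h h')).mul_left _
  have hs : Summable fun x => ‖f x‖ ^ 2 / K x := by
    rw [← Complex.summable_ofReal]
    simp_rw [hexp]
    exact summable_sum fun h _ => summable_sum fun h' _ => hDs h h'
  have hmain := norm_tsum_sq_le (fun x => gau_pos t (toR x - c)) (summable_gau ht0 c) hsf hs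
  have hb2 : t * (b * H : ℝ) ^ 2 ≤ 1 := by
    rw [ht, inv_mul_le_iff₀ (by positivity), mul_one]
    gcongr
  have hE : ∀ h ∈ S, ∀ h' ∈ S, E h h' ≤ Real.exp (2 * Real.pi * n) := by
    intro h hh h' hh'
    refine Real.exp_le_exp.2 ?_
    have h1 : ∑ i, toR h i * toR h' i ≤ n * (H : ℝ) ^ 2 := by
      have : ∀ i ∈ Finset.univ, toR h i * toR h' i ≤ (H : ℝ) ^ 2 := fun i _ => by
        have h1 := Finset.mem_Ico.1 (Fintype.mem_piFinset.1 hh i)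
        have h2 := Finset.mem_Ico.1 (Fintype.mem_piFinset.1 hh' i)
        have h3 : (0 : ℝ) ≤ h i := by exact_mod_cast h1.1
        have h4 : (0 : ℝ) ≤ h' i := by exact_mod_cast h2.1
        have h5 : (h i : ℝ) ≤ H := by exact_mod_cast h1.2.le
        have h6 : (h' i : ℝ) ≤ H := by exact_mod_cast h2.2.le
        rw [sq]
        exact mul_le_mul h5 h6 h4 (h3.trans h5)
      simpa using Finset.sum_le_sum this
    calc 2 * Real.pi * t * (b : ℝ) ^ 2 * ∑ i, toR h i * toR h' i
        ≤ 2 * Real.pi * t * (b : ℝ) ^ 2 * (n * (H : ℝ) ^ 2) := by gcongr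
      _ = 2 * Real.pi * n * (t * (b * H : ℝ) ^ 2) := by ring
      _ ≤ 2 * Real.pi * n * 1 := by gcongr
      _ = _ := by ring
  have hsub : ∀ h ∈ S, ∀ h' ∈ S, h - h' ∈ boxIoo n H := by
    intro h hh h' hh'
    refine Fintype.mem_piFinset.2 fun i => ?_
    have h1 := Finset.mem_Ico.1 (Fintype.mem_piFinset.1 hh i)
    have h2 := Finset.mem_Ico.1 (Fintype.mem_piFinset.1 hh' i)
    rw [Finset.mem_Ioo, Pi.sub_apply]
    constructor <;> linarith [h1.1, h1.2, h2.1, h2.2]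
  have hV : ∑' x, ‖f x‖ ^ 2 / K x ≤
      (H : ℝ) ^ n * (Real.exp (2 * Real.pi * n) * ∑ k ∈ boxIoo n H, A k) := by
    have h1 : ((∑' x, ‖f x‖ ^ 2 / K x : ℝ) : ℂ) =
        ∑ h ∈ S, ∑ h' ∈ S, (E h h' : ℂ) * ∑' x, D h h' x := by
      rw [Complex.ofReal_tsum]
      simp_rw [hexp]
      rw [Summable.tsum_finsetSum fun h _ => summable_sum fun h' _ => hDs h h']
      refine Finset.sum_congr rfl fun h _ => ?_
      rw [Summable.tsum_finsetSum fun h' _ => hDs h h']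
      refine Finset.sum_congr rfl fun h' _ => ?_
      rw [tsum_mul_left]
      congr 1
      exact (Equiv.addRight ((b : ℤ) • h')).tsum_eq (D h h')
    have h2 : ∑' x, ‖f x‖ ^ 2 / K x ≤ ‖∑ h ∈ S, ∑ h' ∈ S, (E h h' : ℂ) * ∑' x, D h h' x‖ := by
      rw [← h1, Complex.norm_real]; exact le_abs_self _
    refine h2.trans ((norm_sum_le _ _).trans ?_)
    have h3 : ∀ h ∈ S, ‖∑ h' ∈ S, (E h h' : ℂ) * ∑' x, D h h' x‖ ≤
        Real.exp (2 * Real.pi * n) * ∑ k ∈ boxIoo n H, A k := by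
      intro h hh
      calc _ ≤ ∑ h' ∈ S, Real.exp (2 * Real.pi * n) * A (h - h') := by
            refine (norm_sum_le _ _).trans (Finset.sum_le_sum fun h' hh' => ?_)
            rw [norm_mul, Complex.norm_real, Real.norm_of_nonneg (Real.exp_pos _).le]
            exact mul_le_mul (hE h hh h' hh') (hgA _ (hsub h hh h' hh') _) (norm_nonneg _)
              (Real.exp_pos _).le
        _ = Real.exp (2 * Real.pi * n) * ∑ k ∈ S.image fun h' => h - h', A k := by
            rw [← Finset.mul_sum, Finset.sum_image fun x _ y _ hxy => sub_right_injective hxy]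
        _ ≤ _ := by
            gcongr
            · exact fun _ _ _ => hA _
            · exact Finset.image_subset_iff.2 fun h' hh' => hsub h hh h' hh'
    refine (Finset.sum_le_sum h3).trans (le_of_eq ?_)
    rw [Finset.sum_const, nsmul_eq_mul, hScard]
  have h6 : ((H : ℝ) ^ n) ^ 2 * ‖gsum P c g‖ ^ 2 ≤ (thetaC * P) ^ n *
      ((H : ℝ) ^ n * (Real.exp (2 * Real.pi * n) * ∑ k ∈ boxIoo n H, A k)) := by
    rw [hf1, norm_mul, norm_pow, Complex.norm_natCast, mul_pow] at hmain
    refine hmain.trans (mul_le_mul (tsum_gau_scale_le hP c) hV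
      (tsum_nonneg fun x => div_nonneg (sq_nonneg _) (gau_pos _ _).le) ?_)
    have := one_le_thetaC
    positivity
  have hHn : 0 < (H : ℝ) ^ n := by positivity
  rw [← mul_le_mul_iff_right₀ (pow_pos hHn 2)]
  refine h6.trans (le_of_eq ?_)
  field_simp

end Weyl

section Shrink

variable {n : ℕ}

/-- The box of integer vectors with `|x_i| ≤ R`. -/
def boxR (n : ℕ) (R : ℝ) : Finset (Fin n → ℤ) := Fintype.piFinset fun _ => Finset.Icc (-⌊R⌋) ⌊R⌋

theorem mem_boxR {R : ℝ} {x : Fin n → ℤ} : x ∈ boxR n R ↔ ∀ i, |(x i : ℝ)| ≤ R := by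
  simp only [boxR, Fintype.mem_piFinset, Finset.mem_Icc]
  refine forall_congr' fun i => ?_
  rw [abs_le, neg_le, Int.le_floor, Int.le_floor, neg_le]
  push_cast
  rw [neg_le]

/-- The vectors `w` in a box for which `L w` is close to an integer vector. -/
def goodSet (L : Matrix (Fin n) (Fin n) ℝ) (R δ : ℝ) : Finset (Fin n → ℤ) :=
  (boxR n R).filter fun w => ∃ v : Fin n → ℤ, ∀ i, |L.mulVec (toR w) i - v i| ≤ δ

theorem gau_two_mul (t : ℝ) (x : Fin n → ℝ) : gau (2 * t) x = gau t x * gau t x := by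
  rw [gau, gau, ← Real.exp_add]; ring_nf

theorem gau_le_one {t : ℝ} (ht : 0 ≤ t) (x : Fin n → ℝ) : gau t x ≤ 1 := by
  rw [gau, Real.exp_le_one_iff]
  have := Real.pi_pos
  have : 0 ≤ ∑ i, x i ^ 2 := Finset.sum_nonneg fun i _ => sq_nonneg _
  rw [neg_mul, neg_mul, neg_nonpos]
  positivity

theorem gau_le_of_lt {t R : ℝ} (ht : 0 < t) (hR : 0 ≤ R) {x : Fin n → ℝ} (i : Fin n) (hx : R < |x i|) :
    gau t x ≤ Real.exp (-(t * R ^ 2)) := by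
  rw [gau, Real.exp_le_exp]
  have h1 : R ^ 2 ≤ ∑ i, x i ^ 2 := by
    refine le_trans ?_ (Finset.single_le_sum (fun i _ => sq_nonneg (x i)) (Finset.mem_univ i))
    rw [← sq_abs (x i)]
    gcongr
  have h2 : 1 ≤ Real.pi := by linarith [Real.pi_gt_three]
  have h3 : t * R ^ 2 ≤ t * ∑ i, x i ^ 2 := by gcongr
  have h4 : 0 ≤ t * R ^ 2 := by positivity
  nlinarith

theorem theta_tail {P W l : ℝ} (hW : 1 ≤ W) (hWP : W ≤ P) (hl : 0 ≤ l)
    (L : Matrix (Fin n) (Fin n) ℝ) :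
    ∑' (w : Fin n → ℤ) (v : Fin n → ℤ), gau (2 * (W ^ 2)⁻¹) (toR w) *
      gau (2 * (P ^ 4 * (W ^ 2)⁻¹)) (L.mulVec (toR w) - toR v) ≤
    thetaC ^ n * ((goodSet L (l * W) (l * W / P ^ 2)).card +
      Real.exp (-l ^ 2) * (thetaC * W) ^ n) := by
  have hW0 : 0 < W := by linarith
  have hP0 : 0 < P := by linarith
  set t := (W ^ 2)⁻¹ with ht
  set s := P ^ 4 * (W ^ 2)⁻¹ with hs
  have ht0 : 0 < t := by positivity
  have hs0 : 0 < s := by positivity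
  have hs1 : 1 ≤ s := by
    rw [hs, ← div_eq_mul_inv, one_le_div (by positivity)]
    calc W ^ 2 ≤ P ^ 2 := by gcongr
      _ ≤ P ^ 4 := pow_le_pow_right₀ (by linarith) (by norm_num)
  set G := goodSet L (l * W) (l * W / P ^ 2)
  have hterm : ∀ w v : Fin n → ℤ, gau (2 * t) (toR w) * gau (2 * s) (L.mulVec (toR w) - toR v) ≤
      ((if w ∈ G then 1 else 0) + Real.exp (-l ^ 2) * gau t (toR w)) *
        gau s (L.mulVec (toR w) - toR v) := by
    intro w v
    rw [gau_two_mul, gau_two_mul]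
    set A := gau t (toR w)
    set B := gau s (L.mulVec (toR w) - toR v)
    have hA : 0 < A := gau_pos _ _
    have hB : 0 < B := gau_pos _ _
    have hA1 : A ≤ 1 := gau_le_one ht0.le _
    have hB1 : B ≤ 1 := gau_le_one hs0.le _
    have key : A * B * (A * B) ≤ ((if w ∈ G then 1 else 0) + Real.exp (-l ^ 2)) * (A * B) := by
      gcongr
      by_cases hw : w ∈ G
      · rw [if_pos hw]
        have := Real.exp_pos (-l ^ 2)
        nlinarith [mul_le_one₀ hA1 hB.le hB1]
      · rw [if_neg hw, zero_add]
        by_cases hwb : w ∈ boxR n (l * W)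
        · have : ∃ i, l * W / P ^ 2 < |L.mulVec (toR w) i - v i| := by
            by_contra hcon
            push Not at hcon
            exact hw (Finset.mem_filter.2 ⟨hwb, v, hcon⟩)
          obtain ⟨i, hi⟩ := this
          have h1 := gau_le_of_lt hs0 (by positivity) (x := L.mulVec (toR w) - toR v) i hi
          have h2 : s * (l * W / P ^ 2) ^ 2 = l ^ 2 := by rw [hs]; field_simp
          rw [h2] at h1
          calc A * B ≤ 1 * B := by gcongr
            _ ≤ _ := by rw [one_mul]; exact h1
        · rw [mem_boxR] at hwb
          push Not at hwb
          obtain ⟨i, hi⟩ := hwb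
          have h1 := gau_le_of_lt ht0 (by positivity) (x := toR w) i hi
          have h2 : t * (l * W) ^ 2 = l ^ 2 := by rw [ht]; field_simp
          rw [h2] at h1
          calc A * B ≤ A * 1 := by gcongr
            _ ≤ _ := by rw [mul_one]; exact h1
    calc A * A * (B * B) = A * B * (A * B) := by ring
      _ ≤ _ := key
      _ ≤ _ := by
        rw [← mul_assoc]
        refine mul_le_mul_of_nonneg_right ?_ hB.le
        rw [add_mul]
        gcongr
        split_ifs
        · simpa using hA1
        · simp
  have hT1 : 1 ≤ thetaC := one_le_thetaC
  have hinner : ∀ w : Fin n → ℤ, ∑' v : Fin n → ℤ, gau (2 * t) (toR w) *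
      gau (2 * s) (L.mulVec (toR w) - toR v) ≤
      ((if w ∈ G then 1 else 0) + Real.exp (-l ^ 2) * gau t (toR w)) * thetaC ^ n := by
    intro w
    have h1 : Summable fun v : Fin n → ℤ => gau (2 * t) (toR w) *
      gau (2 * s) (L.mulVec (toR w) - toR v) :=
      (summable_gau_sub (t := 2 * s) (by positivity) (L.mulVec (toR w))).mul_left _
    have h2 := (summable_gau_sub (t := s) hs0 (L.mulVec (toR w))).mul_left
      ((if w ∈ G then 1 else 0) + Real.exp (-l ^ 2) * gau t (toR w))
    refine (h1.tsum_le_tsum (hterm w) h2).trans ?_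
    rw [tsum_mul_left]
    gcongr
    · have := gau_pos t (toR w)
      split_ifs <;> positivity
    · refine (tsum_gau_sub_le hs0 _).trans (le_of_eq ?_)
      rw [max_eq_left, mul_one]
      exact Real.rpow_le_one_of_one_le_of_nonpos hs1 (by norm_num)
  have hf1 : Summable fun w : Fin n → ℤ => (if w ∈ G then (1 : ℝ) else 0) :=
    summable_of_ne_finset_zero (s := G) fun w hw => if_neg hw
  have hg0 := summable_gau ht0 (0 : Fin n → ℝ)
  simp only [sub_zero] at hg0
  have hf2 := hg0.mul_left (Real.exp (-l ^ 2))
  have hg1 := tsum_gau_scale_le hW (0 : Fin n → ℝ)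
  simp only [sub_zero] at hg1
  refine ((summable_theta L (a := 2 * t) (b := 2 * s) (by positivity)
    (by positivity)).prod.tsum_le_tsum hinner ((hf1.add hf2).mul_right _)).trans ?_
  rw [tsum_mul_right, hf1.tsum_add hf2, tsum_mul_left, mul_comm]
  gcongr
  rw [tsum_eq_sum (s := G) fun w hw => if_neg hw]
  simp

theorem weyl_shrink {P W l : ℝ} (hW : 1 ≤ W) (hWP : W ≤ P) (hl : 0 ≤ l) {r : ℕ}
    (hr : W ^ 2 * 2 ^ r = P ^ 2) (c : Fin n → ℝ) {g : (Fin n → ℤ) → ℂ}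
    (hg : ∀ x, ‖g x‖ ≤ 1) {L : Matrix (Fin n) (Fin n) ℝ} (hL : L.IsSymm) (κ : (Fin n → ℤ) → ℂ)
    (hκ : ∀ w, ‖κ w‖ ≤ 1) (hgL : ∀ w x, g (x + w) * (starRingEnd ℂ) (g x) =
      κ w * eC (∑ i, L.mulVec (toR w) i * x i)) :
    ‖gsum P c g‖ ^ 2 ≤ (P ^ n) ^ 2 * (√2 ^ n * (thetaC ^ n * thetaC ^ n)) *
      ((W ^ n)⁻¹ * (goodSet L (l * W) (l * W / P ^ 2)).card + Real.exp (-l ^ 2)) := by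
  have hW0 : 0 < W := by linarith
  have hP0 : 0 < P := by linarith
  have h1 := weyl_theta hP0 c hg L κ hκ hgL
  have h2 := latTheta_half_le hP0 hL r
  rw [latTheta_thetaForm hP0 L (by norm_num), latTheta_thetaForm hP0 L (by positivity),
    ← ENNReal.ofReal_pow (by positivity), ← ENNReal.ofReal_mul (by positivity),
    ENNReal.ofReal_le_ofReal_iff (mul_nonneg (by positivity) (tsum_nonneg fun w => tsum_nonneg
      fun v => mul_nonneg (gau_pos _ _).le (gau_pos _ _).le))] at h2
  have h3 : (2 : ℝ) ^ (r + 1) * (P ^ 2)⁻¹ = 2 * (W ^ 2)⁻¹ := by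
    rw [← hr]; field_simp; ring
  have h4 : (2 : ℝ) ^ (r + 1) * P ^ 2 = 2 * (P ^ 4 * (W ^ 2)⁻¹) := by
    rw [show P ^ 4 = P ^ 2 * P ^ 2 by ring, ← hr]; field_simp; ring
  have h5 : (√2 ^ n) ^ (r + 2) = (√2 ^ n) ^ 2 * (P / W) ^ n := by
    have : √2 ^ r = P / W := by
      refine (sq_eq_sq₀ (by positivity) (by positivity)).1 ?_
      rw [← pow_mul, mul_comm, pow_mul, Real.sq_sqrt (by norm_num), div_pow, ← hr,
        mul_div_cancel_left₀ _ (by positivity)]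
    rw [pow_add, ← this]; ring
  rw [h3, h4, h5] at h2
  have h6 := theta_tail hW hWP hl L
  have hT1 : 1 ≤ thetaC := one_le_thetaC
  have hT : 1 ≤ thetaC ^ n := one_le_pow₀ hT1
  set Gc : ℝ := ((goodSet L (l * W) (l * W / P ^ 2)).card : ℝ) with hGc
  have hGc0 : 0 ≤ Gc := Nat.cast_nonneg _
  calc ‖gsum P c g‖ ^ 2 ≤ (P / √2) ^ n * ((√2 ^ n) ^ 2 * (P / W) ^ n *
        (thetaC ^ n * (Gc + Real.exp (-l ^ 2) * (thetaC * W) ^ n))) := by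
        refine h1.trans ?_
        gcongr
        exact h2.trans (by gcongr)
    _ ≤ (P / √2) ^ n * ((√2 ^ n) ^ 2 * (P / W) ^ n *
        (thetaC ^ n * (thetaC ^ n * Gc + Real.exp (-l ^ 2) * (thetaC * W) ^ n))) := by
        gcongr
        exact le_mul_of_one_le_left hGc0 hT
    _ = _ := by
      simp only [div_pow, mul_pow]
      field_simp

end Shrink

section Differences

variable {n : ℕ} {R : Type*} [CommRing R]

/-- The derivative in the constant direction `h`. -/
def dirD (h : Fin n → R) : Derivation R (MvPolynomial (Fin n) R) (MvPolynomial (Fin n) R) :=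
  mkDerivation R fun i => C (h i)

theorem dirD_X (h : Fin n → R) (i : Fin n) : dirD h (X i) = C (h i) := mkDerivation_X _ _ _

theorem dirD_apply (h : Fin n → R) (p : MvPolynomial (Fin n) R) :
    dirD h p = ∑ i, C (h i) * pderiv i p := by
  let ev (q : MvPolynomial (Fin n) R) :
      Derivation R (MvPolynomial (Fin n) R) (MvPolynomial (Fin n) R) →+ MvPolynomial (Fin n) R :=
    (Pi.evalAddMonoidHom (fun _ => MvPolynomial (Fin n) R) q).comp Derivation.coeFnAddMonoidHom
  have hev (q : MvPolynomial (Fin n) R) : ev q (∑ i, (C (h i) : MvPolynomial (Fin n) R) •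
      (pderiv i : Derivation R (MvPolynomial (Fin n) R) (MvPolynomial (Fin n) R))) =
      ∑ i, C (h i) * pderiv i q := map_sum _ _ _
  have : dirD h = ∑ i, (C (h i) : MvPolynomial (Fin n) R) •
      (pderiv i : Derivation R (MvPolynomial (Fin n) R) (MvPolynomial (Fin n) R)) := by
    refine derivation_ext fun j => ?_
    rw [dirD_X]
    refine Eq.trans ?_ (hev (X j)).symm
    simp [pderiv_X, Pi.single_apply]
  rw [this]
  exact hev p

theorem pderiv_comm (i j : Fin n) (p : MvPolynomial (Fin n) R) :
    pderiv i (pderiv j p) = pderiv j (pderiv i p) := by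
  have : ⁅(pderiv i : Derivation R (MvPolynomial (Fin n) R) (MvPolynomial (Fin n) R)), (pderiv j : Derivation R (MvPolynomial (Fin n) R) (MvPolynomial (Fin n) R))⁆ = 0 := by
    refine derivation_ext fun k => ?_
    simp only [Derivation.commutator_apply, pderiv_X, Pi.single_apply]
    split_ifs <;> simp
  have h := congrArg (fun D => D p) this
  simpa [Derivation.commutator_apply, sub_eq_zero] using h

theorem pderiv_dirD (i : Fin n) (h : Fin n → R) (p : MvPolynomial (Fin n) R) :
    pderiv i (dirD h p) = dirD h (pderiv i p) := by
  simp only [dirD_apply, map_sum, pderiv_C_mul]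
  exact Finset.sum_congr rfl fun j _ => by rw [pderiv_comm]

theorem dirD_comm (h k : Fin n → R) (p : MvPolynomial (Fin n) R) :
    dirD h (dirD k p) = dirD k (dirD h p) := by
  rw [dirD_apply k, dirD_apply k, map_sum]
  refine Finset.sum_congr rfl fun i _ => ?_
  rw [pderiv_dirD, Derivation.leibniz, smul_eq_mul]
  simp

theorem dirD_smul (b : R) (h : Fin n → R) (p : MvPolynomial (Fin n) R) :
    dirD (b • h) p = C b * dirD h p := by
  simp [dirD_apply, Finset.mul_sum, mul_assoc]

theorem dirD_map {S : Type*} [CommRing S] (φ : R →+* S) (h : Fin n → R)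
    (p : MvPolynomial (Fin n) R) : map φ (dirD h p) = dirD (fun i => φ (h i)) (map φ p) := by
  simp [dirD_apply, pderiv_map]

/-- The iterated derivative in the directions `y 0, …, y (m - 1)`. -/
def iterD (y : ℕ → Fin n → R) (p : MvPolynomial (Fin n) R) : ℕ → MvPolynomial (Fin n) R
  | 0 => p
  | m + 1 => dirD (y m) (iterD y p m)

theorem iterD_map {S : Type*} [CommRing S] (φ : R →+* S) (y : ℕ → Fin n → R)
    (p : MvPolynomial (Fin n) R) (m : ℕ) :
    map φ (iterD y p m) = iterD (fun t i => φ (y t i)) (map φ p) m := by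
  induction m with
  | zero => rfl
  | succ m ih => rw [iterD, iterD, dirD_map, ih]

theorem iterD_congr {y z : ℕ → Fin n → R} {m : ℕ} (h : ∀ t < m, y t = z t)
    (p : MvPolynomial (Fin n) R) : iterD y p m = iterD z p m := by
  induction m with
  | zero => rfl
  | succ m ih => rw [iterD, iterD, ih fun t ht => h t (by omega), h m (by omega)]

theorem pderiv_iterD (i : Fin n) (y : ℕ → Fin n → R) (p : MvPolynomial (Fin n) R) (m : ℕ) :
    pderiv i (iterD y p m) = iterD y (pderiv i p) m := by
  induction m with
  | zero => rfl
  | succ m ih => rw [iterD, iterD, pderiv_dirD, ih]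

theorem dirD_iterD (h : Fin n → R) (y : ℕ → Fin n → R) (p : MvPolynomial (Fin n) R) (m : ℕ) :
    dirD h (iterD y p m) = iterD y (dirD h p) m := by
  induction m with
  | zero => rfl
  | succ m ih => rw [iterD, iterD, dirD_comm, ih]

theorem iterD_smul (b : ℕ → R) (y : ℕ → Fin n → R) (p : MvPolynomial (Fin n) R) (m : ℕ) :
    iterD (fun t => b t • y t) p m = C (∏ t ∈ Finset.range m, b t) * iterD y p m := by
  induction m with
  | zero => simp [iterD]
  | succ m ih =>
    rw [iterD, iterD, ih, dirD_smul, Derivation.leibniz, Finset.prod_range_succ, derivation_C,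
      smul_zero, add_zero, smul_eq_mul, map_mul]
    ring

theorem iterD_sum {ι : Type*} (s : Finset ι) (y : ℕ → Fin n → R) (a : ι → R)
    (p : ι → MvPolynomial (Fin n) R) (m : ℕ) :
    iterD y (∑ i ∈ s, C (a i) * p i) m = ∑ i ∈ s, C (a i) * iterD y (p i) m := by
  induction m with
  | zero => rfl
  | succ m ih =>
    rw [iterD, ih, map_sum]
    refine Finset.sum_congr rfl fun i _ => ?_
    rw [Derivation.leibniz]; simp [iterD]

theorem eval_dirD_self {m : ℕ} {p : MvPolynomial (Fin n) R} (hp : p.IsHomogeneous (m + 1))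
    (y : Fin n → R) : eval y (dirD y p) = (m + 1) * eval y p := by
  have h := congrArg (eval y) hp.sum_X_mul_pderiv
  simpa [dirD_apply] using h

theorem isHomogeneous_dirD {m : ℕ} {p : MvPolynomial (Fin n) R} (hp : p.IsHomogeneous (m + 1))
    (y : Fin n → R) : (dirD y p).IsHomogeneous m := by
  rw [dirD_apply]
  refine IsHomogeneous.sum _ _ _ fun i _ => ?_
  simpa using (isHomogeneous_C (Fin n) (y i)).mul (hp.pderiv (i := i))

theorem eval_iterD_const {m : ℕ} {p : MvPolynomial (Fin n) R} (hp : p.IsHomogeneous m)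
    (y : Fin n → R) : eval 0 (iterD (fun _ => y) p m) = m.factorial * eval y p := by
  induction m generalizing p with
  | zero =>
    have := totalDegree_eq_zero_iff_eq_C.1 (Nat.le_zero.1 hp.totalDegree_le)
    rw [this]; simp [iterD]
  | succ m ih =>
    rw [iterD, dirD_iterD, ih (isHomogeneous_dirD hp y), eval_dirD_self hp, Nat.factorial_succ]
    push_cast; ring

/-- The multilinear forms attached to the partial derivatives of `p`. -/
def polar (p : MvPolynomial (Fin n) R) (m : ℕ) (i : Fin n) (y : ℕ → Fin n → R) : R :=
  eval 0 (pderiv i (iterD y p m))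

theorem polar_map {S : Type*} [CommRing S] (φ : R →+* S) (p : MvPolynomial (Fin n) R) (m : ℕ)
    (i : Fin n) (y : ℕ → Fin n → R) :
    φ (polar p m i y) = polar (map φ p) m i (fun t k => φ (y t k)) := by
  rw [polar, polar, ← iterD_map, pderiv_map, eval_map]
  have := eval₂_comp_left φ (RingHom.id R) 0 (pderiv i (iterD y p m))
  simp only [RingHom.comp_id] at this
  rw [eval, coe_eval₂Hom, this]
  congr 1
  ext j; simp

theorem polar_const {p : MvPolynomial (Fin n) R} {m : ℕ} (hp : p.IsHomogeneous (m + 1)) (i : Fin n)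
    (y : Fin n → R) : polar p m i (fun _ => y) = m.factorial * eval y (pderiv i p) := by
  rw [polar, pderiv_iterD]
  exact eval_iterD_const (by simpa using hp.pderiv (i := i)) y

theorem polar_congr {y z : ℕ → Fin n → R} {m : ℕ} (h : ∀ t < m, y t = z t)
    (p : MvPolynomial (Fin n) R) (i : Fin n) : polar p m i y = polar p m i z := by
  rw [polar, polar, iterD_congr h]

theorem exists_iterD_bound (m : ℕ) (p : MvPolynomial (Fin n) ℤ) :
    ∃ c : ℝ, 0 ≤ c ∧ ∀ (y : ℕ → Fin n → ℤ) (Y : ℕ → ℝ), (∀ t < m, ∀ i, |(y t i : ℝ)| ≤ Y t) →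
      |((eval 0 (iterD y p m) : ℤ) : ℝ)| ≤ c * ∏ t ∈ Finset.range m, Y t := by
  induction m generalizing p with
  | zero => exact ⟨|((eval 0 p : ℤ) : ℝ)|, abs_nonneg _, fun y Y _ => by simp [iterD]⟩
  | succ m ih =>
    choose c hc0 hc using fun i => ih (pderiv i p)
    refine ⟨∑ i, c i, Finset.sum_nonneg fun i _ => hc0 i, fun y Y hy => ?_⟩
    rw [iterD, dirD_iterD, dirD_apply, iterD_sum, map_sum, Int.cast_sum]
    refine (Finset.abs_sum_le_sum_abs _ _).trans ?_
    rw [Finset.prod_range_succ, Finset.sum_mul]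
    refine Finset.sum_le_sum fun i _ => ?_
    rw [map_mul, eval_C, Int.cast_mul, abs_mul]
    have h1 := hy m (by omega) i
    have h2 := hc i y Y fun t ht => hy t (by omega)
    calc _ ≤ Y m * (c i * ∏ t ∈ Finset.range m, Y t) :=
          mul_le_mul h1 h2 (abs_nonneg _) ((abs_nonneg _).trans h1)
      _ = _ := by ring

theorem exists_polar_bound (m : ℕ) (p : MvPolynomial (Fin n) ℤ) :
    ∃ c : ℝ, 0 ≤ c ∧ ∀ (y : ℕ → Fin n → ℤ) (Y : ℕ → ℝ), (∀ t < m, ∀ i, |(y t i : ℝ)| ≤ Y t) →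
      ∀ i, |((polar p m i y : ℤ) : ℝ)| ≤ c * ∏ t ∈ Finset.range m, Y t := by
  choose c hc0 hc using fun i => exists_iterD_bound m (pderiv i p)
  refine ⟨∑ i, c i, Finset.sum_nonneg fun i _ => hc0 i, fun y Y hy i => ?_⟩
  rw [polar, pderiv_iterD]
  refine (hc i y Y hy).trans ?_
  gcongr
  · exact Finset.prod_nonneg fun t ht => by
      rcases isEmpty_or_nonempty (Fin n) with h | ⟨⟨i⟩⟩
      · exact isEmptyElim i
      · exact (abs_nonneg _).trans (hy t (Finset.mem_range.1 ht) i)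
  · exact Finset.single_le_sum (fun i _ => hc0 i) (Finset.mem_univ i)

/-- Polynomials all of whose monomials have degree at most `m - k`. -/
def degLe (n : ℕ) (R : Type*) [CommRing R] (k m : ℕ) : Submodule R (MvPolynomial (Fin n) R) :=
  restrictSupport R {s | s.degree + k ≤ m}

/-- The difference `p(x + h) - p(x)`. -/
def dif (h : Fin n → R) : MvPolynomial (Fin n) R →ₗ[R] MvPolynomial (Fin n) R :=
  (aeval fun i => X i + C (h i)).toLinearMap - LinearMap.id

theorem eval_dif (h : Fin n → R) (p : MvPolynomial (Fin n) R) (x : Fin n → R) :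
    eval x (dif h p) = eval (x + h) p - eval x p := by
  simp only [dif, LinearMap.sub_apply, AlgHom.toLinearMap_apply, LinearMap.id_apply, map_sub]
  congr 1
  rw [← coe_aeval_eq_eval, ← coe_aeval_eq_eval, RingHom.coe_coe, RingHom.coe_coe,
    ← AlgHom.comp_apply]
  congr 1
  refine MvPolynomial.algHom_ext fun i => ?_
  simp

theorem dif_mul_X (h : Fin n → R) (p : MvPolynomial (Fin n) R) (i : Fin n) :
    dif h (p * X i) = dif h p * X i + C (h i) * p + C (h i) * dif h p := by
  simp only [dif, LinearMap.sub_apply, AlgHom.toLinearMap_apply, LinearMap.id_apply, map_mul, aeval_X]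
  ring

theorem degLe_mono {k k' m m' : ℕ} (h : m + k' ≤ m' + k) : degLe n R k m ≤ degLe n R k' m' := by
  refine restrictSupport_mono R fun s hs => ?_
  simp only [Set.mem_ofPred_eq] at hs ⊢
  omega

theorem mul_X_mem_degLe {k m : ℕ} {p : MvPolynomial (Fin n) R} (hp : p ∈ degLe n R k m) (i : Fin n) :
    p * X i ∈ degLe n R k (m + 1) := by
  rw [degLe, mem_restrictSupport_iff] at hp ⊢
  rw [support_mul_X]
  intro s hs
  simp only [Finset.coe_map, Set.mem_image, Finset.mem_coe] at hs
  obtain ⟨t, ht, rfl⟩ := hs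
  have := hp ht
  simp only [Set.mem_ofPred_eq, addRightEmbedding_apply, map_add, Finsupp.degree_single] at this ⊢
  omega

theorem C_mul_mem_degLe {k m : ℕ} {p : MvPolynomial (Fin n) R} (hp : p ∈ degLe n R k m) (a : R) :
    C a * p ∈ degLe n R k m := by
  rw [← smul_eq_C_mul]; exact Submodule.smul_mem _ _ hp

theorem dif_monomial_mem (h : Fin n → R) (m : ℕ) (s : Fin n →₀ ℕ) (hs : s.degree = m) :
    dif h (monomial s 1) ∈ degLe n R 1 m ∧
      dif h (monomial s 1) - dirD h (monomial s 1) ∈ degLe n R 2 m := by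
  induction m generalizing s with
  | zero =>
    have : s = 0 := (Finsupp.degree_eq_zero_iff s).1 hs
    subst this
    have h1 : dif h (monomial 0 (1 : R)) = 0 := by simp [dif]
    have h2 : dirD h (monomial 0 (1 : R)) = 0 := by simp
    rw [h1, h2, sub_zero]
    exact ⟨zero_mem _, zero_mem _⟩
  | succ m ih =>
    have : s ≠ 0 := by rintro rfl; simp at hs
    obtain ⟨i, hi⟩ := Finsupp.ne_iff.1 this
    have hi' : Finsupp.single i 1 ≤ s := by
      rw [Finsupp.single_le_iff]; exact Nat.one_le_iff_ne_zero.2 hi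
    obtain ⟨t, rfl⟩ := exists_add_of_le hi'
    rw [map_add, Finsupp.degree_single] at hs
    have ht : t.degree = m := by omega
    obtain ⟨h1, h2⟩ := ih t ht
    have hm : monomial (Finsupp.single i 1 + t) (1 : R) = monomial t 1 * X i := by
      rw [X, monomial_mul, add_comm, mul_one]
    have h0 : monomial t (1 : R) ∈ degLe n R 0 m :=
      (monomial_mem_restrictSupport R).2 (Or.inl (by simp [ht]))
    rw [hm, dif_mul_X, Derivation.leibniz, dirD_X]
    refine ⟨?_, ?_⟩
    · refine add_mem (add_mem (mul_X_mem_degLe h1 i) (C_mul_mem_degLe (degLe_mono (by omega) h0) _))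
        (C_mul_mem_degLe (degLe_mono (by omega) h1) _)
    · have : dif h (monomial t 1) * X i + C (h i) * monomial t 1 + C (h i) * dif h (monomial t 1) -
          ((monomial t 1 : MvPolynomial (Fin n) R) • (C (h i) : MvPolynomial (Fin n) R) + (X i : MvPolynomial (Fin n) R) • dirD h (monomial t 1)) =
          (dif h (monomial t 1) - dirD h (monomial t 1)) * X i + C (h i) * dif h (monomial t 1) := by
        simp only [smul_eq_mul]; ring
      rw [this]
      exact add_mem (mul_X_mem_degLe h2 i) (C_mul_mem_degLe (degLe_mono (by omega) h1) _)

theorem dif_mem (h : Fin n → R) {k m : ℕ} {p : MvPolynomial (Fin n) R} (hp : p ∈ degLe n R k m) :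
    dif h p ∈ degLe n R (k + 1) m ∧ dif h p - dirD h p ∈ degLe n R (k + 2) m := by
  rw [degLe, restrictSupport_eq_span] at hp
  induction hp using Submodule.span_induction with
  | mem x hx =>
    obtain ⟨s, hs, rfl⟩ := hx
    simp only [Set.mem_ofPred_eq] at hs
    obtain ⟨h1, h2⟩ := dif_monomial_mem (R := R) h _ s rfl
    exact ⟨degLe_mono (by omega) h1, degLe_mono (by omega) h2⟩
  | zero => simp
  | add x y _ _ hx hy =>
    refine ⟨by rw [map_add]; exact add_mem hx.1 hy.1, ?_⟩
    rw [map_add, map_add, add_sub_add_comm]; exact add_mem hx.2 hy.2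
  | smul a x _ hx =>
    refine ⟨by rw [map_smul]; exact Submodule.smul_mem _ _ hx.1, ?_⟩
    rw [map_smul, Derivation.map_smul, ← smul_sub]; exact Submodule.smul_mem _ _ hx.2

theorem dirD_mem (h : Fin n → R) {k m : ℕ} {p : MvPolynomial (Fin n) R} (hp : p ∈ degLe n R k m) :
    dirD h p ∈ degLe n R (k + 1) m := by
  obtain ⟨h1, h2⟩ := dif_mem h hp
  have := sub_mem h1 (degLe_mono (by omega) h2 : _ ∈ degLe n R (k + 1) m)
  simpa using this

theorem eval_of_mem_degLe_one {k : ℕ} {p : MvPolynomial (Fin n) R} (hp : p ∈ degLe n R k (k + 1))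
    (x : Fin n → R) : eval x p = eval 0 p + ∑ i, eval 0 (pderiv i p) * x i := by
  rw [degLe, restrictSupport_eq_span] at hp
  induction hp using Submodule.span_induction with
  | mem q hq =>
    obtain ⟨s, hs, rfl⟩ := hq
    simp only [Set.mem_ofPred_eq] at hs
    rcases Nat.eq_zero_or_pos s.degree with h0 | h0
    · have : s = 0 := (Finsupp.degree_eq_zero_iff s).1 h0
      subst this; simp
    · have : s ≠ 0 := by rintro rfl; simp at h0
      obtain ⟨i, hi⟩ := Finsupp.ne_iff.1 this
      have hi' : Finsupp.single i 1 ≤ s := by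
        rw [Finsupp.single_le_iff]; exact Nat.one_le_iff_ne_zero.2 hi
      obtain ⟨t, rfl⟩ := exists_add_of_le hi'
      have : t = 0 := by
        rw [map_add, Finsupp.degree_single] at hs
        have : t.degree = 0 := by omega
        exact (Finsupp.degree_eq_zero_iff t).1 this
      subst this
      have : monomial (Finsupp.single i 1 + 0) (1 : R) = X i := by simp [X]
      simp only [this]
      simp [pderiv_X, Pi.single_apply, apply_ite]
  | zero => simp
  | add p q _ _ hp hq =>
    rw [map_add, map_add, hp, hq]
    simp only [map_add, add_mul, Finset.sum_add_distrib]; ring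
  | smul a p _ hp =>
    rw [smul_eval, hp]
    simp only [smul_eval, Derivation.map_smul, mul_add, Finset.mul_sum, mul_assoc]

theorem pderiv_of_mem_degLe_zero {k : ℕ} {p : MvPolynomial (Fin n) R} (hp : p ∈ degLe n R k k)
    (i : Fin n) : pderiv i p = 0 := by
  rw [degLe, restrictSupport_eq_span] at hp
  induction hp using Submodule.span_induction with
  | mem q hq =>
    obtain ⟨s, hs, rfl⟩ := hq
    simp only [Set.mem_ofPred_eq] at hs
    have h0 : s.degree = 0 := by omega
    have : s = 0 := (Finsupp.degree_eq_zero_iff s).1 h0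
    subst this; simp
  | zero => simp
  | add p q _ _ hp hq => rw [map_add, hp, hq, add_zero]
  | smul a p _ hp => rw [Derivation.map_smul, hp, smul_zero]

/-- The iterated differences in the directions `y 0, …, y (m - 1)`. -/
def iterDif (y : ℕ → Fin n → R) (p : MvPolynomial (Fin n) R) : ℕ → MvPolynomial (Fin n) R
  | 0 => p
  | m + 1 => dif (y m) (iterDif y p m)

theorem iterDif_congr {y z : ℕ → Fin n → R} {m : ℕ} (h : ∀ t < m, y t = z t)
    (p : MvPolynomial (Fin n) R) : iterDif y p m = iterDif z p m := by
  induction m with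
  | zero => rfl
  | succ m ih => rw [iterDif, iterDif, ih fun t ht => h t (by omega), h m (by omega)]

theorem iterDif_mem {d : ℕ} (y : ℕ → Fin n → R) {p : MvPolynomial (Fin n) R}
    (hp : p ∈ degLe n R 0 d) (m : ℕ) : iterD y p m ∈ degLe n R m d ∧
      iterDif y p m - iterD y p m ∈ degLe n R (m + 1) d := by
  induction m with
  | zero => exact ⟨hp, by simp [iterDif, iterD]⟩
  | succ m ih =>
    refine ⟨dirD_mem _ ih.1, ?_⟩
    have h1 := (dif_mem (y m) ih.1).2
    have h2 := (dif_mem (y m) ih.2).1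
    have := add_mem h1 (degLe_mono (by omega) h2 : _ ∈ degLe n R (m + 2) d)
    rw [map_sub] at this
    rw [iterDif, iterD]
    convert this using 1
    ring

theorem mem_degLe_of_isHomogeneous {d : ℕ} {p : MvPolynomial (Fin n) R} (hp : p.IsHomogeneous d) :
    p ∈ degLe n R 0 d := by
  rw [degLe, mem_restrictSupport_iff]
  intro s hs
  have := hp (mem_support_iff.1 hs)
  have h2 : s.degree = d := by
    rw [Finsupp.degree_eq_weight_one]
    exact this
  simp [h2]

theorem eval_iterDif_sub {j : ℕ} (y : ℕ → Fin n → R) {p : MvPolynomial (Fin n) R}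
    (hp : p.IsHomogeneous (j + 2)) (w x : Fin n → R) :
    eval (x + w) (iterDif y p j) - eval x (iterDif y p j) =
      eval w (iterDif y p j) - eval 0 (iterDif y p j) +
        ∑ i, eval 0 (pderiv i (dirD w (iterD y p j))) * x i := by
  obtain ⟨h1, h2⟩ := iterDif_mem y (mem_degLe_of_isHomogeneous hp) j
  have h3 := (dif_mem w h1).2
  have h4 := (dif_mem w h2).1
  have h5 := add_mem h3 h4
  rw [map_sub] at h5
  have h6 : dif w (iterDif y p j) - dirD w (iterD y p j) ∈ degLe n R (j + 2) (j + 2) := by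
    convert h5 using 1; ring
  have h7 := dirD_mem w h1
  have h8 := add_mem (degLe_mono (by omega) h6 : _ ∈ degLe n R (j + 1) (j + 2)) h7
  rw [sub_add_cancel] at h8
  have h9 := eval_of_mem_degLe_one h8 x
  rw [eval_dif, eval_dif, zero_add] at h9
  rw [h9]
  congr 1
  refine Finset.sum_congr rfl fun i _ => ?_
  have h10 := pderiv_of_mem_degLe_zero h6 i
  rw [map_sub, sub_eq_zero] at h10
  rw [h10]

end Differences

section Nested

variable {n : ℕ}

theorem sum_ite_sq_le {ι : Type*} [Fintype ι] (Q : ι → Prop) {m : ι → ℝ} (hm : ∀ e, 0 ≤ m e) :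
    (∑ e, if Q e then m e ^ 2 else 0) ≤ (∑ e, if Q e then m e else 0) ^ 2 := by
  have h : ∀ e, (if Q e then m e ^ 2 else 0) = (if Q e then m e else 0) ^ 2 := by
    intro e; split_ifs <;> simp
  simp_rw [h]
  exact Finset.sum_sq_le_sq_sum_of_nonneg fun e _ => by split_ifs <;> simp [hm]

theorem nested_vdc {j : ℕ} {P : ℝ} (hP : 1 ≤ P) {M : ℕ} (hM : 1 ≤ M) (b : ℕ → ℕ)
    (hb : ∀ i < j, (b i * (M ^ 2 ^ (i + 1) : ℕ) : ℝ) ≤ P) {ι : Type*} [Fintype ι]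
    (Q : ι → ℕ → (ℕ → Fin n → ℤ) → Prop) (a : ι → ℕ → ℕ) {D : ℝ} (hD : 1 ≤ D)
    (hdens : ∀ e, ∀ i < j, ∀ y, (((boxIoo n (M ^ 2 ^ (i + 1))).filter
      fun k => Q e (i + 1) (Function.update y i k)).card : ℝ) ≤
      if Q e i y then D * ((M ^ 2 ^ (i + 1) : ℕ) : ℝ) ^ n * ((M : ℝ)⁻¹) ^ (2 ^ (i + 1) * a e i) else 0)
    (G : ℕ → (ℕ → Fin n → ℤ) → (Fin n → ℤ) → ℂ) (hG1 : ∀ i y x, ‖G i y x‖ ≤ 1)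
    (hG : ∀ i < j, ∀ y k x, G (i + 1) (Function.update y i k) x =
      G i y (x + (b i : ℤ) • k) * (starRingEnd ℂ) (G i y x)) {U : ℝ} (hU : 1 ≤ U)
    (hlast : ∀ y, (∀ t < j, y t ∈ boxIoo n (M ^ 2 ^ (t + 1))) → ∀ c, ‖gsum P c (G j y)‖ ≤
      P ^ n * U * ∑ e, if Q e j y then ((M : ℝ)⁻¹) ^ (2 ^ j * a e j) else 0)
    (s i : ℕ) (hi : i + s = j) (y : ℕ → Fin n → ℤ)
    (hy : ∀ t < i, y t ∈ boxIoo n (M ^ 2 ^ (t + 1))) (c : Fin n → ℝ) :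
    ‖gsum P c (G i y)‖ ≤ P ^ n * ((thetaC ^ n * Real.exp (2 * Real.pi * n) * D) ^ s * U) *
      ∑ e, if Q e i y then ((M : ℝ)⁻¹) ^ (2 ^ i * ∑ t ∈ Finset.Ico i (j + 1), a e t) else 0 := by
  have hM0 : (0 : ℝ) < M := by exact_mod_cast hM
  have hT : 1 ≤ thetaC ^ n := one_le_pow₀ one_le_thetaC
  have hE : 1 ≤ Real.exp (2 * Real.pi * n) := Real.one_le_exp (by positivity)
  set K := thetaC ^ n * Real.exp (2 * Real.pi * n) * D with hK
  have hTE : 1 ≤ thetaC ^ n * Real.exp (2 * Real.pi * n) := one_le_mul_of_one_le_of_one_le hT hE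
  have hK1 : 1 ≤ K := one_le_mul_of_one_le_of_one_le hTE hD
  induction s generalizing i y c with
  | zero =>
    obtain rfl : i = j := by omega
    simpa using hlast y hy c
  | succ s ih =>
    have hij : i < j := by omega
    set H := M ^ 2 ^ (i + 1) with hH
    have hH0 : 0 < H := by positivity
    have hH0' : (0 : ℝ) < H := by exact_mod_cast hH0
    have hUs : 1 ≤ K ^ s * U := one_le_mul_of_one_le_of_one_le (one_le_pow₀ hK1) hU
    set w : ι → ℝ := fun e => ((M : ℝ)⁻¹) ^ (2 ^ (i + 1) * ∑ t ∈ Finset.Ico (i + 1) (j + 1), a e t)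
    have hw0 : ∀ e, 0 ≤ w e := fun e => by positivity
    set m : ι → ℝ := fun e => ((M : ℝ)⁻¹) ^ (2 ^ i * ∑ t ∈ Finset.Ico i (j + 1), a e t) with hm
    have hm0 : ∀ e, 0 ≤ m e := fun e => by positivity
    have hmw : ∀ e, ((M : ℝ)⁻¹) ^ (2 ^ (i + 1) * a e i) * w e = m e ^ 2 := by
      intro e
      have hs := Finset.sum_eq_sum_Ico_succ_bot (show i < j + 1 by omega) fun t => a e t
      rw [hm, ← pow_add, ← pow_mul, ← mul_add, hs]
      congr 1; ring
    have hv := vdc hP c (hG1 i y) hH0 (hb i hij)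
      (fun k => P ^ n * (K ^ s * U) * ∑ e, if Q e (i + 1) (Function.update y i k) then w e else 0)
      (fun k => by
        have : 0 ≤ ∑ e, if Q e (i + 1) (Function.update y i k) then w e else 0 :=
          Finset.sum_nonneg fun e _ => by split_ifs <;> simp [hw0]
        positivity)
      (fun k hk c' => by
        have := ih (i + 1) (by omega) (Function.update y i k) (fun t ht => by
          rcases eq_or_ne t i with rfl | hti
          · simpa using hk
          · rw [Function.update_of_ne hti]; exact hy t (by omega)) c'
        convert this using 3
        funext x; exact (hG i hij y k x).symm)
    have hsum : ∑ k ∈ boxIoo n H, (P ^ n * (K ^ s * U) *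
        ∑ e, if Q e (i + 1) (Function.update y i k) then w e else 0) ≤
        P ^ n * (K ^ s * U) * (D * (H : ℝ) ^ n * (∑ e, if Q e i y then m e else 0) ^ 2) := by
      rw [← Finset.mul_sum]
      gcongr
      rw [Finset.sum_comm]
      calc ∑ e, ∑ k ∈ boxIoo n H, (if Q e (i + 1) (Function.update y i k) then w e else 0)
          = ∑ e, (((boxIoo n H).filter
              fun k => Q e (i + 1) (Function.update y i k)).card : ℝ) * w e := by
            refine Finset.sum_congr rfl fun e _ => ?_
            rw [← Finset.sum_filter, Finset.sum_const, nsmul_eq_mul]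
        _ ≤ ∑ e, (if Q e i y then D * (H : ℝ) ^ n * ((M : ℝ)⁻¹) ^ (2 ^ (i + 1) * a e i) else 0) * w e := by
            exact Finset.sum_le_sum fun e _ => mul_le_mul_of_nonneg_right (hdens e i hij y) (hw0 e)
        _ = D * (H : ℝ) ^ n * ∑ e, if Q e i y then m e ^ 2 else 0 := by
            rw [Finset.mul_sum]
            refine Finset.sum_congr rfl fun e _ => ?_
            split_ifs
            · rw [← hmw]; ring
            · simp
        _ ≤ _ := by
            gcongr
            exact sum_ite_sq_le _ hm0
    set sm := ∑ e, if Q e i y then m e else 0 with hsm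
    have hsm0 : 0 ≤ sm := Finset.sum_nonneg fun e _ => by split_ifs <;> simp [hm0]
    have hP0 : 0 < P := by linarith
    refine (sq_le_sq₀ (norm_nonneg _) (by positivity)).1 ?_
    calc ‖gsum P c (G i y)‖ ^ 2 ≤ (thetaC * P) ^ n * (Real.exp (2 * Real.pi * n) *
          (((H : ℝ) ^ n)⁻¹ * (P ^ n * (K ^ s * U) * (D * (H : ℝ) ^ n * sm ^ 2)))) := by
          refine hv.trans ?_
          have := one_le_thetaC
          gcongr
      _ = (P ^ n) ^ 2 * (K * (K ^ s * U)) * sm ^ 2 := by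
          rw [hK]; field_simp; ring
      _ ≤ (P ^ n) ^ 2 * (K * (K ^ s * U)) ^ 2 * sm ^ 2 := by
          gcongr
          exact le_self_pow₀ (one_le_mul_of_one_le_of_one_le hK1 hUs) (by norm_num)
      _ = _ := by rw [pow_succ]; ring

end Nested

section Trees

variable {n : ℕ}

/-- A finite set of integer vectors whose coordinates take few values once the preceding ones are
fixed is small. -/
theorem card_le_prod_of_fibers (K : Finset (Fin n → ℤ)) (N : Fin n → ℕ)
    (h : ∀ k, ∀ x ∈ K, ((K.filter fun y => ∀ i < k, y i = x i).image fun y => y k).card ≤ N k) :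
    K.card ≤ ∏ k, N k := by
  set f : ℕ → (Fin n → ℤ) → (Fin n → ℤ) := fun m x i => if (i : ℕ) < m then x i else 0 with hf
  have key : ∀ m ≤ n, (K.image (f m)).card ≤ ∏ k : Fin n, if (k : ℕ) < m then N k else 1 := by
    intro m
    induction m with
    | zero =>
      intro _
      simp only [Nat.not_lt_zero, if_false, Finset.prod_const_one]
      refine Finset.card_le_one.2 fun a ha b hb => ?_
      simp only [hf, Finset.mem_image] at ha hb
      obtain ⟨_, _, rfl⟩ := ha
      obtain ⟨_, _, rfl⟩ := hb
      simp
    | succ m ih =>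
      intro hm
      have hprod : (∏ k : Fin n, if (k : ℕ) < m + 1 then N k else 1) =
          N ⟨m, hm⟩ * ∏ k : Fin n, if (k : ℕ) < m then N k else 1 := by
        rw [← Finset.prod_erase_mul _ _ (Finset.mem_univ (⟨m, hm⟩ : Fin n)), mul_comm]
        rw [← Finset.prod_erase_mul (f := fun k : Fin n => if (k : ℕ) < m then N k else 1) _
          (Finset.mem_univ (⟨m, hm⟩ : Fin n))]
        simp only [Nat.lt_succ_self, if_true, lt_irrefl, if_false, mul_one]
        congr 1
        refine Finset.prod_congr rfl fun k hk => ?_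
        have : (k : ℕ) ≠ m := fun h => (Finset.ne_of_mem_erase hk) (Fin.ext h)
        have : (k : ℕ) < m + 1 ↔ (k : ℕ) < m := by omega
        simp only [this]
      rw [hprod]
      refine le_trans ?_ (Nat.mul_le_mul_left _ (ih (by omega)))
      rw [show K.image (f m) = (K.image (f (m + 1))).image (f m) by
        rw [Finset.image_image]
        refine Finset.image_congr fun x _ => ?_
        funext i
        simp only [hf, Function.comp]
        split_ifs <;> first | rfl | omega]
      refine Finset.card_le_mul_card_image _ _ fun u hu => ?_
      simp only [Finset.mem_image] at hu
      obtain ⟨v, ⟨x, hx, rfl⟩, rfl⟩ := hu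
      refine le_trans ?_ (h ⟨m, hm⟩ x hx)
      refine Finset.card_le_card_of_injOn (fun u => u ⟨m, hm⟩) ?_ ?_
      · intro u hu
        simp only [Finset.coe_filter, Finset.mem_image, Set.mem_ofPred_eq] at hu
        obtain ⟨⟨z, hz, rfl⟩, hzx⟩ := hu
        simp only [Finset.coe_image, Set.mem_image, Finset.coe_filter, Set.mem_ofPred_eq]
        refine ⟨z, ⟨hz, fun i hi => ?_⟩, by simp [hf]⟩
        have him : (i : ℕ) < m := hi
        have := congrFun hzx i
        simpa [hf, him, him.le] using this
      · intro u hu v hv huv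
        simp only [Finset.coe_filter, Finset.mem_image, Set.mem_ofPred_eq] at hu hv
        obtain ⟨⟨z, hz, rfl⟩, hzx⟩ := hu
        obtain ⟨⟨z', hz', rfl⟩, hzx'⟩ := hv
        funext i
        have h1 := congrFun (hzx.trans hzx'.symm) i
        rcases lt_trichotomy (i : ℕ) m with hi | hi | hi
        · simpa [hf, hi, hi.le] using h1
        · have : i = ⟨m, hm⟩ := Fin.ext hi
          rw [this]; exact huv
        · have h2 : ¬ (i : ℕ) < m + 1 := by omega
          simp [hf, h2]
  have h1 := key n le_rfl
  have h2 : K.image (f n) = K := by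
    have : f n = id := by funext x i; simp [hf]
    rw [this, Finset.image_id]
  rw [h2] at h1
  simpa using h1

/-- The integer points of `E` have a bounded number of choices for the coordinates outside `S` once
the preceding coordinates are fixed. -/
def TreeLike (n m : ℕ) (E : Set (ℕ → Fin n → ℤ)) (S : Finset (ℕ × Fin n)) (C : ℕ) : Prop :=
  ∀ t < m, ∀ k, (t, k) ∉ S → ∀ y : ℕ → Fin n → ℤ, ∀ T : Finset ℤ,
    (∀ c ∈ T, ∃ z ∈ E, (∀ t' < t, z t' = y t') ∧ (∀ k' < k, z t k' = y t k') ∧ z t k = c) → T.card ≤ C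

/-- `y` agrees in its first `i` blocks with an element of `E`. -/
def Extends (E : Set (ℕ → Fin n → ℤ)) (i : ℕ) (y : ℕ → Fin n → ℤ) : Prop :=
  ∃ z ∈ E, ∀ t < i, z t = y t

theorem Extends.mono {E : Set (ℕ → Fin n → ℤ)} {i : ℕ} {y : ℕ → Fin n → ℤ} {k : Fin n → ℤ}
    (h : Extends E (i + 1) (Function.update y i k)) : Extends E i y := by
  obtain ⟨z, hz, hzy⟩ := h
  refine ⟨z, hz, fun t ht => ?_⟩
  rw [hzy t (by omega), Function.update_of_ne (by omega)]

/-- The number of free coordinates in block `t`. -/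
def codim (S : Finset (ℕ × Fin n)) (t : ℕ) : ℕ := (Finset.univ.filter fun k : Fin n => (t, k) ∉ S).card

theorem card_box_extends {m C : ℕ} {E : Set (ℕ → Fin n → ℤ)} {S : Finset (ℕ × Fin n)}
    (h : TreeLike n m E S C) {i : ℕ} (hi : i < m) (y : ℕ → Fin n → ℤ) (I : Finset ℤ) :
    ((Fintype.piFinset fun _ : Fin n => I).filter
      fun k => Extends E (i + 1) (Function.update y i k)).card ≤
      C ^ codim S i * I.card ^ (n - codim S i) := by
  set K := (Fintype.piFinset fun _ : Fin n => I).filter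
      fun k => Extends E (i + 1) (Function.update y i k) with hK
  have h1 := card_le_prod_of_fibers K (fun k => if (i, k) ∉ S then C else I.card) ?_
  · refine h1.trans (le_of_eq ?_)
    rw [Finset.prod_ite, Finset.prod_const, Finset.prod_const, codim]
    congr 2
    have := Finset.card_filter_add_card_filter_not (s := (Finset.univ : Finset (Fin n)))
      (fun k => (i, k) ∉ S)
    rw [Finset.card_univ, Fintype.card_fin] at this
    omega
  · intro k x hx
    by_cases hk : (i, k) ∉ S
    · rw [if_pos hk]
      refine h i hi k hk (Function.update y i x) _ fun c hc => ?_
      simp only [Finset.mem_image, Finset.mem_filter, hK] at hc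
      obtain ⟨u, ⟨⟨_, z, hz, hzu⟩, hux⟩, rfl⟩ := hc
      have hzi : z i = u := by simpa using hzu i (by omega)
      refine ⟨z, hz, fun t ht => ?_, fun k' hk' => ?_, ?_⟩
      · rw [hzu t (by omega), Function.update_of_ne (by omega), Function.update_of_ne (by omega)]
      · rw [hzi, Function.update_self]; exact hux k' hk'
      · rw [hzi]
    · rw [if_neg hk]
      refine Finset.card_le_card fun c hc => ?_
      simp only [Finset.mem_image, Finset.mem_filter, hK, Fintype.mem_piFinset] at hc
      obtain ⟨u, ⟨⟨hu, _⟩, _⟩, rfl⟩ := hc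
      exact hu k

theorem codim_le (S : Finset (ℕ × Fin n)) (t : ℕ) : codim S t ≤ n := by
  simpa [codim] using Finset.card_filter_le (Finset.univ : Finset (Fin n)) fun k => (t, k) ∉ S

theorem card_boxIoo_extends {m C : ℕ} {E : Set (ℕ → Fin n → ℤ)} {S : Finset (ℕ × Fin n)}
    (h : TreeLike n m E S C) (hC : 1 ≤ C) {i : ℕ} (hi : i < m) (y : ℕ → Fin n → ℤ) {M : ℕ}
    (hM : 1 ≤ M) :
    (((boxIoo n (M ^ 2 ^ (i + 1))).filter
      fun k => Extends E (i + 1) (Function.update y i k)).card : ℝ) ≤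
      if Extends E i y then ((C : ℝ) ^ n * 2 ^ n) * ((M ^ 2 ^ (i + 1) : ℕ) : ℝ) ^ n *
        ((M : ℝ)⁻¹) ^ (2 ^ (i + 1) * codim S i) else 0 := by
  have hM0 : (0 : ℝ) < M := by exact_mod_cast hM
  split_ifs with hE
  · have h1 := card_box_extends h hi y (Finset.Ioo (-((M ^ 2 ^ (i + 1) : ℕ) : ℤ)) ((M ^ 2 ^ (i + 1) : ℕ) : ℤ))
    have h2 : (Finset.Ioo (-((M ^ 2 ^ (i + 1) : ℕ) : ℤ)) ((M ^ 2 ^ (i + 1) : ℕ) : ℤ)).card ≤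
        2 * M ^ 2 ^ (i + 1) := by
      rw [Int.card_Ioo]; omega
    set H := M ^ 2 ^ (i + 1) with hH
    set a := codim S i
    have ha : a ≤ n := codim_le S i
    have h3 := h1.trans (Nat.mul_le_mul_left _ (Nat.pow_le_pow_left h2 (n - a)))
    have h4 : (((boxIoo n H).filter
      fun k => Extends E (i + 1) (Function.update y i k)).card : ℝ) ≤
        (C : ℝ) ^ a * (2 * (H : ℝ)) ^ (n - a) := by exact_mod_cast h3
    refine h4.trans ?_
    have hC' : (1 : ℝ) ≤ C := by exact_mod_cast hC
    have h5 : ((M : ℝ)⁻¹) ^ (2 ^ (i + 1) * a) = ((H : ℝ) ^ a)⁻¹ := by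
      rw [hH, pow_mul, Nat.cast_pow, inv_pow, inv_pow]
    have hH0 : (0 : ℝ) < H := by rw [hH]; positivity
    rw [h5, mul_pow]
    have h6 : (H : ℝ) ^ n * ((H : ℝ) ^ a)⁻¹ = (H : ℝ) ^ (n - a) := by
      rw [pow_sub₀ _ hH0.ne' ha]
    rw [mul_assoc, h6, ← mul_assoc]
    gcongr
    · norm_num
    · omega
  · rw [Finset.filter_false_of_mem fun k _ hk => hE hk.mono]
    simp

end Trees

section WeylBound

variable {n : ℕ}

/-- The common zeros of the multilinear forms attached to `F` are covered by finitely many tree-like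
sets of codimension at least `N`. -/
def HasStrata (F : MvPolynomial (Fin n) ℤ) (m N : ℕ) : Prop :=
  ∃ (r : ℕ) (E : Fin r → Set (ℕ → Fin n → ℤ)) (S : Fin r → Finset (ℕ × Fin n)) (C : ℕ), 1 ≤ C ∧
    (∀ y, (∀ i, polar F m i y = 0) → ∃ e, y ∈ E e) ∧ (∀ e, TreeLike n m (E e) (S e) C) ∧
    ∀ e, N ≤ ∑ t ∈ Finset.range m, codim (S e) t

theorem eC_sub (x y : ℝ) : eC (x - y) = eC x * (starRingEnd ℂ) (eC y) := by
  rw [conj_eC, sub_eq_add_neg, eC_add]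

/-- The differenced phases. -/
def difPhase (α : ℝ) (F : MvPolynomial (Fin n) ℤ) (b : ℕ → ℕ) (i : ℕ) (y : ℕ → Fin n → ℤ)
    (x : Fin n → ℤ) : ℂ :=
  eC (α * ((eval x (iterDif (fun t => (b t : ℤ) • y t) F i) : ℤ) : ℝ))

theorem difPhase_succ (α : ℝ) (F : MvPolynomial (Fin n) ℤ) (b : ℕ → ℕ) (i : ℕ) (y : ℕ → Fin n → ℤ)
    (k x : Fin n → ℤ) : difPhase α F b (i + 1) (Function.update y i k) x =
      difPhase α F b i y (x + (b i : ℤ) • k) * (starRingEnd ℂ) (difPhase α F b i y x) := by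
  rw [difPhase, difPhase, difPhase, ← eC_sub, ← mul_sub, iterDif, eval_dif, Function.update_self]
  have : iterDif (fun t => (b t : ℤ) • Function.update y i k t) F i =
      iterDif (fun t => (b t : ℤ) • y t) F i :=
    iterDif_congr (fun t ht => by simp only [Function.update_of_ne (show t ≠ i by omega)]) F
  rw [this]; push_cast; ring_nf

/-- The quadratic part of the last differenced phase. -/
def hessMat (F : MvPolynomial (Fin n) ℤ) (j : ℕ) (α : ℝ) (y : ℕ → Fin n → ℤ) :
    Matrix (Fin n) (Fin n) ℝ :=
  fun i k => α * ((eval 0 (pderiv i (pderiv k (iterD y F j))) : ℤ) : ℝ)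

theorem hessMat_isSymm (F : MvPolynomial (Fin n) ℤ) (j : ℕ) (α : ℝ) (y : ℕ → Fin n → ℤ) :
    (hessMat F j α y).IsSymm := by
  refine Matrix.IsSymm.ext fun i k => ?_
  rw [hessMat, hessMat, pderiv_comm]

theorem hessMat_mulVec (F : MvPolynomial (Fin n) ℤ) (j : ℕ) (α : ℝ) (y : ℕ → Fin n → ℤ)
    (w : Fin n → ℤ) (i : Fin n) : (hessMat F j α y).mulVec (toR w) i =
      α * ((eval 0 (pderiv i (dirD w (iterD y F j))) : ℤ) : ℝ) := by
  rw [dirD_apply, map_sum, map_sum, Int.cast_sum, Finset.mul_sum]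
  simp only [Matrix.mulVec, dotProduct, hessMat]
  refine Finset.sum_congr rfl fun k _ => ?_
  rw [pderiv_C_mul, map_mul, eval_C, toR]
  push_cast; ring

theorem eval_pderiv_dirD_smul (F : MvPolynomial (Fin n) ℤ) (j : ℕ) (b : ℕ → ℕ)
    (y : ℕ → Fin n → ℤ) (w : Fin n → ℤ) (i : Fin n) :
    eval 0 (pderiv i (dirD w (iterD (fun t => (b t : ℤ) • y t) F j))) =
      (∏ t ∈ Finset.range j, (b t : ℤ)) * polar F (j + 1) i (Function.update y j w) := by
  rw [iterD_smul, Derivation.leibniz, derivation_C, smul_zero, add_zero, smul_eq_mul, pderiv_C_mul,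
    map_mul, eval_C, polar, iterD, Function.update_self,
    iterD_congr fun t ht => (Function.update_of_ne (show t ≠ j by omega) w y)]

theorem difPhase_dif {j : ℕ} {F : MvPolynomial (Fin n) ℤ} (hF : F.IsHomogeneous (j + 2)) (α : ℝ)
    (b : ℕ → ℕ) (y : ℕ → Fin n → ℤ) (w x : Fin n → ℤ) :
    difPhase α F b j y (x + w) * (starRingEnd ℂ) (difPhase α F b j y x) =
      difPhase α F b j y w * (starRingEnd ℂ) (difPhase α F b j y 0) *
      eC (∑ i, (hessMat F j α (fun t => (b t : ℤ) • y t)).mulVec (toR w) i * x i) := by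
  simp only [difPhase]
  rw [← eC_sub, ← eC_sub, ← mul_sub, ← mul_sub, ← eC_add, ← Int.cast_sub, eval_iterDif_sub _ hF]
  congr 1
  simp only [hessMat_mulVec]
  push_cast
  rw [mul_add, Finset.mul_sum]
  simp only [mul_assoc]

theorem exists_sqrt_two_pow {x : ℝ} (hx : 1 ≤ x) : ∃ r : ℕ, x ≤ √2 ^ r ∧ √2 ^ r ≤ √2 * x := by
  obtain ⟨r, h1, h2⟩ := exists_nat_pow_near hx (show 1 < √2 by
    rw [Real.lt_sqrt] <;> norm_num)
  exact ⟨r + 1, h2.le, by rw [pow_succ, mul_comm]; gcongr⟩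

theorem card_goodSet_le {M : ℕ} (hM : 1 ≤ M) {r : ℕ} {F : MvPolynomial (Fin n) ℤ}
    {E : Fin r → Set (ℕ → Fin n → ℤ)} {S : Fin r → Finset (ℕ × Fin n)} {C : ℕ} (hC : 1 ≤ C)
    {j : ℕ} (hcov : ∀ y, (∀ i, polar F (j + 1) i y = 0) → ∃ e, y ∈ E e)
    (htree : ∀ e, TreeLike n (j + 1) (E e) (S e) C) {α : ℝ} {b : ℕ → ℕ} {y : ℕ → Fin n → ℤ}
    {W l δ : ℝ} (hW : 1 ≤ W) (hl : 1 ≤ l) (hWl : (M : ℝ) ^ 2 ^ (j + 1) ≤ √2 * (l * W))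
    (hzero : ∀ w ∈ goodSet (hessMat F j α (fun t => (b t : ℤ) • y t)) (l * W) δ,
      ∀ i, polar F (j + 1) i (Function.update y j w) = 0) :
    (W ^ n)⁻¹ * ((goodSet (hessMat F j α (fun t => (b t : ℤ) • y t)) (l * W) δ).card : ℝ) ≤
      (6 * C * l) ^ n * ∑ e, if Extends (E e) j y then
        ((M : ℝ)⁻¹) ^ (2 ^ (j + 1) * codim (S e) j) else 0 := by
  have hM0 : (0 : ℝ) < M := by exact_mod_cast hM
  set Gs := goodSet (hessMat F j α (fun t => (b t : ℤ) • y t)) (l * W) δ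
  have hsub : Gs ⊆ Finset.univ.biUnion fun e => (boxR n (l * W)).filter
      fun k => Extends (E e) (j + 1) (Function.update y j k) := by
    intro w hw
    obtain ⟨e, he⟩ := hcov _ (hzero w hw)
    simp only [Finset.mem_biUnion, Finset.mem_univ, true_and, Finset.mem_filter]
    exact ⟨e, (Finset.mem_filter.1 hw).1, _, he, fun _ _ => rfl⟩
  have hlW : 1 ≤ l * W := one_le_mul_of_one_le_of_one_le hl hW
  have hC' : (1 : ℝ) ≤ C := by exact_mod_cast hC
  have h1 : ∀ e, (W ^ n)⁻¹ * (((boxR n (l * W)).filter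
      fun k => Extends (E e) (j + 1) (Function.update y j k)).card : ℝ) ≤
      (6 * C * l) ^ n * if Extends (E e) j y then
        ((M : ℝ)⁻¹) ^ (2 ^ (j + 1) * codim (S e) j) else 0 := by
    intro e
    split_ifs with hE
    · have h2 : ((boxR n (l * W)).filter
          fun k => Extends (E e) (j + 1) (Function.update y j k)).card ≤
          C ^ codim (S e) j * (Finset.Icc (-⌊l * W⌋) ⌊l * W⌋).card ^ (n - codim (S e) j) :=
        card_box_extends (htree e) (Nat.lt_succ_self j) y (Finset.Icc (-⌊l * W⌋) ⌊l * W⌋)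
      set a := codim (S e) j
      have ha : a ≤ n := codim_le (S e) j
      have h3 : ((Finset.Icc (-⌊l * W⌋) ⌊l * W⌋).card : ℝ) ≤ 3 * (l * W) := by
        rw [Int.card_Icc]
        have h0 : 0 ≤ ⌊l * W⌋ := Int.floor_nonneg.2 (by linarith)
        have h4 : (((⌊l * W⌋ + 1 - -⌊l * W⌋).toNat : ℤ) : ℝ) = (⌊l * W⌋ : ℝ) + 1 + ⌊l * W⌋ := by
          rw [Int.toNat_of_nonneg (by omega)]; push_cast; ring
        rw [Int.cast_natCast] at h4
        rw [h4]
        linarith [Int.floor_le (l * W)]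
      have h5 : (((boxR n (l * W)).filter
          fun k => Extends (E e) (j + 1) (Function.update y j k)).card : ℝ) ≤
          (C : ℝ) ^ a * (3 * (l * W)) ^ (n - a) := by
        refine (Nat.cast_le.2 h2).trans ?_
        push_cast
        gcongr
      have h6 : ((M : ℝ)⁻¹) ^ (2 ^ (j + 1) * a) = (((M : ℝ) ^ 2 ^ (j + 1)) ^ a)⁻¹ := by
        rw [pow_mul, inv_pow, inv_pow]
      rw [h6]
      have h7 : ((M : ℝ) ^ 2 ^ (j + 1)) ^ a ≤ (2 * (l * W)) ^ a := by
        refine pow_le_pow_left₀ (by positivity) (hWl.trans ?_) a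
        gcongr
        rw [Real.sqrt_le_left] <;> norm_num
      rw [← div_eq_mul_inv, le_div_iff₀ (by positivity)]
      calc _ ≤ (W ^ n)⁻¹ * ((C : ℝ) ^ a * (3 * (l * W)) ^ (n - a)) * (2 * (l * W)) ^ a := by
            gcongr
        _ ≤ (W ^ n)⁻¹ * ((C : ℝ) ^ n * (2 * (3 * (l * W))) ^ (n - a)) * (2 * (3 * (l * W))) ^ a := by
            have hlW0 : 0 ≤ l * W := by linarith
            have h8 := pow_le_pow_right₀ hC' ha
            have h9 : (3 * (l * W)) ^ (n - a) ≤ (2 * (3 * (l * W))) ^ (n - a) :=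
              pow_le_pow_left₀ (by positivity) (by linarith) _
            have h10 : (2 * (l * W)) ^ a ≤ (2 * (3 * (l * W))) ^ a :=
              pow_le_pow_left₀ (by positivity) (by linarith) _
            exact mul_le_mul (mul_le_mul_of_nonneg_left (mul_le_mul h8 h9 (by positivity)
              (by positivity)) (by positivity)) h10 (by positivity) (by positivity)
        _ = (W ^ n)⁻¹ * (C : ℝ) ^ n * ((2 * (3 * (l * W))) ^ (n - a) * (2 * (3 * (l * W))) ^ a) := by
            ring
        _ = _ := by
            rw [← pow_add, Nat.sub_add_cancel ha, show 2 * (3 * (l * W)) = 6 * l * W by ring,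
              mul_pow (6 * l)]
            field_simp
            ring
    · rw [Finset.filter_false_of_mem fun k _ hk => hE hk.mono]
      simp
  have hcard : (Gs.card : ℝ) ≤ ∑ e, (((boxR n (l * W)).filter
      fun k => Extends (E e) (j + 1) (Function.update y j k)).card : ℝ) := by
    exact_mod_cast (Finset.card_le_card hsub).trans Finset.card_biUnion_le
  calc _ ≤ (W ^ n)⁻¹ * ∑ e, (((boxR n (l * W)).filter
      fun k => Extends (E e) (j + 1) (Function.update y j k)).card : ℝ) := by gcongr
    _ ≤ _ := by
      rw [Finset.mul_sum, Finset.mul_sum]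
      exact Finset.sum_le_sum fun e _ => h1 e

end WeylBound

section WeylBound

variable {n : ℕ}

theorem prod_two_pow (M : ℝ) (j : ℕ) :
    ∏ t ∈ Finset.range (j + 1), M ^ 2 ^ (t + 1) = M ^ (2 ^ (j + 2) - 2) := by
  rw [Finset.prod_pow_eq_pow_sum]
  congr 1
  induction j with
  | zero => simp
  | succ j ih =>
    rw [Finset.sum_range_succ, ih]
    have : 2 ≤ 2 ^ (j + 2) := by rw [pow_succ]; have := Nat.one_le_two_pow (n := j + 1); omega
    rw [show j + 1 + 1 + 1 = (j + 2) + 1 by ring, show j + 1 + 2 = (j + 2) + 1 by ring, pow_succ 2 (j + 2), pow_succ 2 (j + 1)] at *; omega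

theorem polar_eq_zero_of_mem_goodSet {F : MvPolynomial (Fin n) ℤ} {j : ℕ} {X : ℝ}
    (hX : ∀ (y : ℕ → Fin n → ℤ) (Y : ℕ → ℝ), (∀ t < j + 1, ∀ i, |(y t i : ℝ)| ≤ Y t) →
      ∀ i, |((polar F (j + 1) i y : ℤ) : ℝ)| ≤ X * ∏ t ∈ Finset.range (j + 1), Y t)
    {M : ℕ} {α δ R δ' : ℝ} {b : ℕ → ℕ} (hAC : ∀ B v : ℤ, |(B : ℝ)| ≤ X * (M : ℝ) ^ (2 ^ (j + 2) - 2) →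
      |α * ((∏ t ∈ Finset.range j, (b t : ℝ)) * B) - v| ≤ δ → B = 0) (hδ : δ' ≤ δ)
    (hR : R ≤ (M : ℝ) ^ 2 ^ (j + 1)) {y : ℕ → Fin n → ℤ}
    (hy : ∀ t < j, y t ∈ boxIoo n (M ^ 2 ^ (t + 1))) {w : Fin n → ℤ}
    (hw : w ∈ goodSet (hessMat F j α (fun t => (b t : ℤ) • y t)) R δ') (i : Fin n) :
    polar F (j + 1) i (Function.update y j w) = 0 := by
  obtain ⟨hw1, v, hv⟩ := Finset.mem_filter.1 hw
  refine hAC _ (v i) ?_ ?_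
  · rw [← prod_two_pow]
    refine hX _ _ (fun t ht k => ?_) i
    rcases eq_or_ne t j with rfl | htj
    · rw [Function.update_self]
      exact (mem_boxR.1 hw1 k).trans hR
    · rw [Function.update_of_ne htj]
      have h1 := Finset.mem_Ioo.1 (Fintype.mem_piFinset.1 (hy t (by omega)) k)
      have h2 : |y t k| ≤ ((M ^ 2 ^ (t + 1) : ℕ) : ℤ) := (abs_lt.2 h1).le
      exact_mod_cast h2
  · have h := hv i
    rw [hessMat_mulVec, eval_pderiv_dirD_smul] at h
    push_cast at h
    exact h.trans hδ

theorem exp_neg_sq_le {M : ℕ} (hM : 1 ≤ M) {k : ℕ} {l : ℝ} (hl : 1 ≤ l)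
    (hk : k * Real.log M ≤ l) : Real.exp (-l ^ 2) ≤ ((M : ℝ)⁻¹) ^ k := by
  have hM0 : (0 : ℝ) < M := by exact_mod_cast hM
  have : ((M : ℝ)⁻¹) ^ k = Real.exp (-(k * Real.log M)) := by
    rw [Real.exp_neg, Real.exp_nat_mul, Real.exp_log hM0, inv_pow]
  rw [this, Real.exp_le_exp]
  nlinarith

/-- `Extends`, together with a member that imposes no condition. -/
def OptExtends {r : ℕ} (E : Fin r → Set (ℕ → Fin n → ℤ)) (o : Option (Fin r)) (i : ℕ)
    (y : ℕ → Fin n → ℤ) : Prop := ∀ e ∈ o, Extends (E e) i y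

theorem optExtends_none {r : ℕ} (E : Fin r → Set (ℕ → Fin n → ℤ)) (i : ℕ) (y : ℕ → Fin n → ℤ) :
    OptExtends E none i y := by simp [OptExtends]

theorem optExtends_some {r : ℕ} (E : Fin r → Set (ℕ → Fin n → ℤ)) (e : Fin r) (i : ℕ)
    (y : ℕ → Fin n → ℤ) : OptExtends E (some e) i y ↔ Extends (E e) i y := by simp [OptExtends]

theorem norm_gsum_difPhase_le {j r N C M : ℕ} {F : MvPolynomial (Fin n) ℤ}
    (hF : F.IsHomogeneous (j + 2)) (hM : 1 ≤ M)
    {E : Fin r → Set (ℕ → Fin n → ℤ)} {S : Fin r → Finset (ℕ × Fin n)} (hC : 1 ≤ C)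
    (hcov : ∀ y, (∀ i, polar F (j + 1) i y = 0) → ∃ e, y ∈ E e)
    (htree : ∀ e, TreeLike n (j + 1) (E e) (S e) C) {P l α : ℝ} (hP : 1 ≤ P) (hl : 1 ≤ l)
    (hlM : √2 * l ≤ (M : ℝ) ^ 2 ^ (j + 1)) (hkl : (2 ^ (j + 1) * N : ℕ) * Real.log M ≤ l)
    (hMP : (M : ℝ) ^ 2 ^ (j + 1) ≤ P) {b : ℕ → ℕ} {y : ℕ → Fin n → ℤ}
    (hzero : ∀ R ≤ (M : ℝ) ^ 2 ^ (j + 1),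
      ∀ w ∈ goodSet (hessMat F j α (fun t => (b t : ℤ) • y t)) R (R / P ^ 2),
      ∀ i, polar F (j + 1) i (Function.update y j w) = 0) (c : Fin n → ℝ) :
    ‖gsum P c (difPhase α F b j y)‖ ≤
      P ^ n * (√2 ^ n * (thetaC ^ n * thetaC ^ n) * (6 * C * l) ^ n) *
      ((∑ e, if Extends (E e) j y then ((M : ℝ)⁻¹) ^ (2 ^ j * codim (S e) j) else 0) +
        ((M : ℝ)⁻¹) ^ (2 ^ j * N)) := by
  have hM0 : (0 : ℝ) < M := by exact_mod_cast hM
  have hC' : (1 : ℝ) ≤ C := by exact_mod_cast hC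
  have hP0 : 0 < P := by linarith
  set W' := (M : ℝ) ^ 2 ^ (j + 1) with hW'
  have hW'0 : 0 < W' := by positivity
  have h2 : (0 : ℝ) < √2 := by positivity
  obtain ⟨s, hs1, hs2⟩ := exists_sqrt_two_pow (x := P * l / W') (by
    rw [one_le_div hW'0]; nlinarith)
  set W := P / √2 ^ s with hW
  have hs0 : 0 < √2 ^ s := by positivity
  have hlW : l * W ≤ W' := by
    rw [div_le_iff₀ hW'0] at hs1
    rw [hW, ← mul_div_assoc, div_le_iff₀ hs0]; linarith
  have hWl : W' ≤ √2 * (l * W) := by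
    rw [hW, ← mul_div_assoc, ← mul_div_assoc, le_div_iff₀ hs0]
    calc W' * √2 ^ s ≤ W' * (√2 * (P * l / W')) := by gcongr
      _ = √2 * (l * P) := by field_simp
  have hW1 : 1 ≤ W := by
    have : √2 * l * 1 ≤ √2 * l * W := by linarith
    exact le_of_mul_le_mul_left this (by positivity)
  have hWP : W ≤ P := div_le_self hP0.le (one_le_pow₀ (by
    rw [Real.one_le_sqrt]; norm_num))
  have hWr : W ^ 2 * 2 ^ s = P ^ 2 := by
    have h3 : (√2 ^ s) ^ 2 = 2 ^ s := by
      rw [← pow_mul, mul_comm, pow_mul, Real.sq_sqrt (by norm_num)]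
    rw [hW, div_pow, h3]; field_simp
  have hsh := weyl_shrink hW1 hWP (by linarith : 0 ≤ l) hWr c (g := difPhase α F b j y)
    (fun x => (norm_eC _).le) (hessMat_isSymm F j α fun t => (b t : ℤ) • y t)
    (fun w => difPhase α F b j y w * (starRingEnd ℂ) (difPhase α F b j y 0))
    (fun w => by rw [norm_mul, RCLike.norm_conj, difPhase, difPhase, norm_eC, norm_eC, one_mul])
    (fun w x => difPhase_dif hF α b y w x)
  have hgd := card_goodSet_le (α := α) (b := b) (y := y) (W := W) (l := l) (δ := l * W / P ^ 2)
    hM hC hcov htree hW1 hl hWl (hzero _ hlW)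
  have hex := exp_neg_sq_le hM hl hkl
  have hL1 : 1 ≤ (6 * C * l) ^ n := one_le_pow₀ (by nlinarith)
  have hA1 : 1 ≤ √2 ^ n * (thetaC ^ n * thetaC ^ n) :=
    one_le_mul_of_one_le_of_one_le (one_le_pow₀ (by rw [Real.one_le_sqrt]; norm_num))
      (one_le_mul_of_one_le_of_one_le (one_le_pow₀ one_le_thetaC) (one_le_pow₀ one_le_thetaC))
  set A := √2 ^ n * (thetaC ^ n * thetaC ^ n)
  set L := (6 * C * l) ^ n
  have hsq := sum_ite_sq_le (fun o : Option (Fin r) => OptExtends E o j y)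
    (m := fun o => o.elim (((M : ℝ)⁻¹) ^ (2 ^ j * N)) fun e => ((M : ℝ)⁻¹) ^ (2 ^ j * codim (S e) j))
    (fun o => by cases o <;> simp only [Option.elim] <;> positivity)
  simp only [Fintype.sum_option, optExtends_none, optExtends_some, Option.elim, if_true, ← pow_mul, mul_right_comm _ _ 2,
    ← pow_succ] at hsq
  set T₂ := ∑ e, if Extends (E e) j y then ((M : ℝ)⁻¹) ^ (2 ^ (j + 1) * codim (S e) j) else 0
  set T₁ := ∑ e, if Extends (E e) j y then ((M : ℝ)⁻¹) ^ (2 ^ j * codim (S e) j) else 0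
  have hT₁ : 0 ≤ T₁ := Finset.sum_nonneg fun e _ => by split_ifs <;> positivity
  have hT₂ : 0 ≤ T₂ := Finset.sum_nonneg fun e _ => by split_ifs <;> positivity
  refine le_of_sq_le_sq ?_ (by positivity)
  have hm : 0 < ((M : ℝ)⁻¹) ^ (2 ^ (j + 1) * N) := by positivity
  have hAL : 1 ≤ A * L := one_le_mul_of_one_le_of_one_le hA1 hL1
  calc _ ≤ _ := hsh
    _ ≤ (P ^ n) ^ 2 * A * (L * T₂ + L * ((M : ℝ)⁻¹) ^ (2 ^ (j + 1) * N)) := by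
      gcongr
      exact hex.trans (le_mul_of_one_le_left hm.le hL1)
    _ = (P ^ n) ^ 2 * (A * L) * (((M : ℝ)⁻¹) ^ (2 ^ (j + 1) * N) + T₂) := by ring
    _ ≤ (P ^ n) ^ 2 * ((A * L) * (A * L)) * (((M : ℝ)⁻¹) ^ (2 ^ j * N) + T₁) ^ 2 := by
      generalize A * L = B at *
      have hB : B ≤ B * B := by nlinarith
      exact mul_le_mul (by gcongr) hsq (by positivity) (by positivity)
    _ = _ := by ring

/-- Weyl's inequality in the form of a nested van der Corput argument: if `α` is badly approximable
in the required range, the exponential sum saves a power of the differencing parameter. -/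
theorem weyl_bound {j N : ℕ} {F : MvPolynomial (Fin n) ℤ} (hF : F.IsHomogeneous (j + 2))
    (hS : HasStrata F (j + 1) N) : ∃ K X : ℝ, 1 ≤ K ∧ 0 ≤ X ∧ ∀ (P : ℝ) (M : ℕ) (α : ℝ) (b : ℕ → ℕ),
      1 ≤ P → 1 ≤ M → (∀ i < j, (b i : ℝ) * (M : ℝ) ^ 2 ^ (i + 1) ≤ P) →
      (M : ℝ) ^ 2 ^ (j + 1) ≤ P →
      (∀ B v : ℤ, |(B : ℝ)| ≤ X * (M : ℝ) ^ (2 ^ (j + 2) - 2) →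
        |α * ((∏ t ∈ Finset.range j, (b t : ℝ)) * B) - v| ≤ (M : ℝ) ^ 2 ^ (j + 1) / P ^ 2 → B = 0) →
      ∀ c, ‖gsum P c fun x => eC (α * ((eval x F : ℤ) : ℝ))‖ ≤
        K * (1 + Real.log M) ^ n * P ^ n * ((M : ℝ)⁻¹) ^ N := by
  obtain ⟨r, E, S, C, hC, hcov, htree, hcd⟩ := hS
  obtain ⟨X, hX0, hX⟩ := exists_polar_bound (j + 1) F
  set K₀ : ℝ := 1 + (2 ^ (j + 1) * N : ℕ) with hK₀
  have hK₀1 : 1 ≤ K₀ := by rw [hK₀]; linarith [Nat.cast_nonneg (α := ℝ) (2 ^ (j + 1) * N)]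
  have hC' : (1 : ℝ) ≤ C := by exact_mod_cast hC
  set A := √2 ^ n * (thetaC ^ n * thetaC ^ n) with hA
  set D : ℝ := (C : ℝ) ^ n * 2 ^ n with hD
  have hA1 : 1 ≤ A :=
    one_le_mul_of_one_le_of_one_le (one_le_pow₀ (by rw [Real.one_le_sqrt]; norm_num))
      (one_le_mul_of_one_le_of_one_le (one_le_pow₀ one_le_thetaC) (one_le_pow₀ one_le_thetaC))
  have hC1 : 1 ≤ (C : ℝ) ^ n := one_le_pow₀ hC'
  have hD1 : 1 ≤ D := one_le_mul_of_one_le_of_one_le hC1 (one_le_pow₀ (by norm_num))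
  have hT1 : 1 ≤ thetaC ^ n := one_le_pow₀ one_le_thetaC
  have hT0 : 0 ≤ thetaC := by linarith [one_le_thetaC]
  set V := (thetaC ^ n * Real.exp (2 * Real.pi * n) * D) ^ j with hV
  have hV0 : 0 ≤ V := by positivity
  refine ⟨thetaC ^ n * (2 * K₀) ^ N + V * (A * (6 * C * K₀) ^ n) * (r + 1), X, ?_, hX0, ?_⟩
  · have : 1 ≤ thetaC ^ n * (2 * K₀) ^ N :=
      one_le_mul_of_one_le_of_one_le hT1 (one_le_pow₀ (by linarith))
    have : 0 ≤ V * (A * (6 * C * K₀) ^ n) * (r + 1) := by positivity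
    linarith
  intro P M α b hP hM hb hMP hAC c
  have hM0 : (0 : ℝ) < M := by exact_mod_cast hM
  have hM1 : (1 : ℝ) ≤ M := by exact_mod_cast hM
  have hlog : 0 ≤ Real.log M := Real.log_nonneg hM1
  have hP0 : 0 < P := by linarith
  rw [add_mul, add_mul, add_mul]
  rcases lt_or_ge (M : ℝ) (2 * K₀) with hsmall | hbig
  · refine le_trans ?_ (le_add_of_nonneg_right (by positivity))
    refine (norm_gsum_le hP c fun x => (norm_eC _).le).trans ?_
    have h1 : 1 ≤ (1 + Real.log M) ^ n := one_le_pow₀ (by linarith)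
    have h2 : 1 ≤ (2 * K₀) ^ N * ((M : ℝ)⁻¹) ^ N := by
      rw [← mul_pow]
      exact one_le_pow₀ (by rw [← div_eq_mul_inv, one_le_div hM0]; exact hsmall.le)
    calc (thetaC * P) ^ n = thetaC ^ n * P ^ n * 1 * 1 := by ring
      _ ≤ thetaC ^ n * P ^ n * (1 + Real.log M) ^ n * ((2 * K₀) ^ N * ((M : ℝ)⁻¹) ^ N) := by gcongr
      _ = _ := by ring
  refine le_trans ?_ (le_add_of_nonneg_left (by positivity))
  set l := K₀ * (1 + Real.log M) with hl
  have hl1 : 1 ≤ l := one_le_mul_of_one_le_of_one_le hK₀1 (by linarith)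
  have hkl : (2 ^ (j + 1) * N : ℕ) * Real.log M ≤ l := by
    rw [hl, hK₀]; nlinarith [Nat.cast_nonneg (α := ℝ) (2 ^ (j + 1) * N)]
  have hlM : √2 * l ≤ (M : ℝ) ^ 2 ^ (j + 1) := by
    have h1 := Real.log_le_sub_one_of_pos hM0
    have h2 : √2 ≤ 2 := by rw [Real.sqrt_le_left] <;> norm_num
    calc √2 * l ≤ 2 * (K₀ * M) := by
          rw [hl]; gcongr; linarith
      _ = (2 * K₀) * M := by ring
      _ ≤ M * M := by gcongr
      _ = (M : ℝ) ^ 2 := by ring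
      _ ≤ _ := pow_le_pow_right₀ hM1 (by rw [pow_succ]; have := Nat.one_le_two_pow (n := j); omega)
  have hlast : ∀ y : ℕ → Fin n → ℤ, (∀ t < j, y t ∈ boxIoo n (M ^ 2 ^ (t + 1))) → ∀ c,
      ‖gsum P c (difPhase α F b j y)‖ ≤ P ^ n * (A * (6 * C * l) ^ n) *
        ∑ o : Option (Fin r), if OptExtends E o j y then ((M : ℝ)⁻¹) ^ (2 ^ j *
          (o.elim (if j = j then N else 0) fun e => codim (S e) j)) else 0 := by
    intro y hy c
    have h := norm_gsum_difPhase_le (b := b) (α := α) hF hM hC hcov htree hP hl1 hlM hkl hMP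
      (y := y) (fun R hR w hw i => polar_eq_zero_of_mem_goodSet hX hAC
        (by gcongr) hR hy hw i) c
    refine h.trans (le_of_eq ?_)
    simp only [Fintype.sum_option, optExtends_none, optExtends_some, Option.elim, if_true]
    rw [add_comm]
  have key := nested_vdc (n := n) hP hM b (j := j)
    (fun i hi => by push_cast; exact hb i hi)
    (fun (o : Option (Fin r)) i y => OptExtends E o i y)
    (fun o t => o.elim (if t = j then N else 0) fun e => codim (S e) t) hD1
    (fun o i hi y => by
      cases o with
      | some e =>
        simpa [optExtends_some] using card_boxIoo_extends (htree e) hC (show i < j + 1 by omega) y hM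
      | none =>
        simp only [optExtends_none, Option.elim, if_true, Finset.filter_true, if_neg hi.ne, mul_zero, pow_zero, mul_one]
        rw [boxIoo, Fintype.card_piFinset_const, Int.card_Ioo, Nat.cast_pow]
        have h1 : (((M ^ 2 ^ (i + 1) : ℕ) : ℤ) - -((M ^ 2 ^ (i + 1) : ℕ) : ℤ) - 1).toNat ≤
          2 * M ^ 2 ^ (i + 1) := by omega
        have h2 : (((((M ^ 2 ^ (i + 1) : ℕ) : ℤ) - -((M ^ 2 ^ (i + 1) : ℕ) : ℤ) - 1).toNat : ℕ) : ℝ) ≤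
          2 * ((M ^ 2 ^ (i + 1) : ℕ) : ℝ) := by exact_mod_cast h1
        rw [hD]
        calc _ ≤ (2 * ((M ^ 2 ^ (i + 1) : ℕ) : ℝ)) ^ n := by gcongr
          _ = 1 * 2 ^ n * ((M ^ 2 ^ (i + 1) : ℕ) : ℝ) ^ n := by ring
          _ ≤ _ := by gcongr)
    (difPhase α F b) (fun i y x => (norm_eC _).le) (fun i _ y k x => difPhase_succ α F b i y k x)
    (U := A * (6 * C * l) ^ n) (one_le_mul_of_one_le_of_one_le hA1 (one_le_pow₀ (by nlinarith)))
    hlast j 0 (by omega) (fun _ _ => 0) (fun t ht => by omega) c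
  have h0 : (fun x => eC (α * ((eval x F : ℤ) : ℝ))) = difPhase α F b 0 fun _ _ => 0 := rfl
  rw [h0]
  refine key.trans ?_
  have hsum : (∑ o : Option (Fin r), if OptExtends E o 0 (fun _ _ => 0) then
      ((M : ℝ)⁻¹) ^ (2 ^ 0 * ∑ t ∈ Finset.Ico 0 (j + 1),
        o.elim (if t = j then N else 0) fun e => codim (S e) t) else 0) ≤
      (r + 1) * ((M : ℝ)⁻¹) ^ N := by
    have h1 : ∀ o : Option (Fin r), (if OptExtends E o 0 (fun _ _ => 0) then
      ((M : ℝ)⁻¹) ^ (2 ^ 0 * ∑ t ∈ Finset.Ico 0 (j + 1),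
        o.elim (if t = j then N else 0) fun e => codim (S e) t) else 0) ≤ ((M : ℝ)⁻¹) ^ N := by
      intro o
      split_ifs
      · refine pow_le_pow_of_le_one (by positivity) (inv_le_one_of_one_le₀ hM1) ?_
        rw [pow_zero, one_mul, ← Finset.range_eq_Ico]
        cases o with
        | some e => exact hcd e
        | none => simp
      · positivity
    refine (Finset.sum_le_card_nsmul _ _ _ fun o _ => h1 o).trans (le_of_eq ?_)
    simp
  calc _ ≤ P ^ n * (V * (A * (6 * C * l) ^ n)) * ((r + 1) * ((M : ℝ)⁻¹) ^ N) := by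
        gcongr
    _ = _ := by rw [hl, ← mul_assoc (6 * (C : ℝ)), mul_pow _ (1 + Real.log M)]; ring

end WeylBound

section LinearForms

variable {n : ℕ}

attribute [local instance] MvPolynomial.gradedAlgebra

/-- Every chain of primes above `I` has length at most `s`. -/
def DimLe (I : Ideal (MvPolynomial (Fin n) ℚ)) (s : ℕ) : Prop :=
  ∀ p : LTSeries (PrimeSpectrum (MvPolynomial (Fin n) ℚ)), I ≤ p.head.asIdeal → p.length ≤ s

theorem dimLe_of_ringKrullDim {I : Ideal (MvPolynomial (Fin n) ℚ)} {s : ℕ}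
    (h : ringKrullDim (MvPolynomial (Fin n) ℚ ⧸ I) ≤ s) : DimLe I s := by
  intro p hp
  rw [ringKrullDim_quotient] at h
  let q : LTSeries (PrimeSpectrum.zeroLocus (I : Set (MvPolynomial (Fin n) ℚ))) :=
    LTSeries.mk p.length (fun i => ⟨p i, (PrimeSpectrum.mem_zeroLocus _ _).2
      (le_trans (α := Ideal _) hp (p.strictMono.monotone (Fin.zero_le i)))⟩)
      fun i k hik => p.strictMono hik
  have h1 := (Order.LTSeries.length_le_krullDim q).trans h
  exact_mod_cast h1

/-- The irrelevant ideal. -/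
def irrel (n : ℕ) : Ideal (MvPolynomial (Fin n) ℚ) := RingHom.ker (constantCoeff (R := ℚ))

theorem irrel_isMaximal : (irrel n).IsMaximal :=
  RingHom.ker_isMaximal_of_surjective _ fun c => ⟨C c, by simp⟩

theorem irrel_le_of_X_mem {J : Ideal (MvPolynomial (Fin n) ℚ)} (h : ∀ i, X i ∈ J) : irrel n ≤ J := by
  have h1 : ∀ f : MvPolynomial (Fin n) ℚ, f - C (constantCoeff f) ∈ J := fun f => by
    induction f using MvPolynomial.induction_on with
    | C a => simp
    | add p q hp hq =>
      have := J.add_mem hp hq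
      rw [map_add, C_add]
      convert this using 1; ring
    | mul_X p i _ => simpa using J.mul_mem_left p (h i)
  intro f hf
  have hf0 : constantCoeff f = 0 := hf
  simpa [hf0] using h1 f

theorem le_irrel_of_isHomogeneous {Q : Ideal (MvPolynomial (Fin n) ℚ)}
    (hQ : Q.IsHomogeneous (homogeneousSubmodule (Fin n) ℚ)) (hne : Q ≠ ⊤) : Q ≤ irrel n := by
  intro f hf
  by_contra hf0
  have h0 : ¬ constantCoeff f = 0 := hf0
  have h1 := hQ 0 hf
  have h2 : (DirectSum.decompose (homogeneousSubmodule (Fin n) ℚ) f 0 : MvPolynomial (Fin n) ℚ) =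
      homogeneousComponent 0 f := decomposition.decompose'_apply f 0
  rw [h2, homogeneousComponent_zero] at h1
  refine hne (Ideal.eq_top_of_isUnit_mem _ h1 ?_)
  exact (isUnit_iff_ne_zero.2 h0).map C

theorem isHomogeneous_of_mem_minimalPrimes {I Q : Ideal (MvPolynomial (Fin n) ℚ)}
    (hI : I.IsHomogeneous (homogeneousSubmodule (Fin n) ℚ)) (hQ : Q ∈ I.minimalPrimes) :
    Q.IsHomogeneous (homogeneousSubmodule (Fin n) ℚ) := by
  have hp : (Q.homogeneousCore (homogeneousSubmodule (Fin n) ℚ)).toIdeal.IsPrime :=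
    Ideal.IsPrime.homogeneousCore hQ.1.1
  have hle : I ≤ (Q.homogeneousCore (homogeneousSubmodule (Fin n) ℚ)).toIdeal := by
    rw [← hI.toIdeal_homogeneousCore_eq_self]
    exact Ideal.homogeneousCore_mono _ hQ.1.2
  have h := hQ.2 ⟨hp, hle⟩ (Ideal.toIdeal_homogeneousCore_le _ Q)
  rw [Ideal.IsHomogeneous.iff_eq]
  exact le_antisymm (Ideal.toIdeal_homogeneousCore_le _ Q) h

theorem exists_X_pow_mem {J : Ideal (MvPolynomial (Fin n) ℚ)}
    (h : ∀ Q ∈ J.minimalPrimes, ∀ i, X i ∈ Q) : ∃ D, ∀ i, (X i) ^ D ∈ J := by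
  have h1 : ∀ i, (X i : MvPolynomial (Fin n) ℚ) ∈ J.radical := fun i => by
    rw [← J.sInf_minimalPrimes, Submodule.mem_sInf]
    exact fun Q hQ => h Q hQ i
  choose D hD using h1
  refine ⟨∑ i, D i, fun i => ?_⟩
  rw [← Nat.sub_add_cancel (Finset.single_le_sum (f := D) (fun _ _ => Nat.zero_le _)
    (Finset.mem_univ i)), pow_add]
  exact J.mul_mem_left _ (hD i)

theorem exists_linearForm {T : Set (Ideal (MvPolynomial (Fin n) ℚ))} (hT : T.Finite)
    (h : ∀ Q ∈ T, ∃ i, X i ∉ Q) :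
    ∃ l : MvPolynomial (Fin n) ℚ, l.IsHomogeneous 1 ∧ ∀ Q ∈ T, l ∉ Q := by
  let φ : (Fin n → ℚ) →ₗ[ℚ] MvPolynomial (Fin n) ℚ := Fintype.linearCombination ℚ X
  let sub : Ideal (MvPolynomial (Fin n) ℚ) → Submodule ℚ (Fin n → ℚ) := fun Q =>
    (Q.restrictScalars ℚ).comap φ
  have h1 : ⋃ p ∈ (hT.image sub).toFinset, (p : Set (Fin n → ℚ)) ≠ Set.univ := by
    refine Subspace.biUnion_ne_univ_of_top_notMem ?_
    rw [Set.Finite.mem_toFinset]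
    rintro ⟨Q, hQ, htop⟩
    obtain ⟨i, hi⟩ := h Q hQ
    have : Pi.single i (1 : ℚ) ∈ sub Q := htop ▸ Submodule.mem_top
    refine hi ?_
    simpa [sub, φ] using this
  obtain ⟨c, hc⟩ := (Set.ne_univ_iff_exists_notMem _).1 h1
  refine ⟨φ c, ?_, fun Q hQ hmem => hc ?_⟩
  · refine IsHomogeneous.sum _ _ _ fun i _ => ?_
    rw [smul_eq_C_mul]
    simpa using (isHomogeneous_C _ (c i)).mul (isHomogeneous_X ℚ i)
  · simp only [Set.mem_iUnion, Set.Finite.mem_toFinset]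
    exact ⟨sub Q, ⟨Q, hQ, rfl⟩, hmem⟩

theorem exists_linearForms (s : ℕ) (I : Ideal (MvPolynomial (Fin n) ℚ))
    (hI : I.IsHomogeneous (homogeneousSubmodule (Fin n) ℚ)) (hdim : DimLe I s) :
    ∃ l : Fin s → MvPolynomial (Fin n) ℚ, (∀ k, (l k).IsHomogeneous 1) ∧
      ∃ D, ∀ i, (X i) ^ D ∈ I ⊔ Ideal.span (Set.range l) := by
  induction s generalizing I with
  | zero =>
    refine ⟨Fin.elim0, fun k => k.elim0, ?_⟩
    rw [Set.range_eq_empty, Ideal.span_empty, sup_bot_eq]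
    refine exists_X_pow_mem fun Q hQ => ?_
    have hQh := isHomogeneous_of_mem_minimalPrimes hI hQ
    have hle := le_irrel_of_isHomogeneous hQh hQ.1.1.ne_top
    by_contra hX
    have hlt : Q < irrel n := lt_of_le_of_ne hle (by
      rintro rfl
      exact hX fun i => by simp [irrel, RingHom.mem_ker])
    have hlt' : (⟨Q, hQ.1.1⟩ : PrimeSpectrum (MvPolynomial (Fin n) ℚ)) <
        ⟨irrel n, irrel_isMaximal.isPrime⟩ := hlt
    have := hdim (RelSeries.fromListIsChain [⟨Q, hQ.1.1⟩, ⟨irrel n, irrel_isMaximal.isPrime⟩]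
      (by simp) (by simpa using hlt')) hQ.1.2
    simp at this
  | succ s ih =>
    obtain ⟨l₀, hl₀, hl₀Q⟩ := exists_linearForm
      (T := {Q ∈ I.minimalPrimes | ∃ i, X i ∉ Q})
      ((Ideal.finite_minimalPrimes_of_isNoetherianRing _ I).subset fun Q hQ => hQ.1)
      fun Q hQ => hQ.2
    have hspan : (Ideal.span {l₀}).IsHomogeneous (homogeneousSubmodule (Fin n) ℚ) :=
      Ideal.homogeneous_span _ _ (by rintro _ rfl; exact ⟨1, hl₀⟩)
    obtain ⟨l, hl, D, hD⟩ := ih (I ⊔ Ideal.span {l₀}) (hI.sup hspan) (by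
      intro p hp
      obtain ⟨Q, hQ, hQp⟩ := Ideal.exists_minimalPrimes_le (le_sup_left.trans hp)
      by_cases hX : ∃ i, X i ∉ Q
      · have hlt : (⟨Q, hQ.1.1⟩ : PrimeSpectrum (MvPolynomial (Fin n) ℚ)) < p.head := by
          refine lt_of_le_of_ne hQp ?_
          intro heq
          refine hl₀Q Q ⟨hQ, hX⟩ ?_
          have : l₀ ∈ p.head.asIdeal := hp (le_sup_right (a := I) (Ideal.mem_span_singleton_self l₀))
          rw [← heq] at this
          exact this
        have := hdim (p.cons _ hlt) (by simpa using hQ.1.2)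
        simpa using this
      · push Not at hX
        have hmax : p.head.asIdeal = irrel n :=
          (irrel_isMaximal.eq_of_le p.head.isPrime.ne_top ((irrel_le_of_X_mem hX).trans hQp)).symm
        have hlen : p.length = 0 := by
          by_contra hne
          have h1 : p.head < p.last := p.strictMono (by
            rw [Fin.lt_def]; simp; omega)
          have h2 : irrel n < p.last.asIdeal := hmax ▸ h1
          exact p.last.isPrime.ne_top (irrel_isMaximal.1.2 _ h2)
        omega)
    refine ⟨Fin.cons l₀ l, fun k => ?_, D, fun i => ?_⟩
    · refine Fin.cases hl₀ hl k
    · have := hD i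
      rwa [sup_assoc, ← Ideal.span_union, ← Set.insert_eq, ← Fin.range_cons] at this

end LinearForms

section Trdeg

variable {τ : Type}

attribute [local instance] MvPolynomial.gradedAlgebra

/-- The transcendence degree of `ℚ[X]/P`, measured on the coordinates, is at most `r`. -/
def TrBound (P : Ideal (MvPolynomial τ ℚ)) (r : ℕ) : Prop :=
  ∀ S : Finset τ, AlgebraicIndepOn ℚ (fun t => Ideal.Quotient.mk P (X t)) (S : Set τ) → S.card ≤ r

theorem decompose_eq (f : MvPolynomial τ ℚ) (e : ℕ) :
    (DirectSum.decompose (homogeneousSubmodule τ ℚ) f e : MvPolynomial τ ℚ) =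
      homogeneousComponent e f := decomposition.decompose'_apply f e

theorem homogeneousComponent_mul_right {g q : MvPolynomial τ ℚ} {k : ℕ} (hq : q.IsHomogeneous k)
    (e : ℕ) : ∃ g', homogeneousComponent e (g * q) = g' * q := by
  have h := DirectSum.coe_decompose_mul_of_right_mem (homogeneousSubmodule τ ℚ) (a := g) e
    (show q ∈ homogeneousSubmodule τ ℚ k from hq)
  rw [decompose_eq] at h
  split_ifs at h
  · exact ⟨_, h⟩
  · exact ⟨0, by rw [h, zero_mul]⟩

theorem homogeneousComponent_mul_linear {g q : MvPolynomial τ ℚ} (hq : q.IsHomogeneous 1)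
    (e : ℕ) : homogeneousComponent (e + 1) (g * q) = homogeneousComponent e g * q := by
  have h := DirectSum.coe_decompose_mul_of_right_mem (homogeneousSubmodule τ ℚ) (a := g) (e + 1)
    (show q ∈ homogeneousSubmodule τ ℚ 1 from hq)
  rw [decompose_eq, if_pos (by omega), decompose_eq] at h
  exact h

theorem exists_of_mem_sup {ι κ : Type} [Fintype ι] [Fintype κ] {B : ι → MvPolynomial τ ℚ}
    {deg : ι → ℕ} (hB : ∀ i, (B i).IsHomogeneous (deg i)) {z : κ → MvPolynomial τ ℚ}
    (hz : ∀ k, (z k).IsHomogeneous 1) {f : MvPolynomial τ ℚ} {e : ℕ} (hf : f.IsHomogeneous (e + 1))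
    (hmem : f ∈ Ideal.span (Set.range B) ⊔ Ideal.span (Set.range z)) :
    ∃ b ∈ Ideal.span (Set.range B), ∃ h : κ → MvPolynomial τ ℚ, (∀ k, (h k).IsHomogeneous e) ∧
      f = b + ∑ k, h k * z k := by
  obtain ⟨b, hb, c, hc, rfl⟩ := Submodule.mem_sup.1 hmem
  obtain ⟨u, rfl⟩ := Ideal.mem_span_range_iff_exists_fun.1 hb
  obtain ⟨v, rfl⟩ := Ideal.mem_span_range_iff_exists_fun.1 hc
  refine ⟨homogeneousComponent (e + 1) (∑ i, u i * B i), ?_,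
    fun k => homogeneousComponent e (v k), fun k => homogeneousComponent_isHomogeneous _ _, ?_⟩
  · rw [map_sum]
    refine Ideal.sum_mem _ fun i _ => ?_
    obtain ⟨g', hg'⟩ := homogeneousComponent_mul_right (g := u i) (hB i) (e + 1)
    rw [hg']
    exact Ideal.mul_mem_left _ _ (Ideal.subset_span ⟨i, rfl⟩)
  · have h := homogeneousComponent_of_mem (m := e + 1)
      (show _ ∈ homogeneousSubmodule τ ℚ (e + 1) from hf)
    rw [if_pos rfl] at h
    rw [← h, map_add, map_sum _ (fun k => v k * z k)]
    simp only [homogeneousComponent_mul_linear (hz _)]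

variable [Fintype τ]

theorem monomial_mem_of_X_pow_mem {J : Ideal (MvPolynomial τ ℚ)} {D : ℕ} (hD : ∀ t, X t ^ D ∈ J)
    {s : τ →₀ ℕ} (hs : Fintype.card τ * D < s.degree) (c : ℚ) : monomial s c ∈ J := by
  have : ∃ t, D ≤ s t := by
    by_contra! h
    have h1 : s.degree ≤ ∑ _t : τ, D := by
      rw [Finsupp.degree_eq_sum]
      exact Finset.sum_le_sum fun t _ => (h t).le
    simp at h1
    omega
  obtain ⟨t, ht⟩ := this
  have h2 : monomial s c = monomial (s - Finsupp.single t D) c * X t ^ D := by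
    rw [X_pow_eq_monomial, monomial_mul, mul_one, tsub_add_cancel_of_le]
    rwa [Finsupp.single_le_iff]
  rw [h2]
  exact J.mul_mem_left _ (hD t)

theorem trBound_of_forms {ι κ : Type} [Fintype ι] [Fintype κ] {B : ι → MvPolynomial τ ℚ}
    {deg : ι → ℕ} (hB : ∀ i, (B i).IsHomogeneous (deg i)) {z : κ → MvPolynomial τ ℚ}
    (hz : ∀ k, (z k).IsHomogeneous 1) {D : ℕ}
    (hD : ∀ t, X t ^ D ∈ Ideal.span (Set.range B) ⊔ Ideal.span (Set.range z))
    {P : Ideal (MvPolynomial τ ℚ)} (hP : P.IsPrime) (hBP : Ideal.span (Set.range B) ≤ P) :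
    TrBound P (Fintype.card κ) := by
  intro S hS
  set φ := Ideal.Quotient.mkₐ ℚ P with hφ
  set A₁ := Algebra.adjoin ℚ (Set.range fun k => φ (z k)) with hA₁
  set G := (fun s => φ (monomial s 1)) '' {s : τ →₀ ℕ | s.degree ≤ Fintype.card τ * D} with hG
  have hfin : G.Finite := by
    refine Set.Finite.image _ ?_
    refine Set.Finite.subset (Set.finite_Iic (Finsupp.equivFunOnFinite.symm
      fun _ => Fintype.card τ * D)) fun s hs t => ?_
    exact (Finsupp.le_degree t s).trans hs
  have hmono : ∀ e (f : MvPolynomial τ ℚ), f.IsHomogeneous e → φ f ∈ Submodule.span A₁ G := by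
    have hcoe : ∀ (e : ℕ) (f : MvPolynomial τ ℚ), f.IsHomogeneous e → ∀ s ∈ f.support, s.degree = e :=
      fun e f hf s hs => by
        rw [Finsupp.degree_eq_weight_one]; exact hf (mem_support_iff.1 hs)
    have hlow : ∀ e ≤ Fintype.card τ * D, ∀ f : MvPolynomial τ ℚ, f.IsHomogeneous e →
        φ f ∈ Submodule.span A₁ G := by
      intro e he f hf
      rw [f.as_sum, map_sum]
      refine Submodule.sum_mem _ fun s hs => ?_
      have h1 : monomial s (coeff s f) = (coeff s f) • monomial s (1 : ℚ) := by
        rw [smul_monomial, smul_eq_mul, mul_one]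
      rw [h1, map_smul, ← algebraMap_smul A₁]
      exact Submodule.smul_mem _ _ (Submodule.subset_span ⟨s, by
        rw [Set.mem_ofPred_eq, hcoe e f hf s hs]; exact he, rfl⟩)
    intro e
    induction e with
    | zero => exact hlow 0 (Nat.zero_le _)
    | succ e ih =>
      intro f hf
      by_cases he : e + 1 ≤ Fintype.card τ * D
      · exact hlow _ he f hf
      · have hfJ : f ∈ Ideal.span (Set.range B) ⊔ Ideal.span (Set.range z) := by
          rw [f.as_sum]
          exact Ideal.sum_mem _ fun s hs =>
            monomial_mem_of_X_pow_mem hD (by rw [hcoe _ f hf s hs]; omega) _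
        obtain ⟨b, hb, h, hh, rfl⟩ := exists_of_mem_sup hB hz hf hfJ
        have hφb : φ b = 0 := Ideal.Quotient.eq_zero_iff_mem.2 (hBP hb)
        rw [map_add, hφb, zero_add, map_sum]
        refine Submodule.sum_mem _ fun k _ => ?_
        rw [map_mul, mul_comm]
        exact Submodule.smul_mem _ (⟨φ (z k), Algebra.subset_adjoin ⟨k, rfl⟩⟩ : A₁) (ih _ (hh k))
  have htop : Submodule.span A₁ G = ⊤ := by
    rw [eq_top_iff]
    rintro x -
    obtain ⟨f, rfl⟩ := Ideal.Quotient.mk_surjective x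
    rw [← sum_homogeneousComponent f, map_sum]
    exact Submodule.sum_mem _ fun e _ => hmono e _ (homogeneousComponent_isHomogeneous _ _)
  have : Module.Finite A₁ (MvPolynomial τ ℚ ⧸ P) := ⟨⟨hfin.toFinset, by simpa using htop⟩⟩
  have : Algebra.IsIntegral A₁ (MvPolynomial τ ℚ ⧸ P) := inferInstance
  have : Algebra.IsAlgebraic A₁ (MvPolynomial τ ℚ ⧸ P) := inferInstance
  have h1 := Algebra.IsAlgebraic.trdeg_le_cardinalMk ℚ (A := MvPolynomial τ ℚ ⧸ P)
    (Set.range fun k => φ (z k))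
  have h2 := AlgebraicIndependent.cardinalMk_le_trdeg hS
  have h3 := (h2.trans h1).trans Cardinal.mk_range_le
  simpa using h3

end Trdeg

section Strata

variable {τ : Type} [LinearOrder τ]

/-- Off the coordinates in `S`, each coordinate of a point of `E` takes at most `C` values once the
preceding coordinates are fixed. -/
def LexTree (E : Set (τ → ℤ)) (S : Finset τ) (C : ℕ) : Prop :=
  ∀ t ∉ S, ∀ y : τ → ℤ, ∀ T : Finset ℤ, (∀ c ∈ T, ∃ z ∈ E, (∀ s < t, z s = y s) ∧ z t = c) →
    T.card ≤ C

theorem LexTree.mono {E : Set (τ → ℤ)} {S : Finset τ} {C C' : ℕ} (h : LexTree E S C)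
    (hC : C ≤ C') : LexTree E S C' := fun t ht y T hT => (h t ht y T hT).trans hC

/-- `V` is covered by finitely many tree-like sets with at most `r` free coordinates. -/
def LexCovered (V : Set (τ → ℤ)) (r : ℕ) : Prop :=
  ∃ (k : ℕ) (E : Fin k → Set (τ → ℤ)) (S : Fin k → Finset τ) (C : ℕ),
    (∀ y ∈ V, ∃ e, y ∈ E e) ∧ (∀ e, LexTree (E e) (S e) C) ∧ ∀ e, (S e).card ≤ r

theorem LexCovered.union {V₁ V₂ : Set (τ → ℤ)} {r : ℕ} (h₁ : LexCovered V₁ r)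
    (h₂ : LexCovered V₂ r) : LexCovered (V₁ ∪ V₂) r := by
  obtain ⟨k₁, E₁, S₁, C₁, hc₁, ht₁, hr₁⟩ := h₁
  obtain ⟨k₂, E₂, S₂, C₂, hc₂, ht₂, hr₂⟩ := h₂
  refine ⟨k₁ + k₂, Fin.append E₁ E₂, Fin.append S₁ S₂, max C₁ C₂, ?_, fun e => ?_, fun e => ?_⟩
  · rintro y (hy | hy)
    · obtain ⟨e, he⟩ := hc₁ y hy
      exact ⟨Fin.castAdd k₂ e, by rwa [Fin.append_left]⟩
    · obtain ⟨e, he⟩ := hc₂ y hy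
      exact ⟨Fin.natAdd k₁ e, by rwa [Fin.append_right]⟩
  · refine Fin.addCases (fun e => ?_) (fun e => ?_) e
    · rw [Fin.append_left, Fin.append_left]; exact (ht₁ e).mono (le_max_left _ _)
    · rw [Fin.append_right, Fin.append_right]; exact (ht₂ e).mono (le_max_right _ _)
  · refine Fin.addCases (fun e => ?_) (fun e => ?_) e
    · rw [Fin.append_left]; exact hr₁ e
    · rw [Fin.append_right]; exact hr₂ e

theorem LexCovered.mono {V₁ V₂ : Set (τ → ℤ)} {r : ℕ} (h : LexCovered V₂ r) (hV : V₁ ⊆ V₂) :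
    LexCovered V₁ r := by
  obtain ⟨k, E, S, C, hc, ht⟩ := h
  exact ⟨k, E, S, C, fun y hy => hc y (hV hy), ht⟩

theorem LexTree.covered {E : Set (τ → ℤ)} {S : Finset τ} {C r : ℕ} (h : LexTree E S C)
    (hr : S.card ≤ r) : LexCovered E r :=
  ⟨1, fun _ => E, fun _ => S, C, fun _ hy => ⟨0, hy⟩, fun _ => h, fun _ => hr⟩

/-- The integral points of the zero locus of `I`. -/
def zeroPts (I : Ideal (MvPolynomial τ ℚ)) : Set (τ → ℤ) :=
  {y | ∀ f ∈ I, eval (fun t => (y t : ℚ)) f = 0}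

theorem exists_rel {P : Ideal (MvPolynomial τ ℚ)} {t : τ}
    (h : ¬ Transcendental (Algebra.adjoin ℚ ((fun s => Ideal.Quotient.mk P (X s)) '' Set.Iio t))
      (Ideal.Quotient.mk P (X t))) :
    ∃ (e : ℕ) (g : ℕ → MvPolynomial τ ℚ), (∀ i, g i ∈ supported ℚ (Set.Iio t)) ∧ g e ∉ P ∧
      ∑ i ∈ Finset.range (e + 1), g i * X t ^ i ∈ P := by
  rw [Transcendental, not_not] at h
  obtain ⟨p, hp0, hp⟩ := h
  have hlift : ∀ x : Algebra.adjoin ℚ ((fun s => Ideal.Quotient.mk P (X s)) '' Set.Iio t),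
      ∃ g ∈ supported ℚ (Set.Iio t), Ideal.Quotient.mk P g = x := by
    rintro ⟨x, hx⟩
    have : (supported ℚ (Set.Iio t)).map (Ideal.Quotient.mkₐ ℚ P) =
        Algebra.adjoin ℚ ((fun s => Ideal.Quotient.mk P (X s)) '' Set.Iio t) := by
      rw [supported, AlgHom.map_adjoin, Set.image_image]; rfl
    rw [← this] at hx
    obtain ⟨g, hg, hgx⟩ := hx
    exact ⟨g, hg, hgx⟩
  choose g hg hgx using fun i => hlift (p.coeff i)
  refine ⟨p.natDegree, g, hg, fun hmem => ?_, ?_⟩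
  · have h1 := hgx p.natDegree
    rw [Ideal.Quotient.eq_zero_iff_mem.2 hmem] at h1
    exact hp0 (Polynomial.leadingCoeff_eq_zero.1 (Subtype.ext h1.symm))
  · rw [← Ideal.Quotient.eq_zero_iff_mem, map_sum, ← hp, Polynomial.aeval_eq_sum_range]
    refine Finset.sum_congr rfl fun i _ => ?_
    rw [map_mul, hgx, map_pow, Algebra.smul_def]; rfl

theorem eval_eq_of_supported {ι : Type} {s : Set ι} {g : MvPolynomial ι ℚ} (hg : g ∈ supported ℚ s)
    {y z : ι → ℚ} (h : ∀ t ∈ s, y t = z t) : eval y g = eval z g := by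
  rw [mem_supported] at hg
  exact eval₂Hom_congr' rfl (fun i hi _ => h i (hg hi)) rfl

theorem card_roots_le {e : ℕ} {a : ℕ → ℚ} (ha : a e ≠ 0) {T : Finset ℤ}
    (hT : ∀ c ∈ T, ∑ i ∈ Finset.range (e + 1), a i * (c : ℚ) ^ i = 0) : T.card ≤ e := by
  set p : Polynomial ℚ := ∑ i ∈ Finset.range (e + 1), Polynomial.C (a i) * Polynomial.X ^ i with hp
  have hcoeff : p.coeff e = a e := by simp [hp]
  have hp0 : p ≠ 0 := fun h => ha (by rw [← hcoeff, h, Polynomial.coeff_zero])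
  have hdeg : p.natDegree ≤ e := by
    refine Polynomial.natDegree_sum_le_of_forall_le _ _ fun i hi => ?_
    exact (Polynomial.natDegree_C_mul_X_pow_le _ _).trans (by
      have := Finset.mem_range.1 hi; omega)
  have h1 : T.image (fun c : ℤ => (c : ℚ)) ⊆ p.roots.toFinset := by
    intro x hx
    obtain ⟨c, hc, rfl⟩ := Finset.mem_image.1 hx
    rw [Multiset.mem_toFinset, Polynomial.mem_roots hp0, Polynomial.IsRoot, hp,
      Polynomial.eval_finsetSum]
    simpa using hT c hc
  calc T.card = (T.image (fun c : ℤ => (c : ℚ))).card :=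
        (Finset.card_image_of_injective _ Int.cast_injective).symm
    _ ≤ p.roots.toFinset.card := Finset.card_le_card h1
    _ ≤ p.roots.card := Multiset.toFinset_card_le _
    _ ≤ e := (Polynomial.card_roots' p).trans hdeg

theorem algebraicIndepOn_of_transcendental {P : Ideal (MvPolynomial τ ℚ)} (hP : P ≠ ⊤)
    (S : Finset τ)
    (hS : ∀ t ∈ S, Transcendental (Algebra.adjoin ℚ ((fun s => Ideal.Quotient.mk P (X s)) '' Set.Iio t))
      (Ideal.Quotient.mk P (X t))) :
    AlgebraicIndepOn ℚ (fun t => Ideal.Quotient.mk P (X t)) (S : Set τ) := by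
  induction S using Finset.induction_on_max with
  | empty =>
    have : Nontrivial (MvPolynomial τ ℚ ⧸ P) := Ideal.Quotient.nontrivial_iff.2 hP
    rw [Finset.coe_empty]
    exact (algebraicIndependent_empty_type_iff (ι := (∅ : Set τ))).2 (algebraMap ℚ _).injective
  | insert a S hmax ih =>
    rw [Finset.coe_insert]
    refine (ih fun t ht => hS t (Finset.mem_insert_of_mem ht)).insert ?_
    have h1 := hS a (Finset.mem_insert_self _ _)
    have hle : Algebra.adjoin ℚ ((fun s => Ideal.Quotient.mk P (X s)) '' (S : Set τ)) ≤
        Algebra.adjoin ℚ ((fun s => Ideal.Quotient.mk P (X s)) '' Set.Iio a) :=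
      Algebra.adjoin_mono (Set.image_mono fun s hs => hmax s hs)
    rintro ⟨p, hp0, hp⟩
    refine h1 ⟨p.map (Subalgebra.inclusion hle).toRingHom, ?_, ?_⟩
    · rwa [Ne, Polynomial.map_eq_zero_iff (Subalgebra.inclusion_injective hle)]
    · rw [← hp, Polynomial.aeval_def, Polynomial.eval₂_map]; rfl

variable [Fintype τ]

theorem lexTree_of_prime {P : Ideal (MvPolynomial τ ℚ)} (hP : P.IsPrime) {r : ℕ}
    (hr : TrBound P r) : ∃ c ∉ P, LexCovered (zeroPts P \ zeroPts (P ⊔ Ideal.span {c})) r := by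
  set S : Finset τ := Finset.univ.filter fun t =>
    Transcendental (Algebra.adjoin ℚ ((fun s => Ideal.Quotient.mk P (X s)) '' Set.Iio t))
      (Ideal.Quotient.mk P (X t)) with hS
  have hrel : ∀ t, ∃ (e : ℕ) (g : ℕ → MvPolynomial τ ℚ), t ∉ S →
      ((∀ i, g i ∈ supported ℚ (Set.Iio t)) ∧ g e ∉ P ∧
        ∑ i ∈ Finset.range (e + 1), g i * X t ^ i ∈ P) := by
    intro t
    by_cases ht : t ∈ S
    · exact ⟨0, 0, fun h => absurd ht h⟩
    · obtain ⟨e, g, h⟩ := exists_rel (P := P) (t := t) (by simpa [hS] using ht)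
      exact ⟨e, g, fun _ => h⟩
  choose e g hg using hrel
  refine ⟨∏ t ∈ Sᶜ, g t (e t), ?_, LexTree.covered (S := S) (C := ∑ t, e t) ?_ ?_⟩
  · rw [hP.prod_mem_iff]
    rintro ⟨t, ht, htP⟩
    exact (hg t (by simpa using ht)).2.1 htP
  · intro t ht y T hT
    obtain ⟨hg1, -, hg3⟩ := hg t ht
    refine le_trans ?_ (Finset.single_le_sum (f := e) (fun _ _ => Nat.zero_le _)
      (Finset.mem_univ t))
    rcases T.eq_empty_or_nonempty with rfl | ⟨c₀, hc₀⟩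
    · simp
    have hval : ∀ z ∈ zeroPts P \ zeroPts (P ⊔ Ideal.span {∏ t ∈ Sᶜ, g t (e t)}),
        eval (fun s => (z s : ℚ)) (g t (e t)) ≠ 0 := by
      rintro z ⟨hz1, hz2⟩ h0
      refine hz2 fun f hf => ?_
      obtain ⟨a, ha, b, hb, rfl⟩ := Submodule.mem_sup.1 hf
      obtain ⟨u, rfl⟩ := Ideal.mem_span_singleton'.1 hb
      have hprod : ∏ t ∈ Sᶜ, eval (fun s => (z s : ℚ)) (g t (e t)) = 0 :=
        Finset.prod_eq_zero (Finset.mem_compl.2 ht) h0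
      rw [map_add, hz1 a ha, map_mul, map_prod, hprod, mul_zero, add_zero]
    have hpre : ∀ z : τ → ℤ, (∀ s < t, z s = y s) → ∀ i,
        eval (fun s => (z s : ℚ)) (g t i) = eval (fun s => (y s : ℚ)) (g t i) := fun z hz i =>
      eval_eq_of_supported (hg1 i) fun s hs => by rw [hz s hs]
    refine card_roots_le (a := fun i => eval (fun s => (y s : ℚ)) (g t i)) ?_ ?_
    · obtain ⟨z, hz, hzy, -⟩ := hT c₀ hc₀
      have := hval z hz
      rwa [hpre z hzy] at this
    · intro c hc
      obtain ⟨z, hz, hzy, hzc⟩ := hT c hc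
      have := hz.1 _ hg3
      rw [map_sum] at this
      rw [← this]
      refine Finset.sum_congr rfl fun i _ => ?_
      rw [map_mul, hpre z hzy, map_pow, eval_X, hzc]
  · exact hr S (algebraicIndepOn_of_transcendental hP.ne_top S fun t ht => (Finset.mem_filter.1 ht).2)

theorem lexCovered_zeroPts {r : ℕ} (I : Ideal (MvPolynomial τ ℚ))
    (hI : ∀ P : Ideal (MvPolynomial τ ℚ), P.IsPrime → I ≤ P → TrBound P r) :
    LexCovered (zeroPts I) r := by
  induction I using WellFoundedGT.induction with
  | ind I ih =>
  have hgt : ∀ c ∉ I, LexCovered (zeroPts (I ⊔ Ideal.span {c})) r := fun c hc =>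
    ih _ (lt_of_le_of_ne le_sup_left fun h => hc (h ▸ le_sup_right (a := I)
      (Ideal.mem_span_singleton_self c))) fun P hP hle => hI P hP (le_sup_left.trans hle)
  by_cases hprime : I.IsPrime
  · obtain ⟨c, hc, hcov⟩ := lexTree_of_prime hprime (hI I hprime le_rfl)
    exact (hcov.union (hgt c hc)).mono fun y hy => by
      by_cases h : y ∈ zeroPts (I ⊔ Ideal.span {c})
      · exact Or.inr h
      · exact Or.inl ⟨hy, h⟩
  by_cases htop : I = ⊤
  · refine ⟨0, Fin.elim0, Fin.elim0, 0, fun y hy => ?_, fun e => e.elim0, fun e => e.elim0⟩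
    have := hy 1 (htop ▸ Submodule.mem_top)
    simp at this
  · have : ∃ a b, a * b ∈ I ∧ a ∉ I ∧ b ∉ I := by
      by_contra! h
      exact hprime ⟨htop, fun {a b} hab => or_iff_not_imp_left.2 fun ha => h a b hab ha⟩
    obtain ⟨a, b, hab, ha, hb⟩ := this
    refine ((hgt a ha).union (hgt b hb)).mono fun y hy => ?_
    have h0 := hy _ hab
    rw [map_mul, mul_eq_zero] at h0
    have key : ∀ c, eval (fun t => (y t : ℚ)) c = 0 → y ∈ zeroPts (I ⊔ Ideal.span {c}) := by
      intro c hc f hf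
      obtain ⟨u, hu, v, hv, rfl⟩ := Submodule.mem_sup.1 hf
      obtain ⟨w, rfl⟩ := Ideal.mem_span_singleton'.1 hv
      rw [map_add, hy u hu, map_mul, hc]; simp
    exact h0.imp (key a) (key b)

end Strata

section Assembly

variable {n : ℕ}

attribute [local instance] MvPolynomial.gradedAlgebra

theorem isHomogeneous_eval_iterD {τ : Type} {y : ℕ → Fin n → MvPolynomial τ ℚ}
    (hy : ∀ t k, (y t k).IsHomogeneous 1) (m : ℕ) (f : MvPolynomial (Fin n) ℚ) :
    (eval 0 (iterD y (map C f) m)).IsHomogeneous m := by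
  induction m generalizing f with
  | zero =>
    have h : eval (0 : Fin n → MvPolynomial τ ℚ) (map C f) = C (eval 0 f) := by
      rw [eval_map, ← eval₂_id, eval₂_comp_left, RingHom.comp_id]
      congr 1; ext; simp
    rw [iterD, h]; exact isHomogeneous_C _ _
  | succ m ih =>
    rw [iterD, dirD_iterD, dirD_apply, iterD_sum, map_sum]
    refine IsHomogeneous.sum _ _ _ fun i _ => ?_
    rw [map_mul, eval_C, pderiv_map, add_comm]
    exact (hy m i).mul (ih _)

/-- The generic point of the space of `m`-tuples of vectors. -/
def genericPt (n m : ℕ) (t : ℕ) (k : Fin n) : MvPolynomial (Fin m ×ₗ Fin n) ℚ :=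
  if h : t < m then X (toLex (⟨t, h⟩, k)) else 0

theorem isHomogeneous_genericPt (m t : ℕ) (k : Fin n) : (genericPt n m t k).IsHomogeneous 1 := by
  rw [genericPt]
  split_ifs
  · exact isHomogeneous_X _ _
  · exact isHomogeneous_zero _ _ _

theorem isHomogeneous_span_pderiv {f : MvPolynomial (Fin n) ℚ} {d : ℕ} (hf : f.IsHomogeneous d) :
    (Ideal.span (Set.range fun i => pderiv i f)).IsHomogeneous (homogeneousSubmodule (Fin n) ℚ) := by
  refine Ideal.homogeneous_span _ _ ?_
  rintro _ ⟨i, rfl⟩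
  exact ⟨d - 1, hf.pderiv⟩

theorem exists_pow_mem_of_polar {f : MvPolynomial (Fin n) ℚ} {m : ℕ}
    (hf : f.IsHomogeneous (m + 2)) {s D : ℕ} {l : Fin s → MvPolynomial (Fin n) ℚ}
    (hl : ∀ i, X i ^ D ∈ Ideal.span (Set.range fun i => pderiv i f) ⊔ Ideal.span (Set.range l))
    (J : Ideal (MvPolynomial (Fin (m + 1) ×ₗ Fin n) ℚ))
    (hJ1 : ∀ i, polar (map C f) (m + 1) i (genericPt n (m + 1)) ∈ J)
    (hJ2 : ∀ t k, (X (toLex (t, k)) - X (toLex (0, k)) : MvPolynomial _ ℚ) ∈ J)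
    (hJ3 : ∀ j, rename (fun k => toLex ((0 : Fin (m + 1)), k)) (l j) ∈ J) (t) : X t ^ D ∈ J := by
  set π := Ideal.Quotient.mk J with hπ
  set x : Fin n → MvPolynomial (Fin (m + 1) ×ₗ Fin n) ℚ ⧸ J := fun k => π (X (toLex (0, k))) with hx
  have hX : ∀ t k, π (X (toLex (t, k))) = x k := fun t k => Ideal.Quotient.eq.2 (hJ2 t k)
  set Φ : MvPolynomial (Fin n) ℚ →+* _ := eval₂Hom (π.comp C) x with hΦ
  have h1 : ∀ i, Φ (pderiv i f) = 0 := fun i => by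
    have h2 := Ideal.Quotient.eq_zero_iff_mem.2 (hJ1 i)
    rw [← hπ, polar_map, map_map, polar_congr (z := fun _ => x), polar_const
      ((hf.map (π.comp C))), pderiv_map, eval_map] at h2
    · have h3 : (((m + 1).factorial : ℕ) : MvPolynomial (Fin (m + 1) ×ₗ Fin n) ℚ ⧸ J) =
          algebraMap ℚ _ ((m + 1).factorial : ℚ) := by simp
      have hu : IsUnit (algebraMap ℚ (MvPolynomial (Fin (m + 1) ×ₗ Fin n) ℚ ⧸ J)
          ((m + 1).factorial : ℚ)) :=
        (IsUnit.mk0 _ (Nat.cast_ne_zero.2 (Nat.factorial_ne_zero _))).map _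
      rw [h3] at h2
      exact hu.mul_right_eq_zero.1 h2
    · intro t ht
      funext k
      rw [genericPt, dif_pos ht, hX]
  have h2 : ∀ j, Φ (l j) = 0 := fun j => by
    have := Ideal.Quotient.eq_zero_iff_mem.2 (hJ3 j)
    rw [← this]
    have h : Φ = π.comp (rename fun k => toLex ((0 : Fin (m + 1)), k)).toRingHom :=
      ringHom_ext (fun a => by simp [hΦ]) fun k => by simp [hΦ, hx]
    rw [h]; rfl
  have h3 : Ideal.span (Set.range fun i => pderiv i f) ⊔ Ideal.span (Set.range l) ≤
      RingHom.ker Φ := by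
    refine sup_le (Ideal.span_le.2 ?_) (Ideal.span_le.2 ?_)
    · rintro _ ⟨i, rfl⟩; exact h1 i
    · rintro _ ⟨i, rfl⟩; exact h2 i
  have h4 := h3 (hl (ofLex t).2)
  rw [RingHom.mem_ker, map_pow] at h4
  have h5 : Φ (X (ofLex t).2) = π (X t) := by
    rw [show t = toLex ((ofLex t).1, (ofLex t).2) from rfl, hX]
    simp [hΦ]
  rw [← Ideal.Quotient.eq_zero_iff_mem, map_pow, ← h4, h5]

theorem mem_zeroPts_span {τ ι : Type} {B : ι → MvPolynomial τ ℚ} {y : τ → ℤ} :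
    y ∈ zeroPts (Ideal.span (Set.range B)) ↔ ∀ i, eval (fun t => (y t : ℚ)) (B i) = 0 := by
  constructor
  · exact fun h i => h _ (Ideal.subset_span ⟨i, rfl⟩)
  · intro h
    have : Ideal.span (Set.range B) ≤ RingHom.ker (eval fun t => (y t : ℚ)) := by
      refine Ideal.span_le.2 ?_
      rintro _ ⟨i, rfl⟩; exact h i
    exact fun f hf => this hf

theorem lexCovered_polar {f : MvPolynomial (Fin n) ℚ} {m s : ℕ} (hf : f.IsHomogeneous (m + 2))
    (hdim : DimLe (Ideal.span (Set.range fun i => pderiv i f)) s) :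
    LexCovered (zeroPts (Ideal.span (Set.range fun i =>
      polar (map C f) (m + 1) i (genericPt n (m + 1))))) (m * n + s) := by
  obtain ⟨l, hl1, D, hD⟩ := exists_linearForms s _ (isHomogeneous_span_pderiv hf) hdim
  let z : (Fin m × Fin n) ⊕ Fin s → MvPolynomial (Fin (m + 1) ×ₗ Fin n) ℚ :=
    Sum.elim (fun p => X (toLex (p.1.succ, p.2)) - X (toLex (0, p.2)))
      fun j => rename (fun k => toLex (0, k)) (l j)
  refine lexCovered_zeroPts _ fun P hP hle => ?_
  have hcard : Fintype.card ((Fin m × Fin n) ⊕ Fin s) = m * n + s := by simp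
  rw [← hcard]
  refine trBound_of_forms (deg := fun _ => m + 1) (z := z) (D := D) (fun i => ?_) (fun k => ?_)
    (fun t => ?_) hP hle
  · rw [polar, pderiv_iterD, pderiv_map]
    exact isHomogeneous_eval_iterD (isHomogeneous_genericPt _) _ _
  · rcases k with p | j
    · exact (isHomogeneous_X _ _).sub (isHomogeneous_X _ _)
    · exact (hl1 j).rename_isHomogeneous
  · refine exists_pow_mem_of_polar hf hD _ (fun i => ?_) (fun t k => ?_) (fun j => ?_) t
    · exact Submodule.mem_sup_left (Ideal.subset_span ⟨i, rfl⟩)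
    · refine Fin.cases ?_ (fun t => ?_) t
      · simp
      · exact Submodule.mem_sup_right (Ideal.subset_span ⟨Sum.inl (t, k), rfl⟩)
    · exact Submodule.mem_sup_right (Ideal.subset_span ⟨Sum.inr j, rfl⟩)

theorem sum_codim_ge (S : Finset (ℕ × Fin n)) (m : ℕ) :
    m * n ≤ ∑ t ∈ Finset.range m, codim S t + S.card := by
  have h1 : ∑ t ∈ Finset.range m, (Finset.univ.filter fun k : Fin n => (t, k) ∈ S).card ≤ S.card := by
    rw [← Finset.card_sigma]
    refine Finset.card_le_card_of_injOn (fun p => (p.1, p.2)) ?_ ?_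
    · rintro ⟨t, k⟩ h
      simp only [Finset.coe_sigma, Set.mem_sigma_iff, Finset.mem_coe, Finset.mem_filter] at h
      exact h.2.2
    · rintro ⟨t, k⟩ - ⟨t', k'⟩ - h
      obtain ⟨rfl, rfl⟩ := Prod.mk.inj h
      rfl
  refine le_trans ?_ (Nat.add_le_add_left h1 _)
  rw [← Finset.sum_add_distrib]
  have h2 : ∀ t ∈ Finset.range m, codim S t +
      (Finset.univ.filter fun k : Fin n => (t, k) ∈ S).card = n := fun t _ => by
    rw [codim, add_comm, Finset.card_filter_add_card_filter_not]; simp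
  rw [Finset.sum_congr rfl h2]; simp

theorem hasStrata_of_dimLe {F : MvPolynomial (Fin n) ℤ} {m s : ℕ} (hF : F.IsHomogeneous (m + 2))
    (hdim : DimLe (Ideal.span (Set.range fun i => pderiv i (map (Int.castRingHom ℚ) F))) s) :
    HasStrata F (m + 1) (n - s) := by
  obtain ⟨r, E, S, C₀, hc, hE, hS⟩ := lexCovered_polar (hF.map (Int.castRingHom ℚ)) hdim
  let pull : (ℕ → Fin n → ℤ) → (Fin (m + 1) ×ₗ Fin n → ℤ) := fun y t => y (ofLex t).1 (ofLex t).2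
  let ι : Fin (m + 1) ×ₗ Fin n → ℕ × Fin n := fun t => ((ofLex t).1, (ofLex t).2)
  refine ⟨r, fun e => pull ⁻¹' E e, fun e => (S e).image ι, max 1 C₀, le_max_left _ _, ?_, ?_, ?_⟩
  · intro y hy
    refine hc _ (mem_zeroPts_span.2 fun i => ?_)
    rw [polar_map, map_map, map_map]
    have h1 := congrArg (Int.castRingHom ℚ) (hy i)
    rw [polar_map, map_zero] at h1
    rw [← h1, polar_congr (z := fun t k => Int.castRingHom ℚ (y t k))]
    · rw [RingHom.ext_int (((eval _).comp C).comp (Int.castRingHom ℚ)) (Int.castRingHom ℚ)]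
    · intro t ht
      funext k
      rw [genericPt, dif_pos ht, eval_X]; rfl
  · intro e t ht k hk y T hT
    refine (hE e (toLex (⟨t, ht⟩, k)) (fun h => hk (Finset.mem_image.2 ⟨_, h, rfl⟩)) (pull y) T
      fun c hc => ?_).trans (le_max_right _ _)
    obtain ⟨z, hz, h1, h2, h3⟩ := hT c hc
    refine ⟨pull z, hz, fun u hu => ?_, h3⟩
    rcases Prod.Lex.lt_iff.1 hu with h | ⟨h, h'⟩
    · exact congrFun (h1 _ h) _
    · have h4 : ((ofLex u).1 : ℕ) = t := congrArg Fin.val h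
      change z (ofLex u).1 _ = y (ofLex u).1 _
      rw [h4]; exact h2 _ h'
  · intro e
    have h1 := sum_codim_ge ((S e).image ι) (m + 1)
    have h2 := (Finset.card_image_le (s := S e) (f := ι)).trans (hS e)
    have h3 : (m + 1) * n = m * n + n := by ring
    change _ ≤ ∑ t ∈ Finset.range (m + 1), codim ((S e).image ι) t
    omega

theorem lexCovered_grad {F : MvPolynomial (Fin n) ℤ} {d s : ℕ} (hF : F.IsHomogeneous d)
    (hdim : DimLe (Ideal.span (Set.range fun i => pderiv i (map (Int.castRingHom ℚ) F))) s) :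
    LexCovered {x : Fin n → ℤ | ∀ i, eval x (pderiv i F) = 0} s := by
  have hf := hF.map (Int.castRingHom ℚ)
  obtain ⟨l, hl1, D, hD⟩ := exists_linearForms s _ (isHomogeneous_span_pderiv hf) hdim
  refine (lexCovered_zeroPts (Ideal.span (Set.range fun i => pderiv i (map (Int.castRingHom ℚ) F)))
    fun P hP hle => ?_).mono fun x hx => mem_zeroPts_span.2 fun i => ?_
  · have := trBound_of_forms (deg := fun _ => d - 1) (fun i => hf.pderiv) hl1 hD hP hle
    simpa using this
  · rw [pderiv_map, eval_map]
    have := eval₂_comp_left (Int.castRingHom ℚ) (RingHom.id ℤ) x (pderiv i F)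
    rw [eval₂_id, hx i, map_zero, RingHom.comp_id] at this
    exact this.symm

end Assembly

section SingularPoints

variable {n : ℕ}

theorem LexTree.card_le {E : Set (Fin n → ℤ)} {S : Finset (Fin n)} {C s : ℕ} (h : LexTree E S C)
    (hs : S.card ≤ s) (hC : 1 ≤ C) {R : ℝ} (hR : 1 ≤ R) {T : Finset (Fin n → ℤ)} (hTE : ↑T ⊆ E)
    (hTR : T ⊆ boxR n R) : (T.card : ℝ) ≤ C ^ n * (3 * R) ^ s := by
  set A : ℕ := (2 * ⌊R⌋ + 1).toNat with hA
  have hfl : 1 ≤ ⌊R⌋ := Int.le_floor.2 (by exact_mod_cast hR)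
  have hA3 : (A : ℝ) ≤ 3 * R := by
    have h1 : ((A : ℤ) : ℝ) = 2 * ⌊R⌋ + 1 := by
      rw [hA, Int.toNat_of_nonneg (by omega)]; push_cast; rfl
    have h2 := Int.floor_le R
    rw [← Int.cast_natCast, h1]; linarith
  have h1 := card_le_prod_of_fibers T (fun k => if k ∈ S then A else C) fun k x hx => by
    split_ifs with hk
    · refine (Finset.card_le_card (t := Finset.Icc (-⌊R⌋) ⌊R⌋) fun c hc => ?_).trans ?_
      · obtain ⟨y, hy, rfl⟩ := Finset.mem_image.1 hc
        have := hTR (Finset.mem_filter.1 hy).1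
        exact Fintype.mem_piFinset.1 this k
      · rw [Int.card_Icc, hA]; omega
    · refine h k hk x _ fun c hc => ?_
      obtain ⟨y, hy, rfl⟩ := Finset.mem_image.1 hc
      exact ⟨y, hTE (Finset.mem_filter.1 hy).1, (Finset.mem_filter.1 hy).2, rfl⟩
  rw [Finset.prod_ite, Finset.prod_const, Finset.prod_const] at h1
  have h2 : (T.card : ℝ) ≤ (A : ℝ) ^ S.card * (C : ℝ) ^ (Finset.univ.filter fun k => k ∉ S).card := by
    have : (Finset.univ.filter fun k => k ∈ S) = S := by simp
    rw [this] at h1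
    exact_mod_cast h1
  refine h2.trans ?_
  rw [mul_comm]
  have hC' : (1 : ℝ) ≤ C := by exact_mod_cast hC
  refine mul_le_mul (pow_le_pow_right₀ hC' ?_) ?_ (by positivity) (by positivity)
  · exact (Finset.card_filter_le _ _).trans (by simp)
  · exact (pow_le_pow_left₀ (by positivity) hA3 _).trans (pow_le_pow_right₀ (by linarith) hs)

theorem sum_gau_compl_boxR_le {P l : ℝ} (hP : 1 ≤ P) (hl : 0 ≤ l) (T : Finset (Fin n → ℤ)) 
    (hT : ∀ x ∈ T, x ∉ boxR n (l * P)) :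
    ∑ x ∈ T, gau (P ^ 2)⁻¹ (toR x) ≤ Real.exp (-(l ^ 2 / 2)) * (thetaC * (2 * P)) ^ n := by
  have hP0 : 0 < P := by linarith
  have h1 : ∀ x ∈ T, gau (P ^ 2)⁻¹ (toR x) ≤
      Real.exp (-(l ^ 2 / 2)) * gau ((2 * P) ^ 2)⁻¹ (toR x - 0) := fun x hx => by
    have h2 := hT x hx
    rw [mem_boxR] at h2
    push Not at h2
    obtain ⟨i, hi⟩ := h2
    have h3 : gau (P ^ 2)⁻¹ (toR x) = gau ((P ^ 2)⁻¹ / 2) (toR x) * gau ((P ^ 2)⁻¹ / 2) (toR x) := by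
      rw [← gau_two_mul]; congr 1; ring
    rw [h3, sub_zero]
    refine mul_le_mul ((gau_le_of_lt (R := l * P) (by positivity) (by positivity) i hi).trans
      (le_of_eq ?_)) ?_ (gau_pos _ _).le (Real.exp_pos _).le
    · congr 2; field_simp
    · rw [gau, gau, Real.exp_le_exp]
      have h4 : 0 ≤ ∑ i, toR x i ^ 2 := Finset.sum_nonneg fun i _ => sq_nonneg _
      have h5 : ((2 * P) ^ 2)⁻¹ ≤ (P ^ 2)⁻¹ / 2 := by
        rw [mul_pow, mul_inv, div_eq_inv_mul]
        refine mul_le_mul_of_nonneg_right (by norm_num) (by positivity)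
      have := Real.pi_pos
      nlinarith [mul_le_mul_of_nonneg_right (mul_le_mul_of_nonneg_left h5 this.le) h4]
  refine (Finset.sum_le_sum h1).trans ?_
  rw [← Finset.mul_sum]
  refine mul_le_mul_of_nonneg_left ?_ (Real.exp_pos _).le
  refine ((summable_gau (by positivity) 0).sum_le_tsum T fun x _ => (gau_pos _ _).le).trans
    (tsum_gau_scale_le (by linarith) 0)

theorem LexCovered.sum_gau_le {V : Set (Fin n → ℤ)} {s : ℕ} (h : LexCovered V s) :
    ∃ K : ℝ, 0 ≤ K ∧ ∀ (P l : ℝ), 1 ≤ P → 1 ≤ l → ∀ T : Finset (Fin n → ℤ), ↑T ⊆ V →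
      ∑ x ∈ T, gau (P ^ 2)⁻¹ (toR x) ≤ K * ((l * P) ^ s + Real.exp (-(l ^ 2 / 2)) * P ^ n) := by
  obtain ⟨k, E, S, C₀, hc, hE, hS⟩ := h
  set C := max 1 C₀ with hC
  have hθ := one_le_thetaC
  refine ⟨k * C ^ n * 3 ^ s + (2 * thetaC) ^ n, by positivity, fun P l hP hl T hT => ?_⟩
  rw [← Finset.sum_filter_add_sum_filter_not T fun x => x ∈ boxR n (l * P)]
  have h1 : ∑ x ∈ T.filter fun x => x ∈ boxR n (l * P), gau (P ^ 2)⁻¹ (toR x) ≤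
      k * (C ^ n * (3 * (l * P)) ^ s) := by
    have hlP : 1 ≤ l * P := by nlinarith
    calc _ ≤ ∑ x ∈ T.filter fun x => x ∈ boxR n (l * P), (1 : ℝ) :=
          Finset.sum_le_sum fun x _ => gau_le_one (by positivity) _
      _ = ((T.filter fun x => x ∈ boxR n (l * P)).card : ℝ) := by simp
      _ ≤ ((Finset.univ.biUnion fun e : Fin k =>
            (T.filter fun x => x ∈ boxR n (l * P)).filter fun x => x ∈ E e).card : ℝ) := by
          refine Nat.cast_le.2 (Finset.card_le_card fun x hx => ?_)
          obtain ⟨e, he⟩ := hc x (hT (Finset.mem_filter.1 hx).1)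
          exact Finset.mem_biUnion.2 ⟨e, Finset.mem_univ _, Finset.mem_filter.2 ⟨hx, he⟩⟩
      _ ≤ ∑ e : Fin k, (((T.filter fun x => x ∈ boxR n (l * P)).filter fun x => x ∈ E e).card : ℝ) := by
          exact_mod_cast Finset.card_biUnion_le
      _ ≤ ∑ e : Fin k, ((C : ℝ) ^ n * (3 * (l * P)) ^ s) := by
          refine Finset.sum_le_sum fun e _ => ?_
          refine ((hE e).mono (le_max_right 1 C₀)).card_le (hS e) (le_max_left _ _) hlP
            (fun x hx => ?_) (fun x hx => ?_)
          · exact (Finset.mem_filter.1 hx).2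
          · exact (Finset.mem_filter.1 (Finset.mem_filter.1 hx).1).2
      _ = _ := by simp
  have h2 := sum_gau_compl_boxR_le hP (by linarith : (0 : ℝ) ≤ l)
    (T.filter fun x => x ∉ boxR n (l * P)) fun x hx => (Finset.mem_filter.1 hx).2
  refine (add_le_add h1 h2).trans ?_
  have hP0 : 0 < P := by linarith
  have hl0 : 0 < l := by linarith
  rw [mul_pow 3, show thetaC * (2 * P) = 2 * thetaC * P by ring, mul_pow (2 * thetaC) P]
  have e0 := Real.exp_pos (-(l ^ 2 / 2))
  have a1 : 0 ≤ (k : ℝ) * (C : ℝ) ^ n * 3 ^ s * (Real.exp (-(l ^ 2 / 2)) * P ^ n) := by positivity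
  have a2 : 0 ≤ (2 * thetaC) ^ n * (l * P) ^ s := by positivity
  linarith

end SingularPoints

section MinorArcs

variable {n : ℕ}

theorem exists_base (K : ℕ) : ∃ L : ℕ, ∀ q : ℕ, 1 ≤ q →
    ∃ l : ℕ, 2 ≤ l ∧ l ≤ L ∧ ∀ e : ℕ, (Nat.gcd (l ^ e) q) ^ K ≤ q := by
  obtain ⟨s, hs, hcard⟩ := Nat.infinite_setOfPred_prime.exists_subset_card_eq (K + 1)
  refine ⟨s.sup id, fun q hq => ?_⟩
  by_contra! hcon
  have h1 : ∀ l ∈ s, q < (l ^ q.factorization l) ^ K := fun l hl => by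
    have hp : l.Prime := hs hl
    obtain ⟨e, he⟩ := hcon l hp.two_le (Finset.le_sup (f := id) hl)
    refine he.trans_le (Nat.pow_le_pow_left ?_ _)
    refine Nat.le_of_dvd (pow_pos hp.pos _) ?_
    obtain ⟨i, -, hi⟩ := (Nat.dvd_prime_pow hp).1 (Nat.gcd_dvd_left (l ^ e) q)
    rw [hi]
    refine pow_dvd_pow _ ((hp.pow_dvd_iff_le_factorization (by omega)).1 ?_)
    rw [← hi]; exact Nat.gcd_dvd_right _ _
  have h2 : ∏ l ∈ s, l ^ q.factorization l ∣ q := by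
    refine Finset.prod_dvd_of_isRelPrime (fun a ha b hb hab => ?_) fun l _ => Nat.ordProj_dvd q l
    exact Nat.coprime_iff_isRelPrime.1 (((Nat.coprime_primes (hs ha) (hs hb)).2 hab).pow _ _)
  have h3 : (∏ l ∈ s, l ^ q.factorization l) ^ K ≤ q ^ K :=
    Nat.pow_le_pow_left (Nat.le_of_dvd hq h2) _
  rw [← Finset.prod_pow] at h3
  have h4 : q ^ (K + 1) ≤ ∏ l ∈ s, (l ^ q.factorization l) ^ K := by
    rw [← hcard]
    exact Finset.pow_card_le_prod _ _ _ fun l hl => (h1 l hl).le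
  have h5 : q ^ (K + 1) ≤ q ^ K := h4.trans h3
  have h6 : s.Nonempty := Finset.card_pos.1 (by omega)
  obtain ⟨l, hl⟩ := h6
  rcases hq.eq_or_lt with rfl | hq
  · have := h1 l hl; simp at this
  · exact absurd h5 (not_le.2 (Nat.pow_lt_pow_right hq (by omega)))

/-- If `α` is close to `a / q`, then the multiples `α b B` with `B` small are not too close to
integers. -/
theorem eq_zero_of_near {q : ℕ} {a : ℤ} (hq : 1 ≤ q) (ha : IsCoprime a q) {b : ℕ} {β X δ : ℝ}
    (h1 : 2 * b * |β| * X * q < 1) (h2 : 2 * q * δ < 1)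
    (h3 : X * Nat.gcd b q < q ∨ δ * Nat.gcd b q < b * |β| * q) {B v : ℤ} (hB : |(B : ℝ)| ≤ X)
    (hv : |((a : ℝ) / q + β) * (b * B) - v| ≤ δ) : B = 0 := by
  by_contra hB0
  have hq0 : (0 : ℝ) < q := by exact_mod_cast hq
  have hb1 : |b * β * B| * (2 * q) < 1 := by
    rw [abs_mul, abs_mul, Nat.abs_cast]
    have : (b : ℝ) * |β| * |(B : ℝ)| ≤ b * |β| * X := mul_le_mul_of_nonneg_left hB (by positivity)
    nlinarith
  have hexact : a * (b * B) = v * q := by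
    have h4 : |((a * (b * B) - v * q : ℤ) : ℝ)| < 1 := by
      have h5 : ((a * (b * B) - v * q : ℤ) : ℝ) =
          q * ((((a : ℝ) / q + β) * (b * B) - v) - b * β * B) := by
        push_cast; field_simp; ring
      rw [h5, abs_mul, abs_of_pos hq0]
      have := abs_sub (((a : ℝ) / q + β) * (b * B) - v) (b * β * B)
      nlinarith
    have h6 : |a * (b * B) - v * q| < 1 := by exact_mod_cast h4
    have := Int.abs_lt_one_iff.1 h6
    linarith
  have hdvd : (q : ℤ) ∣ b * B := (ha.symm).dvd_of_dvd_mul_left ⟨v, by rw [hexact]; ring⟩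
  have hg : 0 < Nat.gcd b q := Nat.gcd_pos_of_pos_right _ hq
  have hBg : (q : ℤ) ≤ Nat.gcd b q * |B| := by
    have h7 : q ∣ b * B.natAbs := by
      have := Int.natAbs_dvd_natAbs.2 hdvd
      simpa [Int.natAbs_mul] using this
    have h8 : q ∣ Nat.gcd b q * B.natAbs := by
      rw [← Nat.gcd_mul_right]
      exact Nat.dvd_gcd h7 (dvd_mul_right _ _)
    have h9 := Nat.le_of_dvd (Nat.mul_pos hg (Int.natAbs_pos.2 hB0)) h8
    rw [Int.abs_eq_natAbs]; exact_mod_cast h9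
  have hBg' : (q : ℝ) ≤ Nat.gcd b q * |(B : ℝ)| := by exact_mod_cast hBg
  have hg' : (0 : ℝ) < Nat.gcd b q := by exact_mod_cast hg
  rcases h3 with h3 | h3
  · nlinarith
  · have h10 : |b * β * B| ≤ δ := by
      have : b * β * B = ((a : ℝ) / q + β) * (b * B) - v := by
        have : (v : ℝ) = a * (b * B) / q := by
          rw [eq_div_iff hq0.ne']; exact_mod_cast hexact.symm
        rw [this]; ring
      rw [this]; exact hv
    rw [abs_mul, abs_mul, Nat.abs_cast] at h10
    have h11 : b * |β| * q ≤ b * |β| * (Nat.gcd b q * |(B : ℝ)|) :=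
      mul_le_mul_of_nonneg_left hBg' (by positivity)
    nlinarith

theorem exists_split (E : ℕ → ℕ) (j e : ℕ) (he : e ≤ ∑ i ∈ Finset.range j, E i) :
    ∃ f : ℕ → ℕ, (∀ i < j, f i ≤ E i) ∧ ∑ i ∈ Finset.range j, f i = e := by
  induction j generalizing e with
  | zero => exact ⟨0, fun i hi => absurd hi (by omega), by simp at he ⊢; omega⟩
  | succ j ih =>
    rw [Finset.sum_range_succ] at he
    obtain ⟨f, hf1, hf2⟩ := ih (e - E j) (by omega)
    refine ⟨fun i => if i < j then f i else min e (E j), fun i hi => ?_, ?_⟩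
    · dsimp only
      split_ifs with h
      · exact hf1 i h
      · have : i = j := by omega
        rw [this]; exact min_le_right _ _
    · rw [Finset.sum_range_succ, if_neg (lt_irrefl _), Finset.sum_congr rfl fun i hi =>
        if_pos (Finset.mem_range.1 hi), hf2]
      omega

theorem exists_steps {j l M : ℕ} {P Y : ℝ} (hl : 2 ≤ l) (hM : 1 ≤ M)
    (hMP : (M : ℝ) ^ 2 ^ (j + 1) ≤ P) (hY : Y < 1) :
    ∃ (b : ℕ → ℕ) (e : ℕ), (∀ i < j, (b i : ℝ) * (M : ℝ) ^ 2 ^ (i + 1) ≤ P) ∧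
      ∏ t ∈ Finset.range j, b t = l ^ e ∧ (l : ℝ) ^ e * Y < 1 ∧
      (P ^ j ≤ (l : ℝ) ^ j * (M : ℝ) ^ (2 ^ (j + 1) - 2) * (l : ℝ) ^ e ∨ 1 ≤ (l : ℝ) ^ (e + 1) * Y) := by
  have hM' : (1 : ℝ) ≤ M := by exact_mod_cast hM
  have hl' : (1 : ℝ) < l := by exact_mod_cast hl
  have hE : ∀ i, ∃ E : ℕ, i < j → (l : ℝ) ^ E * (M : ℝ) ^ 2 ^ (i + 1) ≤ P ∧
      P ≤ l * (M : ℝ) ^ 2 ^ (i + 1) * (l : ℝ) ^ E := fun i => by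
    by_cases hi : i < j
    · have hH : 0 < (M : ℝ) ^ 2 ^ (i + 1) := by positivity
      have h1 : (M : ℝ) ^ 2 ^ (i + 1) ≤ P := (pow_le_pow_right₀ hM'
        (Nat.pow_le_pow_right two_pos (by omega))).trans hMP
      obtain ⟨E, hE1, hE2⟩ := exists_nat_pow_near (x := P / (M : ℝ) ^ 2 ^ (i + 1)) (y := l)
        ((one_le_div hH).2 h1) hl'
      rw [le_div_iff₀ hH] at hE1
      rw [div_lt_iff₀ hH, pow_succ] at hE2
      exact ⟨E, fun _ => ⟨hE1, by linarith⟩⟩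
    · exact ⟨0, fun h => absurd h hi⟩
  choose E hE using hE
  set T := ∑ i ∈ Finset.range j, E i with hT
  set e := Nat.findGreatest (fun e => (l : ℝ) ^ e * Y < 1) T with he
  have he1 : (l : ℝ) ^ e * Y < 1 :=
    Nat.findGreatest_spec (P := fun e => (l : ℝ) ^ e * Y < 1) (Nat.zero_le T) (by simpa using hY)
  have heT : e ≤ T := Nat.findGreatest_le T
  obtain ⟨f, hf1, hf2⟩ := exists_split E j e heT
  refine ⟨fun i => l ^ f i, e, fun i hi => ?_, ?_, he1, ?_⟩
  · push_cast
    refine le_trans ?_ (hE i hi).1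
    exact mul_le_mul_of_nonneg_right (pow_le_pow_right₀ hl'.le (hf1 i hi)) (by positivity)
  · rw [Finset.prod_pow_eq_pow_sum, hf2]
  · rcases heT.eq_or_lt with h | h
    · left
      have hP0 : 0 ≤ P := le_trans (by positivity) hMP
      calc P ^ j = ∏ i ∈ Finset.range j, P := by simp
        _ ≤ ∏ i ∈ Finset.range j, (l * (M : ℝ) ^ 2 ^ (i + 1) * (l : ℝ) ^ E i) :=
            Finset.prod_le_prod (fun _ _ => hP0) fun i hi => (hE i (Finset.mem_range.1 hi)).2
        _ = _ := by
            rw [Finset.prod_mul_distrib, Finset.prod_mul_distrib, Finset.prod_const,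
              Finset.card_range, Finset.prod_pow_eq_pow_sum, Finset.prod_pow_eq_pow_sum, ← hT, ← h]
            congr 3
            clear * -
            induction j with
            | zero => simp
            | succ j ih => 
              rw [Finset.sum_range_succ, ih]
              have := Nat.pow_le_pow_right two_pos (show 1 ≤ j + 1 by omega)
              rw [pow_succ 2 (j + 1)]; omega
    · right
      have := Nat.findGreatest_is_greatest (P := fun e => (l : ℝ) ^ e * Y < 1)
        (Nat.lt_succ_self e) h
      exact not_lt.1 this

end MinorArcs

section MinorArcs

variable {n : ℕ}

set_option maxHeartbeats 400000 in
theorem gsum_minor {F : MvPolynomial (Fin n) ℤ} {j N : ℕ} (hF : F.IsHomogeneous (j + 2))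
    (hS : HasStrata F (j + 1) N) {K : ℕ} (hK : 1 ≤ K) :
    ∃ A : ℝ, 1 ≤ A ∧ ∀ (P : ℝ) (M q : ℕ) (a : ℤ) (β : ℝ), 1 ≤ P → 1 ≤ M → 1 ≤ q →
      IsCoprime a q → (M : ℝ) ^ 2 ^ (j + 1) ≤ P →
      A * (M : ℝ) ^ (2 ^ (j + 2) - 2) * (q * |β|) < 1 →
      A * (q : ℝ) ^ (1 / K : ℝ) * (M : ℝ) ^ (2 ^ (j + 2) - 2 + 2 ^ (j + 1)) < P ^ 2 →
      A * q * (M : ℝ) ^ 2 ^ (j + 1) < P ^ 2 →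
      (A * (M : ℝ) ^ (2 ^ (j + 2) - 2) < q ∨
        A * (M : ℝ) ^ (2 ^ (j + 2) - 2) * (q : ℝ) ^ (1 / K : ℝ) < q * (|β| * P ^ (j + 2))) →
      ‖gsum P 0 fun x => eC (((a : ℝ) / q + β) * ((eval x F : ℤ) : ℝ))‖ ≤
        A * (1 + Real.log M) ^ n * P ^ n * ((M : ℝ)⁻¹) ^ N := by
  obtain ⟨K₀, X, hK₀, hX, hmain⟩ := weyl_bound hF hS
  obtain ⟨L₀, hL₀⟩ := exists_base K
  set X₁ := max 1 X with hX₁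
  set L : ℝ := max 1 (L₀ : ℝ) with hL
  have hX1 : 1 ≤ X₁ := le_max_left _ _
  have hL1 : 1 ≤ L := le_max_left _ _
  set A := K₀ * (2 * L ^ (j + 1) * X₁) with hA
  have hLj : 1 ≤ L ^ (j + 1) := one_le_pow₀ hL1
  have hA2 : 2 * L ^ (j + 1) * X₁ ≤ A := le_mul_of_one_le_left (by positivity) hK₀
  have hAK : K₀ ≤ A := le_mul_of_one_le_right (by linarith) (by nlinarith)
  have hAX : 2 * X₁ ≤ A := le_trans (by nlinarith) hA2
  refine ⟨A, hK₀.trans hAK, fun P M q a β hP hM hq ha hMP hi hii hiii hcase => ?_⟩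
  have hP0 : 0 < P := by linarith
  have hM' : (1 : ℝ) ≤ M := by exact_mod_cast hM
  have hM0 : (0 : ℝ) < M := by linarith
  have hq' : (1 : ℝ) ≤ q := by exact_mod_cast hq
  have hq0 : (0 : ℝ) < q := by linarith
  have hlog : 0 ≤ Real.log M := Real.log_nonneg hM'
  set U := (M : ℝ) ^ (2 ^ (j + 2) - 2) with hU
  set W := (M : ℝ) ^ 2 ^ (j + 1) with hW
  set G := (q : ℝ) ^ (1 / K : ℝ) with hG
  have hU0 : 0 < U := by positivity
  have hW0 : 0 < W := by positivity
  have hG0 : 0 < G := by positivity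
  have hUW : (M : ℝ) ^ (2 ^ (j + 2) - 2 + 2 ^ (j + 1)) = U * W := pow_add _ _ _
  rw [hUW] at hii
  suffices hb : ∃ b : ℕ → ℕ, (∀ i < j, (b i : ℝ) * (M : ℝ) ^ 2 ^ (i + 1) ≤ P) ∧
      2 * ((∏ t ∈ Finset.range j, b t : ℕ) : ℝ) * |β| * (X₁ * U) * q < 1 ∧
      ((X₁ * U) * Nat.gcd (∏ t ∈ Finset.range j, b t) q < q ∨
        (W / P ^ 2) * Nat.gcd (∏ t ∈ Finset.range j, b t) q <
          ((∏ t ∈ Finset.range j, b t : ℕ) : ℝ) * |β| * q) by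
    obtain ⟨b, hb1, hb2, hb3⟩ := hb
    refine (hmain P M _ b hP hM hb1 hMP (fun B v hB hv => ?_) 0).trans ?_
    · refine eq_zero_of_near hq ha hb2 (δ := W / P ^ 2) ?_ hb3
        (hB.trans (mul_le_mul_of_nonneg_right (le_max_right _ _) hU0.le)) (v := v) ?_
      · rw [show 2 * (q : ℝ) * (W / P ^ 2) = 2 * q * W / P ^ 2 by ring, div_lt_one (by positivity)]
        refine lt_of_le_of_lt ?_ hiii
        have : 0 < q * W := by positivity
        nlinarith
      · convert hv using 5
        push_cast; rfl
    · have : 0 ≤ (1 + Real.log M) ^ n * P ^ n * ((M : ℝ)⁻¹) ^ N := by positivity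
      nlinarith
  rcases hcase with hA1 | hB1
  · refine ⟨fun _ => 1, fun i hi => ?_, ?_, Or.inl ?_⟩
    · rw [Nat.cast_one, one_mul]
      exact (pow_le_pow_right₀ hM' (Nat.pow_le_pow_right two_pos (by omega))).trans hMP
    · simp only [Finset.prod_const_one, Nat.cast_one, mul_one]
      refine lt_of_le_of_lt ?_ hi
      have : 0 ≤ U * (q * |β|) := by positivity
      nlinarith
    · simp only [Finset.prod_const_one, Nat.gcd_one_left, Nat.cast_one, mul_one]
      refine lt_of_le_of_lt ?_ hA1
      nlinarith
  · obtain ⟨l, hl2, hlL, hgcd⟩ := hL₀ q hq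
    have hlL' : (l : ℝ) ≤ L := (Nat.cast_le.2 hlL).trans (le_max_right _ _)
    have hl1 : (1 : ℝ) ≤ l := by exact_mod_cast (by omega : 1 ≤ l)
    have hY : 2 * |β| * (X₁ * U) * q < 1 := by
      refine lt_of_le_of_lt ?_ hi
      have : 0 ≤ U * (q * |β|) := by positivity
      nlinarith
    obtain ⟨b, e, hb1, hbe, hb2, hb3⟩ := exists_steps (j := j) hl2 hM hMP hY
    refine ⟨b, hb1, ?_, Or.inr ?_⟩
    · rw [hbe]; push_cast; linarith
    rw [hbe]
    have hg : ((Nat.gcd (l ^ e) q : ℕ) : ℝ) ≤ G := by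
      rw [hG, one_div]
      refine (Real.le_rpow_inv_iff_of_pos (by positivity) hq0.le (by positivity)).2 ?_
      rw [Real.rpow_natCast]; exact_mod_cast hgcd e
    refine lt_of_le_of_lt (mul_le_mul_of_nonneg_left hg (by positivity)) ?_
    push_cast
    rw [div_mul_eq_mul_div, div_lt_iff₀ (by positivity)]
    have hle0 : (0 : ℝ) < (l : ℝ) ^ e := by positivity
    rcases hb3 with h | h
    · have hUe : U = (M : ℝ) ^ (2 ^ (j + 1) - 2) * W := by
        rw [hU, hW, ← pow_add]; congr 1
        have := Nat.pow_le_pow_right two_pos (show 1 ≤ j + 1 by omega)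
        rw [pow_succ 2 (j + 1)]; omega
      set V := (M : ℝ) ^ (2 ^ (j + 1) - 2) with hV
      have hV0 : 0 < V := by positivity
      have hlj : (l : ℝ) ^ j ≤ A := by
        refine (pow_le_pow_left₀ (by positivity) hlL' j).trans ((pow_le_pow_right₀ hL1
          (Nat.le_succ j)).trans (le_trans ?_ hA2))
        change L ^ (j + 1) ≤ _
        nlinarith [mul_le_mul_of_nonneg_left hX1 (by linarith : 0 ≤ L ^ (j + 1))]
      have hlj0 : (0 : ℝ) < (l : ℝ) ^ j := by positivity
      have h1 : P ^ (j + 2) * (|β| * q) ≤ (l : ℝ) ^ j * V * (l : ℝ) ^ e * P ^ 2 * (|β| * q) := by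
        rw [pow_add]
        exact mul_le_mul_of_nonneg_right (mul_le_mul_of_nonneg_right h (by positivity))
          (by positivity)
      have h2 : (l : ℝ) ^ j * V * (W * G) ≤ A * U * G := by
        rw [hUe]
        calc _ = (l : ℝ) ^ j * (V * W * G) := by ring
          _ ≤ A * (V * W * G) := mul_le_mul_of_nonneg_right hlj (by positivity)
          _ = _ := by ring
      have h3 : (l : ℝ) ^ j * V * (W * G) < (l : ℝ) ^ j * V * ((l : ℝ) ^ e * |β| * q * P ^ 2) := by
        calc _ ≤ A * U * G := h2
          _ < q * (|β| * P ^ (j + 2)) := hB1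
          _ ≤ _ := by linarith
      exact lt_of_mul_lt_mul_left h3 (by positivity)
    · have h1 : 1 ≤ A * U * ((l : ℝ) ^ e * |β| * q) := by
        refine h.trans ?_
        rw [pow_succ]
        have h4 : (l : ℝ) * (2 * X₁) ≤ A := by
          refine le_trans ?_ hA2
          have : (l : ℝ) ≤ L ^ (j + 1) := hlL'.trans (le_self_pow₀ hL1 (by omega))
          linarith [mul_le_mul_of_nonneg_right this (by linarith : 0 ≤ 2 * X₁)]
        calc _ = (l : ℝ) * (2 * X₁) * (U * ((l : ℝ) ^ e * |β| * q)) := by ring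
          _ ≤ A * (U * ((l : ℝ) ^ e * |β| * q)) := mul_le_mul_of_nonneg_right h4 (by positivity)
          _ = _ := by ring
      have h5 : 0 < W * G := by positivity
      have h6 : 0 ≤ (l : ℝ) ^ e * |β| * q := by positivity
      calc W * G ≤ W * G * (A * U * ((l : ℝ) ^ e * |β| * q)) := le_mul_of_one_le_right h5.le h1
        _ = (A * G * (U * W)) * ((l : ℝ) ^ e * |β| * q) := by ring
        _ < P ^ 2 * ((l : ℝ) ^ e * |β| * q) := by
            refine mul_lt_mul_of_pos_right hii ?_
            rcases h6.eq_or_lt with h7 | h7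
            · rw [← h7] at h1; norm_num at h1
            · exact h7
        _ = _ := by ring

end MinorArcs

section MinorArcs

variable {n : ℕ}

theorem one_add_log_pow_le (n : ℕ) {ε : ℝ} (hε : 0 < ε) : ∃ C : ℝ, 0 < C ∧ ∀ x : ℝ, 1 ≤ x →
    (1 + Real.log x) ^ n ≤ C * x ^ ε := by
  have hε' : 0 < ε / (n + 1) := by positivity
  refine ⟨(1 + 1 / (ε / (n + 1))) ^ n, by positivity, fun x hx => ?_⟩
  have h1 : 1 + Real.log x ≤ (1 + 1 / (ε / (n + 1))) * x ^ (ε / (n + 1)) := by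
    have h2 := Real.log_le_rpow_div (by linarith : 0 ≤ x) hε'
    have h3 := Real.one_le_rpow hx hε'.le
    rw [add_mul, one_mul, one_div_mul_eq_div]; linarith
  have h4 : 0 ≤ Real.log x := Real.log_nonneg hx
  refine (pow_le_pow_left₀ (by linarith) h1 n).trans ?_
  rw [mul_pow]
  refine mul_le_mul_of_nonneg_left ?_ (by positivity)
  rw [← Real.rpow_mul_natCast (by linarith)]
  refine Real.rpow_le_rpow_of_exponent_le hx ?_
  rw [div_mul_eq_mul_div, div_le_iff₀ (by positivity)]
  nlinarith

theorem exists_kappa {x₁ y₁ x₂ y₂ : ℝ} (h₁ : y₁ < x₁) (h₂ : y₂ < x₂) : ∃ K : ℕ, 2 ≤ K ∧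
    y₁ < (1 - 1 / (K : ℝ)) ^ 2 * x₁ ∧ y₂ < (1 - 1 / (K : ℝ)) ^ 2 * x₂ := by
  have h : ∀ x : ℝ, Filter.Tendsto (fun K : ℕ => (1 - 1 / (K : ℝ)) ^ 2 * x) Filter.atTop
      (nhds x) := fun x => by
    have h1 := ((tendsto_one_div_atTop_nhds_zero_nat (𝕜 := ℝ)).const_sub 1).pow 2
    simpa using h1.mul_const x
  have := ((Filter.eventually_ge_atTop 2).and (((h x₁).eventually_const_lt h₁).and
    ((h x₂).eventually_const_lt h₂)))
  exact this.exists

set_option maxHeartbeats 400000 in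
theorem gsum_rpow_bound {F : MvPolynomial (Fin n) ℤ} {j N : ℕ} (hF : F.IsHomogeneous (j + 2))
    (hS : HasStrata F (j + 1) N) {K : ℕ} (hK : 2 ≤ K) {u w κ : ℝ} (hu : u = 2 ^ (j + 2) - 2)
    (hw : w = 2 ^ (j + 1)) (hκ : κ = 1 - 1 / K) (hN : 0 < N) :
    ∃ C : ℝ, 0 < C ∧ ∀ (P : ℝ) (q : ℕ) (a : ℤ) (β : ℝ), 1 ≤ P → 1 ≤ q → IsCoprime a q →
      (q : ℝ) ≤ P ^ (2 * u / (u + w)) → q * |β| ≤ P ^ (-(2 * u / (u + w))) →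
      ‖gsum P 0 fun x => eC (((a : ℝ) / q + β) * ((eval x F : ℤ) : ℝ))‖ ≤
        C * P ^ n * (min (P ^ (2 * κ / (u + w)))
          (((q : ℝ) ^ κ * (1 + |β| * P ^ (j + 2))) ^ (1 / u))) ^ (-(κ * N)) := by
  obtain ⟨A, hA, hmain⟩ := gsum_minor hF hS (K := K) (by omega)
  have hK' : (2 : ℝ) ≤ K := by exact_mod_cast hK
  have hK1 : 1 / (K : ℝ) ≤ 1 / 2 := one_div_le_one_div_of_le two_pos hK'
  have hK0 : 0 < 1 / (K : ℝ) := by positivity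
  have hκ0 : 0 < κ := by rw [hκ]; linarith
  have hκ1 : κ < 1 := by rw [hκ]; linarith
  have hN' : (0 : ℝ) < N := by exact_mod_cast hN
  have hκN : 0 < κ * N := mul_pos hκ0 hN'
  have hε : 0 < (1 - κ) * N := mul_pos (by linarith) hN'
  obtain ⟨C₁, hC₁, hlog⟩ := one_add_log_pow_le n hε
  have hw2 : 2 ≤ w := by rw [hw, pow_succ]; linarith [one_le_pow₀ (M₀ := ℝ) one_le_two (n := j)]
  have huw : u = 2 * w - 2 := by rw [hu, hw]; ring
  have hu2 : 2 ≤ u := by linarith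
  have hwu : w ≤ u := by linarith
  have hκw : κ * w ≤ w := mul_le_of_le_one_left (by linarith) hκ1.le
  have hun : ((2 ^ (j + 2) - 2 : ℕ) : ℝ) = u := by
    rw [Nat.cast_sub, hu]
    · push_cast; ring
    · exact (Nat.pow_le_pow_right two_pos (show 1 ≤ j + 2 by omega))
  have hwn : ((2 ^ (j + 1) : ℕ) : ℝ) = w := by rw [hw]; push_cast; ring
  set c := 1 / (4 * A) with hc
  have hA0 : 0 < A := by linarith
  have hc0 : 0 < c := by positivity
  have hAc : A * c = 1 / 4 := by rw [hc]; field_simp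
  have hc1 : c ≤ 1 := by rw [hc, div_le_one (by linarith)]; linarith
  have hθ := one_le_thetaC
  refine ⟨(A * C₁ * 2 ^ (κ * N) + thetaC ^ n) * c ^ (-(κ * N)), by positivity,
    fun P q a β hP hq ha hqP hβ => ?_⟩
  have hP0 : 0 < P := by linarith
  have hq' : (1 : ℝ) ≤ q := by exact_mod_cast hq
  have hq0 : (0 : ℝ) < q := by linarith
  set Y := |β| * P ^ (j + 2) with hY
  have hY0 : 0 ≤ Y := by positivity
  set t₀ := min (P ^ (2 * κ / (u + w))) (((q : ℝ) ^ κ * (1 + Y)) ^ (1 / u)) with ht₀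
  have ht₀0 : 0 < t₀ := lt_min (by positivity) (by positivity)
  set t := c * t₀ with ht
  have ht0 : 0 < t := by positivity
  suffices h : ‖gsum P 0 fun x => eC (((a : ℝ) / q + β) * ((eval x F : ℤ) : ℝ))‖ ≤
      (A * C₁ * 2 ^ (κ * N) + thetaC ^ n) * P ^ n * t ^ (-(κ * N)) by
    refine h.trans (le_of_eq ?_)
    rw [ht, Real.mul_rpow hc0.le ht₀0.le]; ring
  have htN : 0 < t ^ (-(κ * N)) := by positivity
  rcases lt_or_ge t 1 with ht1 | ht1
  · have h1 : 1 ≤ t ^ (-(κ * N)) := Real.one_le_rpow_of_pos_of_le_one_of_nonpos ht0 ht1.le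
      (by linarith)
    refine (norm_gsum_le hP 0 fun x => (norm_eC _).le).trans ?_
    rw [mul_pow]
    have h2 : 0 ≤ A * C₁ * 2 ^ (κ * N) * P ^ n := by positivity
    have h3 : 0 ≤ thetaC ^ n * P ^ n := by positivity
    refine (le_mul_of_one_le_right h3 h1).trans ?_
    have := mul_nonneg h2 htN.le
    linarith
  set M := ⌊t⌋₊ with hM
  have hM1 : 1 ≤ M := Nat.le_floor (by simpa using ht1)
  have hM1' : (1 : ℝ) ≤ M := by exact_mod_cast hM1
  have hMt : (M : ℝ) ≤ t := Nat.floor_le ht0.le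
  have htM : t / 2 ≤ M := by
    have := Nat.lt_floor_add_one t
    rw [← hM] at this; linarith
  -- powers of `M`
  have hpow : ∀ k : ℕ, 1 ≤ k → (M : ℝ) ^ k ≤ c * t₀ ^ (k : ℝ) := fun k hk => by
    rw [Real.rpow_natCast]
    refine (pow_le_pow_left₀ (by positivity) hMt k).trans ?_
    rw [ht, mul_pow]
    exact mul_le_mul_of_nonneg_right (pow_le_of_le_one hc0.le hc1 (by omega)) (by positivity)
  have hpowP : ∀ k : ℕ, 1 ≤ k → (M : ℝ) ^ k ≤ c * P ^ (2 * κ / (u + w) * k) := fun k hk => by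
    refine (hpow k hk).trans (mul_le_mul_of_nonneg_left ?_ hc0.le)
    rw [Real.rpow_mul hP0.le]
    exact Real.rpow_le_rpow ht₀0.le (min_le_left _ _) (by positivity)
  have hu1 : 1 ≤ 2 ^ (j + 2) - 2 := by
    have : (1 : ℝ) ≤ ((2 ^ (j + 2) - 2 : ℕ) : ℝ) := by rw [hun]; linarith
    exact_mod_cast this
  have hw1 : 1 ≤ 2 ^ (j + 1) := Nat.one_le_two_pow
  have hMu : (M : ℝ) ^ (2 ^ (j + 2) - 2) ≤ c * P ^ (2 * κ / (u + w) * u) := by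
    have := hpowP _ hu1
    rwa [hun] at this
  have hMw : (M : ℝ) ^ 2 ^ (j + 1) ≤ c * P ^ (2 * κ / (u + w) * w) := by
    have := hpowP _ hw1
    rwa [hwn] at this
  have hMuw : (M : ℝ) ^ (2 ^ (j + 2) - 2 + 2 ^ (j + 1)) ≤ c * P ^ (2 * κ / (u + w) * (u + w)) := by
    have := hpowP (2 ^ (j + 2) - 2 + 2 ^ (j + 1)) (by omega)
    rwa [Nat.cast_add, hun, hwn] at this
  have hMq : (M : ℝ) ^ (2 ^ (j + 2) - 2) ≤ c * ((q : ℝ) ^ κ * (1 + Y)) := by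
    have h1 := hpow _ hu1
    rw [hun] at h1
    refine h1.trans (mul_le_mul_of_nonneg_left ?_ hc0.le)
    refine (Real.rpow_le_rpow ht₀0.le (min_le_right _ _) (by linarith)).trans (le_of_eq ?_)
    rw [← Real.rpow_mul (by positivity), one_div_mul_cancel (by linarith), Real.rpow_one]
  have hqK : (q : ℝ) ^ κ * (q : ℝ) ^ (1 / K : ℝ) = q := by
    rw [← Real.rpow_add hq0, hκ, sub_add_cancel, Real.rpow_one]
  have hPpos : ∀ x : ℝ, 0 < P ^ x := fun x => by positivity
  have key := hmain P M q a β hP hM1 hq ha ?_ ?_ ?_ ?_ ?_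
  · refine key.trans ?_
    have h1 := hlog M hM1'
    have h2 : ((M : ℝ)⁻¹) ^ N = (M : ℝ) ^ (-(N : ℝ)) := by
      rw [Real.rpow_neg (by positivity), Real.rpow_natCast, inv_pow]
    have h3 : (M : ℝ) ^ ((1 - κ) * N) * (M : ℝ) ^ (-(N : ℝ)) = (M : ℝ) ^ (-(κ * N)) := by
      rw [← Real.rpow_add (by positivity)]; congr 1; ring
    have h4 : (M : ℝ) ^ (-(κ * N)) ≤ 2 ^ (κ * N) * t ^ (-(κ * N)) := by
      refine (Real.rpow_le_rpow_of_nonpos (by positivity) htM (by linarith)).trans (le_of_eq ?_)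
      rw [Real.div_rpow ht0.le two_pos.le, Real.rpow_neg two_pos.le, div_inv_eq_mul, mul_comm]
    rw [h2]
    calc A * (1 + Real.log M) ^ n * P ^ n * (M : ℝ) ^ (-(N : ℝ))
        ≤ A * (C₁ * (M : ℝ) ^ ((1 - κ) * N)) * P ^ n * (M : ℝ) ^ (-(N : ℝ)) := by gcongr
      _ = A * C₁ * P ^ n * (M : ℝ) ^ (-(κ * N)) := by rw [← h3]; ring
      _ ≤ A * C₁ * P ^ n * (2 ^ (κ * N) * t ^ (-(κ * N))) :=
          mul_le_mul_of_nonneg_left h4 (by positivity)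
      _ ≤ _ := by
          have : 0 ≤ thetaC ^ n * P ^ n * t ^ (-(κ * N)) := by positivity
          linarith
  · refine hMw.trans ?_
    have h1 : P ^ (2 * κ / (u + w) * w) ≤ P := by
      conv_rhs => rw [← Real.rpow_one P]
      refine Real.rpow_le_rpow_of_exponent_le hP ?_
      rw [div_mul_eq_mul_div, div_le_one (by linarith)]
      linarith
    exact (mul_le_of_le_one_left (hPpos _).le hc1).trans h1
  · have h1 : (M : ℝ) ^ (2 ^ (j + 2) - 2) * (q * |β|) ≤
        c * P ^ (2 * κ / (u + w) * u) * P ^ (-(2 * u / (u + w))) :=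
      mul_le_mul hMu hβ (by positivity) (by positivity)
    have h2 : P ^ (2 * κ / (u + w) * u) * P ^ (-(2 * u / (u + w))) ≤ 1 := by
      rw [← Real.rpow_add hP0]
      refine Real.rpow_le_one_of_one_le_of_nonpos hP ?_
      have : 2 * κ / (u + w) * u + -(2 * u / (u + w)) = (κ - 1) * (2 * u / (u + w)) := by ring
      rw [this]
      exact mul_nonpos_of_nonpos_of_nonneg (by linarith) (by positivity)
    calc _ = A * ((M : ℝ) ^ (2 ^ (j + 2) - 2) * (q * |β|)) := by ring
      _ ≤ A * (c * P ^ (2 * κ / (u + w) * u) * P ^ (-(2 * u / (u + w)))) :=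
          mul_le_mul_of_nonneg_left h1 hA0.le
      _ = A * c * (P ^ (2 * κ / (u + w) * u) * P ^ (-(2 * u / (u + w)))) := by ring
      _ < 1 := by rw [hAc]; linarith
  · have h1 : (q : ℝ) ^ (1 / K : ℝ) ≤ P ^ (2 * u / (u + w) * (1 / K)) := by
      rw [Real.rpow_mul hP0.le]
      exact Real.rpow_le_rpow hq0.le hqP hK0.le
    have h2 : P ^ (2 * u / (u + w) * (1 / K)) * P ^ (2 * κ / (u + w) * (u + w)) ≤ P ^ 2 := by
      rw [← Real.rpow_add hP0, ← Real.rpow_two]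
      refine Real.rpow_le_rpow_of_exponent_le hP ?_
      rw [div_mul_cancel₀ _ (by linarith : u + w ≠ 0)]
      have : 2 * u / (u + w) ≤ 2 := by rw [div_le_iff₀ (by linarith)]; linarith
      have := mul_le_mul_of_nonneg_right this hK0.le
      rw [hκ]; linarith
    calc _ ≤ A * P ^ (2 * u / (u + w) * (1 / K)) * (c * P ^ (2 * κ / (u + w) * (u + w))) :=
          mul_le_mul (mul_le_mul_of_nonneg_left h1 hA0.le) hMuw (by positivity) (by positivity)
      _ = A * c * (P ^ (2 * u / (u + w) * (1 / K)) * P ^ (2 * κ / (u + w) * (u + w))) := by ring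
      _ ≤ A * c * P ^ 2 := mul_le_mul_of_nonneg_left h2 (by positivity)
      _ < P ^ 2 := by rw [hAc]; have : 0 < P ^ 2 := by positivity
                      linarith
  · have h2 : P ^ (2 * u / (u + w)) * P ^ (2 * κ / (u + w) * w) ≤ P ^ 2 := by
      rw [← Real.rpow_add hP0, ← Real.rpow_two]
      refine Real.rpow_le_rpow_of_exponent_le hP ?_
      rw [div_mul_eq_mul_div, ← add_div, div_le_iff₀ (by linarith)]
      linarith
    calc _ ≤ A * P ^ (2 * u / (u + w)) * (c * P ^ (2 * κ / (u + w) * w)) :=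
          mul_le_mul (mul_le_mul_of_nonneg_left hqP hA0.le) hMw (by positivity) (by positivity)
      _ = A * c * (P ^ (2 * u / (u + w)) * P ^ (2 * κ / (u + w) * w)) := by ring
      _ ≤ A * c * P ^ 2 := mul_le_mul_of_nonneg_left h2 (by positivity)
      _ < P ^ 2 := by rw [hAc]; have : 0 < P ^ 2 := by positivity
                      linarith
  · rcases le_or_gt Y 1 with hY1 | hY1
    · left
      have h1 : (q : ℝ) ^ κ ≤ q := by
        conv_rhs => rw [← Real.rpow_one (q : ℝ)]
        exact Real.rpow_le_rpow_of_exponent_le hq' hκ1.le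
      calc _ ≤ A * (c * ((q : ℝ) ^ κ * (1 + Y))) := mul_le_mul_of_nonneg_left hMq hA0.le
        _ = A * c * ((q : ℝ) ^ κ * (1 + Y)) := by ring
        _ ≤ A * c * (q * 2) := mul_le_mul_of_nonneg_left
            (mul_le_mul h1 (by linarith) (by linarith) hq0.le) (by positivity)
        _ < q := by rw [hAc]; linarith
    · right
      calc _ ≤ A * (c * ((q : ℝ) ^ κ * (1 + Y))) * (q : ℝ) ^ (1 / K : ℝ) :=
            mul_le_mul_of_nonneg_right (mul_le_mul_of_nonneg_left hMq hA0.le) (by positivity)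
        _ = A * c * (((q : ℝ) ^ κ * (q : ℝ) ^ (1 / K : ℝ)) * (1 + Y)) := by ring
        _ < q * Y := by
            have := mul_lt_mul_of_pos_left hY1 hq0
            rw [hAc, hqK]; linarith

/-- The bound for the generating function near a reduced fraction. -/
theorem gsum_bound {F : MvPolynomial (Fin n) ℤ} {j N : ℕ} (hj : 1 ≤ j)
    (hF : F.IsHomogeneous (j + 2)) (hS : HasStrata F (j + 1) N)
    (hN : ((j : ℝ) + 2) * (3 * 2 ^ (j + 1) - 2) < 2 * N) :
    ∃ D δ C : ℝ, 0 < D ∧ 0 < δ ∧ 0 < C ∧ ∀ (P : ℝ) (q : ℕ) (a : ℤ) (β : ℝ), 1 ≤ P → 1 ≤ q →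
      IsCoprime a q → (q : ℝ) ≤ P ^ D → q * |β| ≤ P ^ (-D) →
      ‖gsum P 0 fun x => eC (((a : ℝ) / q + β) * ((eval x F : ℤ) : ℝ))‖ ≤
        C * P ^ n * (P ^ (-((j : ℝ) + 2 + δ)) +
          (q : ℝ) ^ (-(2 + δ)) * ((1 + |β| * P ^ (j + 2)) ^ 2)⁻¹) := by
  set w : ℝ := 2 ^ (j + 1) with hw
  set u : ℝ := 2 ^ (j + 2) - 2 with hu
  have hw4 : 4 ≤ w := by
    have : (2 : ℝ) ^ 2 ≤ 2 ^ (j + 1) := pow_le_pow_right₀ one_le_two (by omega)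
    rw [hw]; linarith
  have huw : u = 2 * w - 2 := by rw [hu, hw]; ring
  have hu0 : 0 < u := by linarith
  have hj' : (1 : ℝ) ≤ j := by exact_mod_cast hj
  have h1 : (j : ℝ) + 2 < 2 * N / (u + w) := by
    rw [lt_div_iff₀ (by linarith), huw]
    calc _ = ((j : ℝ) + 2) * (3 * w - 2) := by ring
      _ < _ := hN
  have h2 : 2 < N / u := by
    rw [lt_div_iff₀ hu0]
    have : 0 ≤ ((j : ℝ) - 1) * (3 * w - 2) := mul_nonneg (by linarith) (by linarith)
    nlinarith
  obtain ⟨K, hK, hK1, hK2⟩ := exists_kappa h1 h2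
  set κ : ℝ := 1 - 1 / K with hκ
  have hN0 : (0 : ℝ) < N := by
    rcases (Nat.cast_nonneg (α := ℝ) N).eq_or_lt with h | h
    · rw [← h] at h2; norm_num at h2
    · exact h
  obtain ⟨C, hC, hmain⟩ := gsum_rpow_bound hF hS hK hu hw hκ (by exact_mod_cast hN0)
  have hK' : (2 : ℝ) ≤ K := by exact_mod_cast hK
  have hKh : 1 / (K : ℝ) ≤ 1 / 2 := one_div_le_one_div_of_le two_pos hK'
  have hK0 : 0 < 1 / (K : ℝ) := by positivity
  have hκ0 : 0 < κ := by rw [hκ]; linarith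
  have hκ1 : κ < 1 := by rw [hκ]; linarith
  set δ := min (κ ^ 2 * (2 * N / (u + w)) - (j + 2)) (κ ^ 2 * (N / u) - 2) with hδ
  have hδ1 : (j : ℝ) + 2 + δ ≤ κ ^ 2 * (2 * N / (u + w)) := by
    linarith [min_le_left (κ ^ 2 * (2 * N / (u + w)) - (j + 2)) (κ ^ 2 * (N / u) - 2)]
  have hδ2 : 2 + δ ≤ κ ^ 2 * (N / u) := by
    linarith [min_le_right (κ ^ 2 * (2 * N / (u + w)) - (j + 2)) (κ ^ 2 * (N / u) - 2)]
  have hδ0 : 0 < δ := lt_min (by linarith) (by linarith)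
  refine ⟨2 * u / (u + w), δ, C, by positivity, hδ0, hC, fun P q a β hP hq ha hqP hβ =>
    (hmain P q a β hP hq ha hqP hβ).trans (mul_le_mul_of_nonneg_left ?_ (by positivity))⟩
  have hP0 : 0 < P := by linarith
  have hq' : (1 : ℝ) ≤ q := by exact_mod_cast hq
  have hq0 : (0 : ℝ) < q := by linarith
  set Y := |β| * P ^ (j + 2) with hY
  have hY0 : 0 ≤ Y := by positivity
  rcases min_choice (P ^ (2 * κ / (u + w))) (((q : ℝ) ^ κ * (1 + Y)) ^ (1 / u)) with h | h
  · rw [h, ← Real.rpow_mul hP0.le]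
    refine (Real.rpow_le_rpow_of_exponent_le hP (z := -((j : ℝ) + 2 + δ)) ?_).trans
      (le_add_of_nonneg_right (by positivity))
    have : 2 * κ / (u + w) * -(κ * N) = -(κ ^ 2 * (2 * N / (u + w))) := by ring
    rw [this]; linarith
  · rw [h, ← Real.rpow_mul (by positivity), Real.mul_rpow (by positivity) (by positivity),
      ← Real.rpow_mul hq0.le]
    refine le_trans ?_ (le_add_of_nonneg_left (by positivity))
    refine mul_le_mul ?_ ?_ (by positivity) (by positivity)
    · refine Real.rpow_le_rpow_of_exponent_le hq' ?_
      have : κ * (1 / u * -(κ * N)) = -(κ ^ 2 * (N / u)) := by ring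
      rw [this]; linarith
    · have h3 : ((1 + Y) ^ 2)⁻¹ = (1 + Y) ^ (-2 : ℝ) := by
        rw [Real.rpow_neg (by positivity), Real.rpow_two]
      rw [h3]
      refine Real.rpow_le_rpow_of_exponent_le (by linarith) ?_
      have h4 : 1 / u * -(κ * N) = -(κ * (N / u)) := by ring
      have h5 : κ ^ 2 * (N / u) ≤ κ * (N / u) := by
        refine mul_le_mul_of_nonneg_right ?_ (by positivity)
        nlinarith
      rw [h4]; linarith

end MinorArcs

section LocalZeros

variable {n : ℕ}

theorem map_aeval_int {R S : Type*} [CommRing R] [Algebra ℤ R] [CommRing S] (φ : R →+* S) (x : Fin n → R)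
    (F : MvPolynomial (Fin n) ℤ) : φ (aeval x F) = aeval (fun i => φ (x i)) F := by
  rw [map_aeval, aeval_def, coe_eval₂Hom]
  congr 1
  exact Subsingleton.elim _ _

/-- The restriction of a polynomial to a line parallel to a coordinate axis. -/
def linePoly {R : Type*} [CommRing R] (F : MvPolynomial (Fin n) ℤ) (y : Fin n → R) (i : Fin n) :
    Polynomial R :=
  aeval (Function.update (fun j => Polynomial.C (y j)) i Polynomial.X) F

theorem eval_linePoly {R : Type*} [CommRing R] (F : MvPolynomial (Fin n) ℤ) (y : Fin n → R)
    (i : Fin n) (t : R) : (linePoly F y i).eval t = aeval (Function.update y i t) F := by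
  rw [linePoly, ← Polynomial.coe_evalRingHom, map_aeval_int]
  congr 2
  ext j
  rcases eq_or_ne j i with rfl | hj <;> simp [*]

theorem eval_derivative_linePoly {R : Type*} [CommRing R] (F : MvPolynomial (Fin n) ℤ)
    (y : Fin n → R) (i : Fin n) (t : R) :
    (linePoly F y i).derivative.eval t = aeval (Function.update y i t) (pderiv i F) := by
  rw [← eval_linePoly]
  congr 1
  induction F using MvPolynomial.induction_on with
  | C a => simp [linePoly]
  | add f g hf hg => simp only [linePoly, map_add] at hf hg ⊢; rw [hf, hg]
  | mul_X f j hf =>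
    simp only [linePoly, map_mul, Polynomial.derivative_mul, Derivation.leibniz, map_add,
      smul_eq_mul, aeval_X] at hf ⊢
    rw [hf]
    rcases eq_or_ne j i with rfl | hj
    · simp; ring
    · simp [hj, mul_comm]

/-- The number of zeros of `F` modulo `Q`. -/
def zcount (F : MvPolynomial (Fin n) ℤ) (Q : ℕ) : ℕ :=
  Nat.card {x : Fin n → ZMod Q // aeval x F = 0}

theorem zcount_mul (F : MvPolynomial (Fin n) ℤ) {a b : ℕ} (h : a.Coprime b) :
    zcount F (a * b) = zcount F a * zcount F b := by
  rw [zcount, zcount, zcount, ← Nat.card_prod]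
  refine Nat.card_congr (Equiv.trans (Equiv.subtypeEquiv
    ((Equiv.arrowCongr (Equiv.refl (Fin n)) (ZMod.chineseRemainder h).toEquiv).trans
      (Equiv.arrowProdEquivProdArrow (Fin n) (fun _ => ZMod a) (fun _ => ZMod b)))
    fun x => ?_) Equiv.subtypeProdEquivProd)
  rw [← (ZMod.chineseRemainder h).injective.eq_iff, map_zero, Prod.ext_iff]
  have h1 := map_aeval_int ((RingHom.fst _ _).comp (ZMod.chineseRemainder h).toRingHom) x F
  have h2 := map_aeval_int ((RingHom.snd _ _).comp (ZMod.chineseRemainder h).toRingHom) x F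
  exact and_congr (Eq.congr h1 rfl) (Eq.congr h2 rfl)

theorem sub_mem_of_forall {R : Type*} [CommRing R] (F : MvPolynomial (Fin n) ℤ) {I : Ideal R}
    {x y : Fin n → R} (h : ∀ i, x i - y i ∈ I) : aeval x F - aeval y F ∈ I := by
  rw [← Ideal.Quotient.eq]
  rw [map_aeval_int, map_aeval_int]
  congr 2
  ext i
  exact Ideal.Quotient.eq.2 (h i)

theorem exists_zcount_prime_pow (F : MvPolynomial (Fin n) ℤ) {p : ℕ} [Fact p.Prime]
    {x : Fin n → ℤ_[p]} {i : Fin n} (hx : aeval x F = 0) (hi : aeval x (pderiv i F) ≠ 0) :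
    ∃ c : ℝ, 0 < c ∧ ∀ e : ℕ, c * ((p ^ e : ℕ) : ℝ) ^ n ≤ zcount F (p ^ e) * (p ^ e : ℕ) := by
  set ε := ‖(aeval x (pderiv i F) : ℤ_[p])‖ with hε
  have hε0 : 0 < ε := norm_pos_iff.2 hi
  have hε1 : ε ≤ 1 := PadicInt.norm_le_one _
  obtain ⟨k, hk⟩ := PadicInt.exists_pow_neg_lt p (ε := ε ^ 2) (by positivity)
  have hkε : (p : ℝ) ^ (-(k : ℤ)) < ε := hk.trans_le (pow_le_of_le_one hε0.le hε1 two_ne_zero)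
  have hp : 0 < p := (Fact.out : p.Prime).pos
  have hlift : ∀ y : Fin n → ℤ_[p], (∀ j, y j - x j ∈ Ideal.span {(p ^ k : ℤ_[p])}) →
      ∃ t : ℤ_[p], aeval (Function.update y i t) F = 0 := fun y hy => by
    set y' := Function.update y i (x i) with hy'
    have hy'x : ∀ j, y' j - x j ∈ Ideal.span {(p ^ k : ℤ_[p])} := fun j => by
      rcases eq_or_ne j i with rfl | hj
      · simp [hy']
      · simpa [hy', hj] using hy j
    have h1 : ‖(aeval y' F : ℤ_[p])‖ ≤ (p : ℝ) ^ (-(k : ℤ)) := by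
      rw [PadicInt.norm_le_pow_iff_mem_span_pow]
      simpa [hx] using sub_mem_of_forall F hy'x
    have h2 : ‖(aeval y' (pderiv i F) : ℤ_[p])‖ = ε := by
      have h3 : ‖(aeval y' (pderiv i F) : ℤ_[p]) - aeval x (pderiv i F)‖ ≤
          (p : ℝ) ^ (-(k : ℤ)) := by
        rw [PadicInt.norm_le_pow_iff_mem_span_pow]
        exact sub_mem_of_forall _ hy'x
      have h4 := IsUltrametricDist.norm_add_eq_max_of_norm_ne_norm
        (x := (aeval y' (pderiv i F) : ℤ_[p]) - aeval x (pderiv i F))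
        (y := (aeval x (pderiv i F) : ℤ_[p])) (by rw [← hε]; linarith [h3.trans_lt hkε] |> ne_of_lt)
      rw [sub_add_cancel] at h4
      rw [h4, max_eq_right]
      exact (h3.trans_lt hkε).le
    obtain ⟨t, ht, -⟩ := hensels_lemma (p := p) (F := linePoly F y i) (a := x i) (by
      rw [Polynomial.coe_aeval_eq_eval, eval_linePoly, eval_derivative_linePoly, h2]
      exact h1.trans_lt hk)
    refine ⟨t, ?_⟩
    rwa [Polynomial.coe_aeval_eq_eval, eval_linePoly] at ht
  refine ⟨(((p ^ k : ℕ) : ℝ) ^ n)⁻¹, by positivity, fun e => ?_⟩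
  have : NeZero (p ^ e) := ⟨by positivity⟩
  have hcard : (p ^ (e - k)) ^ (n - 1) ≤ zcount F (p ^ e) := by
    set Y : ({j // j ≠ i} → Fin (p ^ (e - k))) → Fin n → ℤ_[p] := fun z j =>
      x j + if h : j ≠ i then (p ^ k : ℤ_[p]) * ((z ⟨j, h⟩ : ℕ) : ℤ_[p]) else 0 with hY
    have hYx : ∀ z j, Y z j - x j ∈ Ideal.span {(p ^ k : ℤ_[p])} := fun z j => by
      rw [hY, Ideal.mem_span_singleton]
      dsimp only
      split_ifs <;> simp
    choose T hT using fun z => hlift (Y z) (hYx z)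
    set f : ({j // j ≠ i} → Fin (p ^ (e - k))) → {x : Fin n → ZMod (p ^ e) // aeval x F = 0} :=
      fun z => ⟨fun j => PadicInt.toZModPow e (Function.update (Y z) i (T z) j), by
        have := congrArg (PadicInt.toZModPow e) (hT z)
        rwa [map_aeval_int, map_zero] at this⟩ with hf
    have hinj : Function.Injective f := fun z z' hzz => by
      funext ⟨j, hj⟩
      have h1 := congrFun (congrArg Subtype.val hzz) j
      simp only [hf, hY, Function.update_of_ne hj, map_add, dif_pos hj, map_mul, map_natCast,
        map_pow, add_right_inj] at h1
      rcases le_or_gt e k with hek | hek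
      · have h0 : p ^ (e - k) = 1 := by rw [Nat.sub_eq_zero_of_le hek, pow_zero]
        have h2 := (z ⟨j, hj⟩).2
        have h3 := (z' ⟨j, hj⟩).2
        ext; omega
      · have h2 : p ^ k * (z ⟨j, hj⟩ : ℕ) ≡ p ^ k * (z' ⟨j, hj⟩ : ℕ) [MOD p ^ k * p ^ (e - k)] := by
          rw [← pow_add, Nat.add_sub_cancel' hek.le, ← ZMod.natCast_eq_natCast_iff]
          push_cast; exact h1
        have h3 := Nat.ModEq.mul_left_cancel' (by positivity) h2
        ext
        exact Nat.ModEq.eq_of_lt_of_lt h3 (z ⟨j, hj⟩).2 (z' ⟨j, hj⟩).2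
    have := Nat.card_le_card_of_injective f hinj
    rw [zcount]
    refine le_trans (le_of_eq ?_) this
    simp [Fintype.card_subtype_compl]
  have hn : n = n - 1 + 1 := (Nat.succ_pred_eq_of_pos i.pos).symm
  have h1 : p ^ e ≤ p ^ k * p ^ (e - k) := by
    rw [← pow_add]; exact Nat.pow_le_pow_right hp (by omega)
  have h2 : (p ^ e) ^ n ≤ (p ^ k) ^ n * (zcount F (p ^ e) * p ^ e) := by
    calc (p ^ e) ^ n ≤ (p ^ k * p ^ (e - k)) ^ n := Nat.pow_le_pow_left h1 n
      _ = (p ^ k) ^ n * ((p ^ (e - k)) ^ (n - 1) * p ^ (e - k)) := by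
        rw [mul_pow, ← pow_succ, ← hn]
      _ ≤ _ := Nat.mul_le_mul_left _ (Nat.mul_le_mul hcard
        (Nat.pow_le_pow_right hp (Nat.sub_le e k)))
  rw [inv_mul_le_iff₀ (by positivity)]
  exact_mod_cast h2

end LocalZeros

section Congruences

variable {n : ℕ}

theorem aeval_zmod (F : MvPolynomial (Fin n) ℤ) (Q : ℕ) (x : Fin n → ℤ) :
    aeval (fun i => (x i : ZMod Q)) F = ((eval x F : ℤ) : ZMod Q) := by
  have := map_aeval_int (Int.castRingHom (ZMod Q)) x F
  exact this.symm.trans (by rw [aeval_eq_eval, eq_intCast])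

theorem exp_le_gau {P B : ℝ} (hP : 0 < P) {x : Fin n → ℤ} (hx : ∀ i, |(x i : ℝ)| ≤ B * P) :
    Real.exp (-(Real.pi * n * B ^ 2)) ≤ gau (P ^ 2)⁻¹ (toR x) := by
  rw [gau, Real.exp_le_exp]
  have h1 : ∑ i, toR x i ^ 2 ≤ n * (B * P) ^ 2 := by
    refine (Finset.sum_le_card_nsmul _ _ ((B * P) ^ 2) fun i _ => ?_).trans (le_of_eq ?_)
    · rw [← sq_abs]; exact pow_le_pow_left₀ (abs_nonneg _) (hx i) 2
    · simp
  have h2 : Real.pi * (P ^ 2)⁻¹ * ∑ i, toR x i ^ 2 ≤ Real.pi * (P ^ 2)⁻¹ * (n * (B * P) ^ 2) :=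
    mul_le_mul_of_nonneg_left h1 (by positivity)
  have h3 : Real.pi * (P ^ 2)⁻¹ * (n * (B * P) ^ 2) = Real.pi * n * B ^ 2 := by field_simp
  linarith

theorem le_tsum_gau {P : ℝ} (hP : 1 ≤ P) :
    Real.exp (-(Real.pi * n)) * P ^ n ≤ ∑' x : Fin n → ℤ, gau (P ^ 2)⁻¹ (toR x) := by
  have hP0 : 0 < P := by linarith
  have hs : Summable fun x : Fin n → ℤ => gau (P ^ 2)⁻¹ (toR x) := by
    simpa using summable_gau (t := (P ^ 2)⁻¹) (by positivity) (0 : Fin n → ℝ)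
  refine le_trans ?_ (hs.sum_le_tsum (boxR n P) fun x _ => (gau_pos _ _).le)
  have h1 : P ^ n ≤ ((boxR n P).card : ℝ) := by
    have h2 : P ≤ ((⌊P⌋ + 1 - -⌊P⌋).toNat : ℝ) := by
      have h3 : 0 ≤ ⌊P⌋ := Int.floor_nonneg.2 hP0.le
      have h4 : (((⌊P⌋ + 1 - -⌊P⌋).toNat : ℤ) : ℝ) = ((⌊P⌋ + 1 - -⌊P⌋ : ℤ) : ℝ) := by
        rw [Int.toNat_of_nonneg (by omega)]
      have h5 : (0 : ℝ) ≤ ⌊P⌋ := by exact_mod_cast h3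
      rw [Int.cast_natCast] at h4
      rw [h4]; push_cast
      linarith [Int.lt_floor_add_one P]
    rw [boxR, Fintype.card_piFinset]
    simp only [Int.card_Icc, Finset.prod_const, Finset.card_univ, Fintype.card_fin]
    push_cast
    exact pow_le_pow_left₀ hP0.le h2 n
  refine le_trans ?_ (Finset.card_nsmul_le_sum _ _ (Real.exp (-(Real.pi * n))) fun x hx => ?_)
  · rw [nsmul_eq_mul, mul_comm]
    exact mul_le_mul_of_nonneg_right h1 (Real.exp_pos _).le
  · simpa using exp_le_gau (B := 1) hP0 fun i => by simpa using mem_boxR.1 hx i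

theorem sum_gau_class_le {P : ℝ} {Q : ℕ} (hQ : 1 ≤ Q) (hP : (Q : ℝ) ≤ P) (c : Fin n → ZMod Q)
    (s : Finset (Fin n → ℤ)) (hs : ∀ x ∈ s, ∀ i, (x i : ZMod Q) = c i) :
    ∑ x ∈ s, gau (P ^ 2)⁻¹ (toR x) ≤ (thetaC * (P / Q)) ^ n := by
  have hQ0 : (0 : ℝ) < Q := by exact_mod_cast hQ
  have : NeZero Q := ⟨by omega⟩
  set r : Fin n → ℤ := fun i => ((c i).val : ℤ) with hr
  set c' : Fin n → ℝ := fun i => -(r i : ℝ) / Q with hc'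
  have hdiv : ∀ x ∈ s, ∀ i, x i = r i + Q * ((x i - r i) / Q) := fun x hx i => by
    have h1 : (Q : ℤ) ∣ x i - r i := by
      rw [← ZMod.intCast_zmod_eq_zero_iff_dvd]
      push_cast
      rw [hs x hx i, hr]
      simp
    rw [Int.mul_ediv_cancel' h1]; ring
  set f : (Fin n → ℤ) → Fin n → ℤ := fun x i => (x i - r i) / Q with hf
  have hinj : Set.InjOn f s := fun x hx y hy hxy => by
    funext i
    have := congrFun hxy i
    simp only [hf] at this
    rw [hdiv x hx i, hdiv y hy i, this]
  have hPQ : 1 ≤ P / Q := by rwa [one_le_div hQ0]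
  have hP0 : 0 < P := by linarith
  have h1 : ∑ x ∈ s, gau (P ^ 2)⁻¹ (toR x) =
      ∑ k ∈ s.image f, gau ((P / Q) ^ 2)⁻¹ (toR k - c') := by
    rw [Finset.sum_image hinj]
    refine Finset.sum_congr rfl fun x hx => ?_
    rw [gau, gau]
    congr 1
    rw [mul_assoc, mul_assoc]
    congr 1
    rw [Finset.mul_sum, Finset.mul_sum]
    refine Finset.sum_congr rfl fun i _ => ?_
    have h2 : (x i : ℝ) = r i + Q * (f x i : ℝ) := by exact_mod_cast hdiv x hx i
    simp only [toR, Pi.sub_apply, hc', h2]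
    field_simp
    ring
  rw [h1]
  exact ((summable_gau (by positivity) c').sum_le_tsum _ fun x _ => (gau_pos _ _).le).trans
    (tsum_gau_scale_le hPQ c')

theorem tsum_gau_dvd_le {F : MvPolynomial (Fin n) ℤ} {P : ℝ} {Q : ℕ} (hQ : 1 ≤ Q)
    (hP : (Q : ℝ) ≤ P) :
    ∑' x : Fin n → ℤ, (if (Q : ℤ) ∣ eval x F then gau (P ^ 2)⁻¹ (toR x) else 0) ≤
      zcount F Q * (thetaC * (P / Q)) ^ n := by
  have : NeZero Q := ⟨by omega⟩
  refine Real.tsum_le_of_sum_le (fun x => ?_) fun s => ?_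
  · split_ifs
    exacts [(gau_pos _ _).le, le_rfl]
  rw [← Finset.sum_filter]
  have h1 : ∀ x ∈ s.filter fun x => (Q : ℤ) ∣ eval x F, (fun i => (x i : ZMod Q)) ∈
      (Finset.univ.filter fun c : Fin n → ZMod Q => aeval c F = 0) := fun x hx => by
    rw [Finset.mem_filter] at hx ⊢
    exact ⟨Finset.mem_univ _, by rw [aeval_zmod, ZMod.intCast_zmod_eq_zero_iff_dvd]; exact hx.2⟩
  rw [← Finset.sum_fiberwise_of_maps_to h1]
  refine (Finset.sum_le_card_nsmul _ _ _ fun c _ =>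
    sum_gau_class_le hQ hP c _ fun x hx i => congrFun (Finset.mem_filter.1 hx).2 i).trans ?_
  rw [nsmul_eq_mul, zcount, Nat.card_eq_fintype_card, Fintype.card_subtype]

theorem eC_nat_mul (b : ℕ) (t : ℝ) : eC (b * t) = eC t ^ b := by
  rw [eC, eC, ← Complex.exp_nat_mul]; push_cast; ring_nf

theorem sum_eC_div {Q : ℕ} (hQ : 1 ≤ Q) (m : ℤ) :
    ∑ b ∈ Finset.range Q, eC ((b : ℝ) / Q * m) = if (Q : ℤ) ∣ m then (Q : ℂ) else 0 := by
  have hQ0 : (Q : ℝ) ≠ 0 := by exact_mod_cast (by omega : Q ≠ 0)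
  set z := eC ((m : ℝ) / Q) with hz
  have h1 : ∀ b : ℕ, eC ((b : ℝ) / Q * m) = z ^ b := fun b => by
    rw [hz, ← eC_nat_mul]; congr 1; ring
  simp only [h1]
  have h2 : z = 1 ↔ (Q : ℤ) ∣ m := by
    rw [hz, eC, Complex.exp_eq_one_iff]
    have h3 : ∀ k : ℤ, (2 * Real.pi * Complex.I * ((m : ℝ) / Q : ℝ) = k * (2 * Real.pi * Complex.I)) ↔
        m = Q * k := fun k => by
      rw [mul_comm, mul_left_inj' Complex.two_pi_I_ne_zero, ← Complex.ofReal_intCast,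
        Complex.ofReal_inj, div_eq_iff hQ0, mul_comm (k : ℝ)]
      exact_mod_cast Iff.rfl
    exact exists_congr h3
  split_ifs with h
  · simp [h2.2 h]
  · have h4 : z ^ Q = 1 := by
      rw [← h1, div_self hQ0, one_mul, eC_int]
    have h5 := mul_neg_geom_sum z Q
    rw [h4, sub_self] at h5
    exact (mul_eq_zero.1 h5).resolve_left (sub_ne_zero.2 fun h6 => h (h2.1 h6.symm))

theorem tsum_gau_dvd {F : MvPolynomial (Fin n) ℤ} {P : ℝ} {Q : ℕ} (hQ : 1 ≤ Q) (hP : 1 ≤ P) :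
    (((Q : ℝ) * ∑' x : Fin n → ℤ, (if (Q : ℤ) ∣ eval x F then gau (P ^ 2)⁻¹ (toR x) else 0) : ℝ) : ℂ)
      = ∑ b ∈ Finset.range Q, gsum P 0 fun x => eC ((b : ℝ) / Q * ((eval x F : ℤ) : ℝ)) := by
  have hP0 : 0 < P := by linarith
  simp only [gsum]
  rw [← Summable.tsum_finsetSum fun b _ =>
    summable_gau_mul (by positivity) 0 fun x => (norm_eC _).le, ← tsum_mul_left, Complex.ofReal_tsum]
  refine tsum_congr fun x => ?_
  rw [← Finset.mul_sum, sum_eC_div hQ, sub_zero]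
  split_ifs <;> push_cast <;> ring

end Congruences

section LocalDensities

variable {n : ℕ}

/-- The bound for the generating function of `F` on the arcs around reduced fractions with
denominator at most `P ^ D`. -/
def GsumBound (F : MvPolynomial (Fin n) ℤ) (d : ℕ) (D δ C : ℝ) : Prop :=
  ∀ (P : ℝ) (q : ℕ) (a : ℤ) (β : ℝ), 1 ≤ P → 1 ≤ q → IsCoprime a q → (q : ℝ) ≤ P ^ D →
    q * |β| ≤ P ^ (-D) →
    ‖gsum P 0 fun x => eC (((a : ℝ) / q + β) * ((eval x F : ℤ) : ℝ))‖ ≤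
      C * P ^ n * (P ^ (-((d : ℝ) + δ)) + (q : ℝ) ^ (-(2 + δ)) * ((1 + |β| * P ^ d) ^ 2)⁻¹)

theorem exists_sum_rpow_lt {δ ε : ℝ} (hδ : 0 < δ) (hε : 0 < ε) :
    ∃ k : ℕ, ∀ t : Finset ℕ, (∀ q ∈ t, k < q) → ∑ q ∈ t, (q : ℝ) ^ (-(1 + δ)) < ε := by
  obtain ⟨s, hs⟩ := summable_iff_vanishing_norm.1
    (Real.summable_nat_rpow.2 (show -(1 + δ) < -1 by linarith)) ε hε
  refine ⟨s.sup id, fun t ht => (le_abs_self _).trans_lt (hs t ?_)⟩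
  rw [Finset.disjoint_left]
  exact fun q hq hqs => absurd (Finset.le_sup (f := id) hqs) (not_le.2 (ht q hq))

theorem sum_div_gcd_le {Q : ℕ} (hQ : 1 ≤ Q) {f : ℕ → ℝ} (hf : ∀ q, 0 ≤ f q) :
    ∑ b ∈ (Finset.range Q).erase 0, f (Q / Q.gcd b) ≤ ∑ q ∈ Q.divisors.erase 1, (q : ℝ) * f q := by
  have h1 : ∀ b ∈ (Finset.range Q).erase 0, Q / Q.gcd b ∈ Q.divisors.erase 1 := fun b hb => by
    rw [Finset.mem_erase, Finset.mem_range] at hb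
    have h2 := Nat.gcd_dvd_left Q b
    rw [Finset.mem_erase, Nat.mem_divisors]
    refine ⟨fun h => ?_, Nat.div_dvd_of_dvd h2, by omega⟩
    rw [Nat.div_eq_iff_eq_mul_left (Nat.gcd_pos_of_pos_left _ hQ) h2, one_mul] at h
    have := Nat.le_of_dvd (Nat.pos_of_ne_zero hb.1) (show Q ∣ b by rw [h]; exact Nat.gcd_dvd_right Q b)
    omega
  rw [← Finset.sum_fiberwise_of_maps_to h1]
  refine Finset.sum_le_sum fun q hq => ?_
  rw [Finset.mem_erase, Nat.mem_divisors] at hq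
  rw [Finset.sum_congr rfl fun b hb => by rw [(Finset.mem_filter.1 hb).2], Finset.sum_const,
    nsmul_eq_mul]
  refine mul_le_mul_of_nonneg_right ?_ (hf q)
  have h3 := Nat.totient_div_of_dvd (Nat.div_dvd_of_dvd hq.2.1)
  rw [Nat.div_div_self hq.2.1 (by omega)] at h3
  have h4 : (((Finset.range Q).erase 0).filter fun b => Q / Q.gcd b = q).card ≤ Nat.totient q := by
    rw [h3]
    refine Finset.card_le_card fun b hb => ?_
    rw [Finset.mem_filter, Finset.mem_erase] at hb
    rw [Finset.mem_filter]
    refine ⟨hb.1.2, ?_⟩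
    rw [← hb.2, Nat.div_div_self (Nat.gcd_dvd_left _ _) (by omega)]
  exact_mod_cast h4.trans (Nat.totient_le q)

theorem exists_zcount_coprime {F : MvPolynomial (Fin n) ℤ} {d : ℕ} {D δ C : ℝ} (hD : 0 < D)
    (hδ : 0 < δ) (hC : 0 < C) (hB : GsumBound F d D δ C) :
    ∃ (k : ℕ) (c : ℝ), 0 < c ∧ ∀ Q : ℕ, 1 ≤ Q → (∀ p : ℕ, p.Prime → p ∣ Q → k < p) →
      c * (Q : ℝ) ^ n ≤ zcount F Q * Q := by
  set c₁ := Real.exp (-(Real.pi * n)) with hc₁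
  have hc₁0 : 0 < c₁ := Real.exp_pos _
  have hθ := one_le_thetaC
  obtain ⟨k, hk⟩ := exists_sum_rpow_lt hδ (show 0 < c₁ / (4 * C) by positivity)
  refine ⟨k, c₁ / (2 * thetaC ^ n), by positivity, fun Q hQ hQk => ?_⟩
  have hQ0 : (0 : ℝ) < Q := by exact_mod_cast hQ
  obtain ⟨P, hP1, hPQ, hPD, hPδ⟩ : ∃ P : ℝ, 1 ≤ P ∧ (Q : ℝ) ≤ P ∧ (Q : ℝ) ≤ P ^ D ∧
      P ^ (-((d : ℝ) + δ)) < c₁ / (4 * C * Q) := by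
    have h1 := (tendsto_rpow_atTop hD).eventually_ge_atTop (Q : ℝ)
    have h2 := (tendsto_rpow_neg_atTop (show 0 < (d : ℝ) + δ by positivity)).eventually_lt_const
      (show 0 < c₁ / (4 * C * Q) by positivity)
    obtain ⟨P, ⟨⟨hP1, hP2⟩, hP3⟩, hP4⟩ := (((Filter.eventually_ge_atTop (1 : ℝ)).and
      (Filter.eventually_ge_atTop (Q : ℝ))).and h1 |>.and h2).exists
    exact ⟨P, hP1, hP2, hP3, hP4⟩
  have hP0 : 0 < P := by linarith
  set W : ℝ := ∑' x : Fin n → ℤ, gau (P ^ 2)⁻¹ (toR x) with hW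
  set T : ℝ := ∑' x : Fin n → ℤ, (if (Q : ℤ) ∣ eval x F then gau (P ^ 2)⁻¹ (toR x) else 0) with hT
  have hWle := le_tsum_gau (n := n) hP1
  have hTle := tsum_gau_dvd_le (F := F) hQ hPQ
  have hid := tsum_gau_dvd (F := F) hQ hP1
  set g : ℕ → ℂ := fun b => gsum P 0 fun x => eC ((b : ℝ) / Q * ((eval x F : ℤ) : ℝ)) with hg
  have hg0 : g 0 = (W : ℂ) := by
    simp only [hg, gsum, hW, Complex.ofReal_tsum]
    refine tsum_congr fun x => ?_
    simp [eC_zero]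
  rw [← Finset.add_sum_erase _ g (Finset.mem_range.2 hQ), hg0] at hid
  have hgb : ∀ b ∈ (Finset.range Q).erase 0, ‖g b‖ ≤ C * P ^ n * (c₁ / (4 * C * Q)) +
      C * P ^ n * ((Q / Q.gcd b : ℕ) : ℝ) ^ (-(2 + δ)) := fun b hb => by
    rw [Finset.mem_erase, Finset.mem_range] at hb
    have hgpos : 0 < Q.gcd b := Nat.gcd_pos_of_pos_left _ hQ
    have h1 : 1 ≤ Q / Q.gcd b := Nat.div_pos (Nat.gcd_le_left _ hQ) hgpos
    have h2 : ((Q / Q.gcd b : ℕ) : ℝ) ≤ P ^ D :=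
      (Nat.cast_le.2 (Nat.div_le_self _ _)).trans hPD
    have h3 := hB P (Q / Q.gcd b) ((b / Q.gcd b : ℕ) : ℤ) 0 hP1 h1
      (Nat.isCoprime_iff_coprime.2 (Nat.coprime_div_gcd_div_gcd hgpos).symm) h2
      (by simpa using by positivity)
    have h4 : (((b / Q.gcd b : ℕ) : ℤ) : ℝ) / ((Q / Q.gcd b : ℕ) : ℝ) = (b : ℝ) / Q := by
      rw [Int.cast_natCast, Nat.cast_div (Nat.gcd_dvd_right _ _) (by positivity),
        Nat.cast_div (Nat.gcd_dvd_left _ _) (by positivity),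
        div_div_div_cancel_right₀ (by positivity)]
    simp only [h4, add_zero, abs_zero, zero_mul, one_pow, inv_one, mul_one] at h3
    refine h3.trans ?_
    rw [mul_add]
    have : C * P ^ n * P ^ (-((d : ℝ) + δ)) ≤ C * P ^ n * (c₁ / (4 * C * Q)) :=
      mul_le_mul_of_nonneg_left hPδ.le (by positivity)
    linarith
  have hsum : ∑ b ∈ (Finset.range Q).erase 0, ‖g b‖ ≤ c₁ / 2 * P ^ n := by
    refine (Finset.sum_le_sum hgb).trans ?_
    rw [Finset.sum_add_distrib, Finset.sum_const, ← Finset.mul_sum, nsmul_eq_mul,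
      Finset.card_erase_of_mem (Finset.mem_range.2 hQ), Finset.card_range]
    have h1 : ((Q - 1 : ℕ) : ℝ) * (C * P ^ n * (c₁ / (4 * C * Q))) ≤ c₁ / 4 * P ^ n := by
      have : ((Q - 1 : ℕ) : ℝ) ≤ Q := by exact_mod_cast Nat.sub_le _ _
      calc _ ≤ (Q : ℝ) * (C * P ^ n * (c₁ / (4 * C * Q))) :=
            mul_le_mul_of_nonneg_right this (by positivity)
        _ = _ := by field_simp
    have h2 := sum_div_gcd_le hQ (f := fun q => (q : ℝ) ^ (-(2 + δ))) fun q => by positivity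
    have h3 : ∑ q ∈ Q.divisors.erase 1, (q : ℝ) * (q : ℝ) ^ (-(2 + δ)) < c₁ / (4 * C) := by
      refine lt_of_eq_of_lt (Finset.sum_congr rfl fun q hq => ?_) (hk (Q.divisors.erase 1)
        fun q hq => ?_)
      · have hq0 : (0 : ℝ) < q := by
          exact_mod_cast Nat.pos_of_mem_divisors (Finset.mem_of_mem_erase hq)
        rw [show -(1 + δ) = 1 + -(2 + δ) by ring, Real.rpow_add hq0, Real.rpow_one]
      · rw [Finset.mem_erase, Nat.mem_divisors] at hq
        obtain ⟨p, hp, hpq⟩ := Nat.exists_prime_and_dvd hq.1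
        exact (hQk p hp (hpq.trans hq.2.1)).trans_le
          (Nat.le_of_dvd (Nat.pos_of_dvd_of_pos hq.2.1 hQ) hpq)
    have h4 : C * P ^ n * ∑ b ∈ (Finset.range Q).erase 0, ((Q / Q.gcd b : ℕ) : ℝ) ^ (-(2 + δ)) ≤
        c₁ / 4 * P ^ n := by
      calc _ ≤ C * P ^ n * (c₁ / (4 * C)) :=
            mul_le_mul_of_nonneg_left (h2.trans h3.le) (by positivity)
        _ = _ := by field_simp
    linarith
  have hmain : W - c₁ / 2 * P ^ n ≤ Q * T := by
    have h1 : ((Q * T - W : ℝ) : ℂ) = ∑ b ∈ (Finset.range Q).erase 0, g b := by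
      rw [Complex.ofReal_sub, hid]; ring
    have h2 : ‖((Q * T - W : ℝ) : ℂ)‖ ≤ c₁ / 2 * P ^ n := by
      rw [h1]; exact (norm_sum_le _ _).trans hsum
    rw [Complex.norm_real, Real.norm_eq_abs] at h2
    linarith [neg_abs_le (Q * T - W)]
  have h1 : c₁ / 2 * P ^ n ≤ Q * (zcount F Q * (thetaC * (P / Q)) ^ n) := by
    have := mul_le_mul_of_nonneg_left hTle hQ0.le
    linarith
  have h2 : Q * (zcount F Q * (thetaC * (P / Q)) ^ n) =
      (zcount F Q * Q) * thetaC ^ n * P ^ n / Q ^ n := by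
    rw [mul_pow, div_pow]; ring
  rw [h2, le_div_iff₀ (by positivity)] at h1
  have hPn : 0 < P ^ n := by positivity
  have h3 : c₁ / 2 * (Q : ℝ) ^ n ≤ zcount F Q * Q * thetaC ^ n := by
    refine le_of_mul_le_mul_right ?_ hPn
    linarith
  rw [div_mul_eq_mul_div, div_le_iff₀ (by positivity)]
  linarith

theorem exists_zcount_of_prime_pow {F : MvPolynomial (Fin n) ℤ} {k : ℕ} {c : ℝ} (hc : 0 < c)
    (hk : ∀ Q : ℕ, 1 ≤ Q → (∀ p : ℕ, p.Prime → p ∣ Q → k < p) → c * (Q : ℝ) ^ n ≤ zcount F Q * Q)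
    (hp : ∀ p : ℕ, p.Prime → ∃ c : ℝ, 0 < c ∧ ∀ e : ℕ,
      c * ((p ^ e : ℕ) : ℝ) ^ n ≤ zcount F (p ^ e) * (p ^ e : ℕ)) :
    ∃ c : ℝ, 0 < c ∧ ∀ Q : ℕ, 1 ≤ Q → c * (Q : ℝ) ^ n ≤ zcount F Q * Q := by
  induction k generalizing c with
  | zero => exact ⟨c, hc, fun Q hQ => hk Q hQ fun p hp _ => hp.pos⟩
  | succ k ih =>
    by_cases hk1 : (k + 1).Prime
    · obtain ⟨c', hc', h⟩ := hp _ hk1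
      refine ih (mul_pos hc' hc) fun Q hQ hQk => ?_
      have hQ0 : Q ≠ 0 := by omega
      have h1 := h (Q.factorization (k + 1))
      have h2 := hk (Q / (k + 1) ^ Q.factorization (k + 1)) (Nat.ordCompl_pos _ hQ0)
        fun p hp hpd => lt_of_le_of_ne (hQk p hp (hpd.trans (Nat.ordCompl_dvd _ _))) fun h => by
          subst h
          exact Nat.not_dvd_ordCompl hk1 hQ0 hpd
      have h3 := zcount_mul F (Nat.coprime_ordCompl hk1 hQ0 |>.pow_left (Q.factorization (k + 1)))
      have h4 := Nat.ordProj_mul_ordCompl_eq_self Q (k + 1)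
      rw [h4] at h3
      have h5 : (Q : ℝ) = (((k + 1) ^ Q.factorization (k + 1) : ℕ) : ℝ) *
        ((Q / (k + 1) ^ Q.factorization (k + 1) : ℕ) : ℝ) := by rw [← Nat.cast_mul, h4]
      rw [h3, h5, Nat.cast_mul]
      calc _ = (c' * (((k + 1) ^ Q.factorization (k + 1) : ℕ) : ℝ) ^ n) *
            (c * ((Q / (k + 1) ^ Q.factorization (k + 1) : ℕ) : ℝ) ^ n) := by rw [mul_pow]; ring
        _ ≤ _ := mul_le_mul h1 h2 (by positivity) (by positivity)
        _ = _ := by ring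
    · exact ih hc fun Q hQ hQk => hk Q hQ fun p hp hpd =>
        lt_of_le_of_ne (hQk p hp hpd) fun h => hk1 (h ▸ hp)

end LocalDensities

section PadicDensity

variable {n : ℕ}

theorem aeval_mul_of_isHomogeneous {R : Type*} [CommRing R] {F : MvPolynomial (Fin n) ℤ} {d : ℕ}
    (hF : F.IsHomogeneous d) (c : R) (x : Fin n → R) :
    aeval (fun i => c * x i) F = c ^ d * aeval x F := by
  simp only [aeval_def, eval₂_eq', Finset.mul_sum]
  refine Finset.sum_congr rfl fun m hm => ?_
  have h : ∑ i, m i = d := by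
    simpa [Finsupp.weight_apply, Finsupp.sum_fintype] using hF (mem_support_iff.1 hm)
  simp only [mul_pow, Finset.prod_mul_distrib, Finset.prod_pow_eq_pow_sum, h]
  ring

theorem eval_map_int {R : Type*} [CommRing R] (F : MvPolynomial (Fin n) ℤ) (x : Fin n → R) :
    eval x (map (Int.castRingHom R) F) = aeval x F := by
  rw [eval_map, aeval_def]; rfl

theorem exists_padicInt_zero {F : MvPolynomial (Fin n) ℤ} {d : ℕ} (hF : F.IsHomogeneous d) {p : ℕ}
    [Fact p.Prime] {x : Fin n → ℚ_[p]} {i : Fin n} (hx : aeval x F = 0)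
    (hi : aeval x (pderiv i F) ≠ 0) :
    ∃ z : Fin n → ℤ_[p], aeval z F = 0 ∧ aeval z (pderiv i F) ≠ 0 := by
  obtain ⟨b, hb⟩ := IsLocalization.exist_integer_multiples_of_finite (nonZeroDivisors ℤ_[p]) x
  choose z hz using hb
  have hb0 : algebraMap ℤ_[p] ℚ_[p] b ≠ 0 :=
    (map_ne_zero_iff _ (IsFractionRing.injective ℤ_[p] ℚ_[p])).2 (nonZeroDivisors.ne_zero b.2)
  have key : ∀ {G : MvPolynomial (Fin n) ℤ} {k : ℕ}, G.IsHomogeneous k →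
      algebraMap ℤ_[p] ℚ_[p] (aeval z G) = algebraMap ℤ_[p] ℚ_[p] b ^ k * aeval x G := fun hG => by
    rw [map_aeval_int, ← aeval_mul_of_isHomogeneous hG]
    congr 2
    ext j
    rw [hz, Algebra.smul_def]
  refine ⟨z, ?_, fun h => ?_⟩
  · refine IsFractionRing.injective ℤ_[p] ℚ_[p] ?_
    rw [key hF, hx, mul_zero, map_zero]
  · have := key hF.pderiv (G := pderiv i F)
    rw [h, map_zero] at this
    exact mul_ne_zero (pow_ne_zero _ hb0) hi this.symm

theorem exists_zcount {F : MvPolynomial (Fin n) ℤ} {d : ℕ} (hF : F.IsHomogeneous d) {D δ C : ℝ}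
    (hD : 0 < D) (hδ : 0 < δ) (hC : 0 < C) (hB : GsumBound F d D δ C)
    (hp : ∀ (p : ℕ) [Fact p.Prime], ∃ x : Fin n → ℚ_[p],
      eval x (map (Int.castRingHom ℚ_[p]) F) = 0 ∧
        ∃ i, eval x (pderiv i (map (Int.castRingHom ℚ_[p]) F)) ≠ 0) :
    ∃ c : ℝ, 0 < c ∧ ∀ Q : ℕ, 1 ≤ Q → c * (Q : ℝ) ^ n ≤ zcount F Q * Q := by
  obtain ⟨k, c, hc, hk⟩ := exists_zcount_coprime hD hδ hC hB
  refine exists_zcount_of_prime_pow hc hk fun p hp' => ?_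
  have : Fact p.Prime := ⟨hp'⟩
  obtain ⟨x, hx, i, hi⟩ := hp p
  rw [pderiv_map, eval_map_int] at hi
  rw [eval_map_int] at hx
  obtain ⟨z, hz, hzi⟩ := exists_padicInt_zero hF hx hi
  exact exists_zcount_prime_pow F hz hzi

end PadicDensity

section RealDensity

variable {n : ℕ}

theorem contDiff_aeval (F : MvPolynomial (Fin n) ℤ) :
    ContDiff ℝ 1 fun x : Fin n → ℝ => aeval x F := by
  simp only [aeval_def, eval₂_eq']
  fun_prop

theorem aeval_real (F : MvPolynomial (Fin n) ℤ) (x : Fin n → ℤ) :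
    aeval (fun i => (x i : ℝ)) F = ((eval x F : ℤ) : ℝ) := by
  have := map_aeval_int (Int.castRingHom ℝ) x F
  exact this.symm.trans (by rw [aeval_eq_eval, eq_intCast])

theorem exists_finset_int {Q : ℕ} (hQ : 1 ≤ Q) {R : ℝ} (hR : (Q : ℝ) ≤ R) (u : ℝ) (r : ℤ) :
    ∃ S : Finset ℤ, (∀ x ∈ S, (Q : ℤ) ∣ x - r ∧ |(x : ℝ) - u| ≤ R) ∧ R / Q ≤ S.card := by
  have hQ0 : (0 : ℝ) < Q := by exact_mod_cast hQ
  set k : ℤ := ⌈(u - r - R) / Q⌉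
  set M : ℕ := ⌊2 * R / Q⌋₊
  have hk1 : u - r - R ≤ k * Q := (div_le_iff₀ hQ0).1 (Int.le_ceil _)
  have hk2 : k * Q < u - r - R + Q := by
    have := Int.ceil_lt_add_one ((u - r - R) / Q)
    have h2 : (k : ℝ) * Q < ((u - r - R) / Q + 1) * Q := mul_lt_mul_of_pos_right this hQ0
    rwa [add_mul, div_mul_cancel₀ _ hQ0.ne', one_mul] at h2
  have hM1 : (M : ℝ) * Q ≤ 2 * R := (le_div_iff₀ hQ0).1 (Nat.floor_le
    (div_nonneg (by linarith) hQ0.le))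
  have hinj : Function.Injective fun m : ℕ => r + Q * (k + m) := fun a b h => by
    have h1 : (Q : ℤ) * (k + a) = Q * (k + b) := add_left_cancel h
    have h2 := mul_left_cancel₀ (show (Q : ℤ) ≠ 0 by omega) h1
    exact_mod_cast add_left_cancel h2
  refine ⟨(Finset.range M).map ⟨_, hinj⟩, fun x hx => ?_, ?_⟩
  · obtain ⟨m, hm, rfl⟩ := Finset.mem_map.1 hx
    refine ⟨⟨k + m, by simp⟩, ?_⟩
    have hm1 : (m : ℝ) + 1 ≤ M := by exact_mod_cast Finset.mem_range.1 hm
    have hm2 : ((m : ℝ) + 1) * Q ≤ M * Q := mul_le_mul_of_nonneg_right hm1 hQ0.le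
    have hm3 : (0 : ℝ) ≤ m * Q := by positivity
    simp only [Function.Embedding.coeFn_mk]
    push_cast
    rw [abs_le]
    constructor <;> nlinarith
  · rw [Finset.card_map, Finset.card_range]
    have h1 : 2 * R / Q < M + 1 := Nat.lt_floor_add_one _
    have h2 : 1 ≤ R / Q := (one_le_div hQ0).2 hR
    have h3 : 2 * R / Q = R / Q + R / Q := by ring
    linarith

theorem exists_real_zero_near {F : MvPolynomial (Fin n) ℤ} {ξ : Fin n → ℝ} {i : Fin n}
    (hξ : aeval ξ F = 0) (hi : aeval ξ (pderiv i F) ≠ 0) :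
    ∃ ρ L : ℝ, 0 < ρ ∧ ρ ≤ 1 ∧ 1 ≤ L ∧ ∀ y : Fin n → ℝ, (∀ j, |y j - ξ j| ≤ ρ) →
      ∃ t, |t - ξ i| ≤ 1 ∧ ∀ s, |s - t| ≤ 1 → |aeval (Function.update y i s) F| ≤ L * |s - t| := by
  have hr : (linePoly F ξ i).IsRoot (ξ i) := by
    rw [Polynomial.IsRoot, eval_linePoly, Function.update_eq_self, hξ]
  obtain ⟨H, hH⟩ := Polynomial.dvd_iff_isRoot.2 hr
  have hH0 : H.eval (ξ i) ≠ 0 := by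
    have h1 := eval_derivative_linePoly F ξ i (ξ i)
    rw [Function.update_eq_self, hH] at h1
    simp only [Polynomial.derivative_mul, Polynomial.derivative_sub, Polynomial.derivative_X,
      Polynomial.derivative_C, Polynomial.eval_add, Polynomial.eval_mul, Polynomial.eval_sub,
      Polynomial.eval_X, Polynomial.eval_C, sub_self, zero_mul, add_zero, sub_zero,
      one_mul] at h1
    rwa [h1]
  have hpos : ∀ᶠ t in nhds (ξ i), 0 < H.eval t * H.eval (ξ i) :=
    (H.continuous.mul continuous_const).continuousAt.eventually
      (lt_mem_nhds (mul_self_pos.2 hH0))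
  obtain ⟨ε', hε', hpos⟩ := Metric.eventually_nhds_iff.1 hpos
  set ε := min (ε' / 2) 1
  have hε : 0 < ε := lt_min (by linarith) one_pos
  have hεε : ε < ε' := (min_le_left _ _).trans_lt (by linarith)
  have hF : Continuous fun x : Fin n → ℝ => aeval x F := (contDiff_aeval F).continuous
  have hneg : aeval (Function.update ξ i (ξ i + ε)) F * aeval (Function.update ξ i (ξ i - ε)) F <
      0 := by
    rw [← eval_linePoly, ← eval_linePoly, hH]
    simp only [Polynomial.eval_mul, Polynomial.eval_sub, Polynomial.eval_X, Polynomial.eval_C]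
    have h1 := hpos (y := ξ i + ε) (by simpa [abs_of_pos hε] using hεε)
    have h2 := hpos (y := ξ i - ε) (by simpa [Real.dist_eq, abs_of_pos hε] using hεε)
    have h3 : 0 < H.eval (ξ i + ε) * H.eval (ξ i - ε) := by
      have h4 := mul_pos h1 h2
      have h5 : 0 < H.eval (ξ i + ε) * H.eval (ξ i - ε) * (H.eval (ξ i) * H.eval (ξ i)) := by
        calc _ < _ := h4
          _ = _ := by ring
      exact pos_of_mul_pos_left h5 (mul_self_nonneg _)
    have h6 : 0 < ε ^ 2 * (H.eval (ξ i + ε) * H.eval (ξ i - ε)) := by positivity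
    calc _ = -(ε ^ 2 * (H.eval (ξ i + ε) * H.eval (ξ i - ε))) := by ring
      _ < 0 := by linarith
  have hcont : ∀ s : ℝ, Continuous fun y : Fin n → ℝ => aeval (Function.update y i s) F :=
    fun s => hF.comp (continuous_id.update i continuous_const)
  have hnear : ∀ᶠ y in nhds ξ, aeval (Function.update y i (ξ i + ε)) F *
      aeval (Function.update y i (ξ i - ε)) F < 0 :=
    ((hcont _).mul (hcont _)).continuousAt.eventually (gt_mem_nhds hneg)
  obtain ⟨ρ', hρ', hnear⟩ := Metric.eventually_nhds_iff.1 hnear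
  obtain ⟨L, hL⟩ := (contDiff_aeval F).contDiffOn.exists_lipschitzOnWith (s := Metric.closedBall ξ 2)
    one_ne_zero (convex_closedBall _ _) (isCompact_closedBall _ _)
  refine ⟨min (ρ' / 2) 1, max L 1, lt_min (by linarith) one_pos, min_le_right _ _,
    le_max_right _ _, fun y hy => ?_⟩
  have hyρ : dist y ξ < ρ' := by
    refine lt_of_le_of_lt ?_ (show ρ' / 2 < ρ' by linarith)
    rw [dist_pi_le_iff (by linarith)]
    exact fun j => (hy j).trans (min_le_left _ _)
  have hy1 : ∀ j, |y j - ξ j| ≤ 1 := fun j => (hy j).trans (min_le_right _ _)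
  have hct : Continuous fun t : ℝ => aeval (Function.update y i t) F :=
    hF.comp (continuous_const.update i continuous_id)
  have h0 : (0 : ℝ) ∈ Set.uIcc (aeval (Function.update y i (ξ i - ε)) F)
      (aeval (Function.update y i (ξ i + ε)) F) := by
    rw [Set.mem_uIcc]
    rcases mul_neg_iff.1 (hnear hyρ) with h | h
    · exact Or.inl ⟨h.2.le, h.1.le⟩
    · exact Or.inr ⟨h.1.le, h.2.le⟩
  obtain ⟨t, ht, ht0⟩ := intermediate_value_uIcc hct.continuousOn h0
  have htξ : |t - ξ i| ≤ 1 := by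
    rw [Set.uIcc_of_le (by linarith)] at ht
    have : ε ≤ 1 := min_le_right _ _
    rw [abs_le]
    constructor <;> linarith [ht.1, ht.2]
  refine ⟨t, htξ, fun s hs => ?_⟩
  have hmem : ∀ u : ℝ, |u - ξ i| ≤ 2 → Function.update y i u ∈ Metric.closedBall ξ 2 :=
    fun u hu => by
    rw [Metric.mem_closedBall, dist_pi_le_iff (by norm_num)]
    intro j
    by_cases hj : j = i
    · subst hj
      simpa [Real.dist_eq] using hu
    · rw [Function.update_of_ne hj, Real.dist_eq]
      linarith [hy1 j]
  have h1 := hL.dist_le_mul _ (hmem s (by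
    rw [show s - ξ i = (s - t) + (t - ξ i) by ring]
    linarith [abs_add_le (s - t) (t - ξ i)])) _ (hmem t (by linarith))
  simp only at ht0
  rw [ht0, Real.dist_eq, sub_zero] at h1
  refine h1.trans (mul_le_mul (le_max_left _ _) ?_ dist_nonneg (le_max_of_le_right zero_le_one))
  rw [dist_pi_le_iff (abs_nonneg _)]
  intro j
  by_cases hj : j = i
  · subst hj
    simp [Real.dist_eq]
  · rw [Function.update_of_ne hj, Function.update_of_ne hj, dist_self]
    exact abs_nonneg _

theorem exists_finset_near_zero {F : MvPolynomial (Fin n) ℤ} {d : ℕ} (hF : F.IsHomogeneous d)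
    {ξ : Fin n → ℝ} {i : Fin n} (hξ : aeval ξ F = 0) (hi : aeval ξ (pderiv i F) ≠ 0) :
    ∃ c B η₀ : ℝ, 0 < c ∧ 0 < B ∧ 0 < η₀ ∧ ∀ (η : ℝ) (Q : ℕ), 0 < η → η ≤ η₀ → 1 ≤ Q →
      ∃ P₀ : ℝ, 1 ≤ P₀ ∧ ∀ P, P₀ ≤ P → ∀ r : Fin n → ℤ, ∃ s : Finset (Fin n → ℤ),
        (∀ x ∈ s, (∀ j, (Q : ℤ) ∣ x j - r j) ∧ (∀ j, |(x j : ℝ)| ≤ B * P) ∧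
          |((eval x F : ℤ) : ℝ)| ≤ η * P ^ d) ∧ c * η * (P / Q) ^ n ≤ s.card := by
  obtain ⟨ρ, L, hρ, hρ1, hL, hroot⟩ := exists_real_zero_near hξ hi
  have hL0 : 0 < L := one_pos.trans_le hL
  obtain ⟨m, rfl⟩ : ∃ m, n = m + 1 := ⟨n - 1, by have := i.2; omega⟩
  refine ⟨ρ ^ m / L, ‖ξ‖ + 2, L, by positivity, by positivity, hL0,
    fun η Q hη hηL hQ => ⟨max 1 (max (Q / ρ) (Q * L / η)), le_max_left _ _, fun P hP r => ?_⟩⟩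
  have hQ0 : (0 : ℝ) < Q := by exact_mod_cast hQ
  have hP1 : 1 ≤ P := (le_max_left _ _).trans hP
  have hP0 : 0 < P := one_pos.trans_le hP1
  have hP2 : (Q : ℝ) ≤ P * ρ :=
    (div_le_iff₀ hρ).1 (((le_max_left _ _).trans (le_max_right _ _)).trans hP)
  have hP3 : (Q : ℝ) ≤ P * (η / L) := by
    have := (div_le_iff₀ hη).1 (((le_max_right _ _).trans (le_max_right _ _)).trans hP)
    rw [← mul_div_assoc, le_div_iff₀ hL0]
    exact this
  choose S hS hScard using fun (u : ℝ) (r : ℤ) => exists_finset_int hQ hP2 u r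
  choose S' hS' hScard' using fun (u : ℝ) (r : ℤ) => exists_finset_int hQ hP3 u r
  set T : Finset (Fin (m + 1) → ℤ) :=
    Fintype.piFinset fun j => if j = i then {0} else S (P * ξ j) (r j)
  have hT : ∀ y ∈ T, y i = 0 ∧ ∀ j, j ≠ i → y j ∈ S (P * ξ j) (r j) := fun y hy => by
    rw [Fintype.mem_piFinset] at hy
    refine ⟨by simpa using hy i, fun j hj => by simpa [hj] using hy j⟩
  have hTy : ∀ y ∈ T, ∀ j, |Function.update (fun j => (y j : ℝ) / P) i (ξ i) j - ξ j| ≤ ρ :=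
    fun y hy j => by
    by_cases hj : j = i
    · subst hj
      simpa using hρ.le
    · rw [Function.update_of_ne hj]
      have h1 := (hS _ _ _ ((hT y hy).2 j hj)).2
      rw [show (y j : ℝ) / P - ξ j = (y j - P * ξ j) / P by field_simp, abs_div, abs_of_pos hP0,
        div_le_iff₀ hP0]
      linarith
  have hex : ∀ y : Fin (m + 1) → ℤ, ∃ t : ℝ, y ∈ T → |t - ξ i| ≤ 1 ∧ ∀ s, |s - t| ≤ 1 →
      |aeval (Function.update (fun j => (y j : ℝ) / P) i s) F| ≤ L * |s - t| := fun y => by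
    by_cases hy : y ∈ T
    · obtain ⟨t, ht, ht'⟩ := hroot _ (hTy y hy)
      refine ⟨t, fun _ => ⟨ht, fun s hs => ?_⟩⟩
      have := ht' s hs
      rwa [Function.update_idem] at this
    · exact ⟨0, fun h => absurd h hy⟩
  choose t ht using hex
  refine ⟨(T.sigma fun y => S' (P * t y) (r i)).image fun p => Function.update p.1 i p.2,
    fun x hx => ?_, ?_⟩
  · obtain ⟨⟨y, z⟩, hp, rfl⟩ := Finset.mem_image.1 hx
    rw [Finset.mem_sigma] at hp
    obtain ⟨hy, hz⟩ := hp
    simp only at hy hz ⊢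
    have hz1 := hS' _ _ _ hz
    have hzt : |(z : ℝ) / P - t y| ≤ η / L := by
      rw [show (z : ℝ) / P - t y = (z - P * t y) / P by field_simp, abs_div, abs_of_pos hP0,
        div_le_iff₀ hP0]
      linarith [hz1.2]
    have hηL1 : η / L ≤ 1 := (div_le_one hL0).2 hηL
    have hξn : ∀ j, |ξ j| ≤ ‖ξ‖ := fun j => norm_le_pi_norm ξ j
    refine ⟨fun j => ?_, fun j => ?_, ?_⟩
    · by_cases hj : j = i
      · subst hj
        simpa using hz1.1
      · rw [Function.update_of_ne hj]
        exact (hS _ _ _ ((hT y hy).2 j hj)).1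
    · by_cases hj : j = i
      · subst hj
        rw [Function.update_self]
        have h1 : |(z : ℝ) / P| ≤ ‖ξ‖ + 2 := by
          have h2 := abs_add_le ((z : ℝ) / P - t y) (t y - ξ j + ξ j)
          have h3 := abs_add_le (t y - ξ j) (ξ j)
          rw [show (z : ℝ) / P - t y + (t y - ξ j + ξ j) = z / P by ring] at h2
          linarith [(ht y hy).1, hξn j]
        rwa [abs_div, abs_of_pos hP0, div_le_iff₀ hP0] at h1
      · rw [Function.update_of_ne hj]
        have h1 := (hS _ _ _ ((hT y hy).2 j hj)).2
        have h2 := abs_add_le ((y j : ℝ) - P * ξ j) (P * ξ j)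
        rw [sub_add_cancel, abs_mul, abs_of_pos hP0] at h2
        have h3 := mul_le_mul_of_nonneg_left (hξn j) hP0.le
        have h4 := mul_le_mul_of_nonneg_left hρ1 hP0.le
        linarith
    · have h1 := (ht y hy).2 _ (hzt.trans hηL1)
      have h2 : ((eval (Function.update y i z) F : ℤ) : ℝ) =
          P ^ d * aeval (Function.update (fun j => (y j : ℝ) / P) i (z / P)) F := by
        rw [← aeval_mul_of_isHomogeneous hF, ← aeval_real]
        congr 2
        ext j
        by_cases hj : j = i
        · subst hj
          simp only [Function.update_self]
          field_simp
        · simp only [Function.update_of_ne hj]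
          field_simp
      rw [h2, abs_mul, abs_of_pos (pow_pos hP0 d), mul_comm]
      refine mul_le_mul_of_nonneg_right (h1.trans ?_) (by positivity)
      calc L * |(z : ℝ) / P - t y| ≤ L * (η / L) := mul_le_mul_of_nonneg_left hzt hL0.le
        _ = η := by field_simp
  · rw [Finset.card_image_of_injOn, Finset.card_sigma]
    · push_cast
      have hTc : (P * ρ / Q) ^ m ≤ (T.card : ℝ) := by
        rw [Fintype.card_piFinset]
        push_cast
        rw [← Finset.mul_prod_erase _ _ (Finset.mem_univ i), if_pos rfl, Finset.card_singleton,
          Nat.cast_one, one_mul]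
        calc (P * ρ / Q) ^ m = ∏ _j ∈ Finset.univ.erase i, (P * ρ / Q) := by
              rw [Finset.prod_const, Finset.card_erase_of_mem (Finset.mem_univ i),
                Finset.card_univ, Fintype.card_fin, Nat.add_sub_cancel]
          _ ≤ _ := Finset.prod_le_prod (fun _ _ => by positivity) fun j hj => by
              rw [if_neg (Finset.ne_of_mem_erase hj)]
              exact hScard _ _
      calc ρ ^ m / L * η * (P / Q) ^ (m + 1) = (P * ρ / Q) ^ m * (P * (η / L) / Q) := by
            rw [pow_succ, mul_div_assoc, mul_div_assoc, div_pow, mul_pow, div_pow]; ring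
        _ ≤ T.card * (P * (η / L) / Q) := mul_le_mul_of_nonneg_right hTc (by positivity)
        _ = ∑ _y ∈ T, P * (η / L) / Q := by rw [Finset.sum_const, nsmul_eq_mul]
        _ ≤ _ := Finset.sum_le_sum fun y _ => hScard' _ _
    · rintro ⟨y, z⟩ hp ⟨y', z'⟩ hp' h
      rw [Finset.mem_coe, Finset.mem_sigma] at hp hp'
      simp only at h hp hp'
      have h1 : z = z' := by simpa using congrFun h i
      have h2 : y = y' := by
        ext j
        by_cases hj : j = i
        · rw [hj, (hT y hp.1).1, (hT y' hp'.1).1]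
        · simpa [hj] using congrFun h j
      subst h1 h2
      rfl

end RealDensity

section Fejer

variable {n : ℕ}

theorem continuous_eC : Continuous eC := by
  unfold eC
  fun_prop

theorem norm_eC_sub_one_le (t : ℝ) : ‖eC t - 1‖ ≤ 2 * Real.pi * |t| := by
  have h := Real.norm_exp_I_mul_ofReal_sub_one_le (x := 2 * Real.pi * t)
  rw [Real.norm_eq_abs, abs_mul, abs_of_pos Real.two_pi_pos] at h
  refine le_trans (le_of_eq ?_) h
  rw [eC]
  congr 3
  push_cast
  ring

theorem integral_eC_mul_int (m : ℤ) : ∫ α in (0 : ℝ)..1, eC (α * m) = if m = 0 then 1 else 0 := by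
  split_ifs with h
  · simp [h, eC_zero]
  · have hc : (2 * Real.pi * Complex.I * m : ℂ) ≠ 0 := by
      simp [h, Real.pi_ne_zero]
    have h1 := integral_exp_mul_complex (a := 0) (b := 1) hc
    have h2 := eC_int m
    rw [eC] at h2
    simp only [Complex.ofReal_one, mul_one, Complex.ofReal_zero, mul_zero, Complex.exp_zero] at h1
    rw [Complex.ofReal_intCast] at h2
    rw [h2, sub_self, zero_div] at h1
    refine Eq.trans (intervalIntegral.integral_congr fun α _ => ?_) h1
    simp only [eC]
    congr 1
    push_cast
    ring

/-- The Fejér kernel of length `H` in the variable `Q * α`, normalised to take the value `1` at the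
fractions with denominator dividing `Q`. -/
def fejer (Q H : ℕ) (α : ℝ) : ℝ :=
  ‖∑ h ∈ Finset.range H, eC ((h : ℝ) * Q * α)‖ ^ 2 / (H : ℝ) ^ 2

theorem continuous_fejer (Q H : ℕ) : Continuous (fejer Q H) := by
  unfold fejer
  refine Continuous.div_const (Continuous.pow (Continuous.norm ?_) 2) _
  exact continuous_finsetSum _ fun h _ => continuous_eC.comp (by fun_prop)

theorem fejer_nonneg (Q H : ℕ) (α : ℝ) : 0 ≤ fejer Q H α := by
  unfold fejer
  positivity

theorem fejer_le_one (Q : ℕ) {H : ℕ} (hH : 1 ≤ H) (α : ℝ) : fejer Q H α ≤ 1 := by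
  have hH0 : (0 : ℝ) < H := by exact_mod_cast hH
  rw [fejer, div_le_one (by positivity)]
  refine pow_le_pow_left₀ (norm_nonneg _) ((norm_sum_le _ _).trans ?_) 2
  simp [norm_eC]

theorem one_sub_fejer_le {Q H q : ℕ} (hH : 1 ≤ H) (hq : 1 ≤ q) (hqQ : q ∣ Q) (a : ℤ) (β : ℝ) :
    1 - fejer Q H (a / q + β) ≤ 4 * Real.pi * (H * Q * |β|) := by
  have hH0 : (0 : ℝ) < H := by exact_mod_cast hH
  obtain ⟨k, rfl⟩ := hqQ
  have hq0 : (q : ℝ) ≠ 0 := by positivity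
  set z := ∑ h ∈ Finset.range H, eC ((h : ℝ) * (q * k : ℕ) * (a / q + β)) with hz
  have h1 : ‖z - H‖ ≤ H * (2 * Real.pi * (H * (q * k : ℕ) * |β|)) := by
    have h2 : z - H = ∑ h ∈ Finset.range H, (eC ((h : ℝ) * (q * k : ℕ) * β) - 1) := by
      rw [Finset.sum_sub_distrib, hz]
      congr 1
      · refine Finset.sum_congr rfl fun h _ => ?_
        rw [show (h : ℝ) * (q * k : ℕ) * (a / q + β) = ((h * k * a : ℤ) : ℝ) +
          (h : ℝ) * (q * k : ℕ) * β by push_cast; field_simp, eC_add, eC_int, one_mul]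
      · simp
    rw [h2]
    refine (norm_sum_le_of_le _ fun h hh => (norm_eC_sub_one_le _).trans ?_).trans_eq
      (by rw [Finset.sum_const, Finset.card_range, nsmul_eq_mul])
    have hhH : (h : ℝ) ≤ H := by exact_mod_cast (Finset.mem_range.1 hh).le
    rw [abs_mul, abs_mul, Nat.abs_cast, Nat.abs_cast]
    gcongr
  have h3 : (H : ℝ) - ‖z‖ ≤ ‖z - H‖ := by
    have := norm_sub_norm_le (H : ℂ) z
    rwa [norm_sub_rev, Complex.norm_natCast] at this
  have h4 : ‖z‖ ≤ H := (norm_sum_le _ _).trans (by simp [norm_eC])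
  rw [fejer, ← hz, one_sub_div (by positivity), div_le_iff₀ (by positivity)]
  calc (H : ℝ) ^ 2 - ‖z‖ ^ 2 = (H - ‖z‖) * (H + ‖z‖) := by ring
    _ ≤ (H * (2 * Real.pi * (H * (q * k : ℕ) * |β|))) * (H + H) :=
        mul_le_mul (h3.trans h1) (by linarith) (by positivity) (by positivity)
    _ = _ := by ring

/-- The Fourier coefficient of `fejer Q H` at `-m`. -/
def fejerCoeff (Q H : ℕ) (m : ℤ) : ℝ :=
  (∑ p ∈ Finset.range H ×ˢ Finset.range H, if m + ((p.1 : ℤ) - p.2) * Q = 0 then (1 : ℝ) else 0) /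
    (H : ℝ) ^ 2

theorem fejer_eq_sum (Q H : ℕ) (α : ℝ) : (fejer Q H α : ℂ) =
    (∑ p ∈ Finset.range H ×ˢ Finset.range H, eC (α * ((((p.1 : ℤ) - p.2) * Q : ℤ) : ℝ))) /
      (H : ℂ) ^ 2 := by
  rw [fejer, ← Complex.normSq_eq_norm_sq]
  push_cast
  rw [← Complex.mul_conj, map_sum, Finset.sum_mul_sum, Finset.sum_product]
  congr 1
  refine Finset.sum_congr rfl fun h _ => Finset.sum_congr rfl fun h' _ => ?_
  rw [← eC_sub]
  congr 1
  ring

theorem integral_eC_mul_one_sub_fejer (Q H : ℕ) (m : ℤ) :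
    ∫ α in (0 : ℝ)..1, eC (α * m) * ((1 - fejer Q H α : ℝ) : ℂ) =
      (((if m = 0 then 1 else 0) - fejerCoeff Q H m : ℝ) : ℂ) := by
  have hii : ∀ k : ℤ, IntervalIntegrable (fun α : ℝ => eC (α * k)) volume 0 1 := fun k =>
    (continuous_eC.comp (by fun_prop : Continuous fun α : ℝ => α * (k : ℝ))).intervalIntegrable _ _
  have h1 : ∀ α : ℝ, eC (α * m) * ((1 - fejer Q H α : ℝ) : ℂ) = eC (α * m) -
      (∑ p ∈ Finset.range H ×ˢ Finset.range H,
        eC (α * ((m + ((p.1 : ℤ) - p.2) * Q : ℤ) : ℝ))) / (H : ℂ) ^ 2 := fun α => by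
    rw [Complex.ofReal_sub, Complex.ofReal_one, mul_sub, mul_one, fejer_eq_sum, mul_div_assoc',
      Finset.mul_sum]
    congr 2
    refine Finset.sum_congr rfl fun p _ => ?_
    rw [← eC_add, ← mul_add]
    norm_cast
  simp only [h1]
  rw [intervalIntegral.integral_sub (hii m), intervalIntegral.integral_div,
    intervalIntegral.integral_finsetSum fun p _ => hii _, integral_eC_mul_int]
  · simp only [integral_eC_mul_int, fejerCoeff]
    push_cast
    simp only [apply_ite Complex.ofReal, Complex.ofReal_one, Complex.ofReal_zero]
  · refine IntervalIntegrable.div_const ?_ _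
    exact (continuous_finsetSum _ fun p _ =>
      continuous_eC.comp (by fun_prop)).intervalIntegrable _ _

theorem fejerCoeff_nonneg (Q H : ℕ) (m : ℤ) : 0 ≤ fejerCoeff Q H m := by
  refine div_nonneg (Finset.sum_nonneg fun p _ => ?_) (by positivity)
  split_ifs <;> norm_num

theorem le_fejerCoeff {Q H : ℕ} (hQ : 1 ≤ Q) (hH : 1 ≤ H) {m : ℤ} (hm : (Q : ℤ) ∣ m)
    (hm2 : 2 * |m| ≤ Q * H) : (2 * (H : ℝ))⁻¹ ≤ fejerCoeff Q H m := by
  have hH0 : (0 : ℝ) < H := by exact_mod_cast hH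
  obtain ⟨l, rfl⟩ := hm
  have hl : 2 * |l| ≤ H := by
    rw [abs_mul, Nat.abs_cast] at hm2
    exact le_of_mul_le_mul_left (by linarith) (show (0 : ℤ) < Q by exact_mod_cast hQ)
  have hcard : (H : ℝ) / 2 ≤ ∑ p ∈ Finset.range H ×ˢ Finset.range H,
      if (Q : ℤ) * l + ((p.1 : ℤ) - p.2) * Q = 0 then (1 : ℝ) else 0 := by
    rw [← Finset.sum_filter, Finset.sum_const, nsmul_eq_mul, mul_one]
    have h1 : (Finset.range (H - l.natAbs)).card ≤ ((Finset.range H ×ˢ Finset.range H).filter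
        fun p => (Q : ℤ) * l + ((p.1 : ℤ) - p.2) * Q = 0).card := by
      rcases le_total 0 l with h0 | h0
      · refine Finset.card_le_card_of_injOn (fun h => (h, h + l.natAbs)) (fun h hh => ?_)
          fun a _ b _ hab => (Prod.ext_iff.1 hab).1
        simp only [Finset.coe_range, Set.mem_Iio] at hh
        simp only [Finset.coe_filter, Finset.mem_product, Finset.mem_range, Set.mem_ofPred_eq]
        refine ⟨by omega, ?_⟩
        push_cast
        rw [abs_of_nonneg h0]
        ring
      · refine Finset.card_le_card_of_injOn (fun h => (h + l.natAbs, h)) (fun h hh => ?_)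
          fun a _ b _ hab => (Prod.ext_iff.1 hab).2
        simp only [Finset.coe_range, Set.mem_Iio] at hh
        simp only [Finset.coe_filter, Finset.mem_product, Finset.mem_range, Set.mem_ofPred_eq]
        refine ⟨by omega, ?_⟩
        push_cast
        rw [abs_of_nonpos h0]
        ring
    rw [Finset.card_range] at h1
    rw [Int.abs_eq_natAbs] at hl
    have h2 : H ≤ 2 * (H - l.natAbs) := by omega
    have h3 : (H : ℝ) ≤ 2 * ((H - l.natAbs : ℕ) : ℝ) := by exact_mod_cast h2
    have h4 : ((H - l.natAbs : ℕ) : ℝ) ≤ _ := Nat.cast_le.2 h1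
    linarith
  rw [fejerCoeff, le_div_iff₀ (by positivity)]
  refine le_trans (le_of_eq ?_) hcard
  field_simp

theorem continuous_gsum_eC {P : ℝ} (hP : 1 ≤ P) (f : (Fin n → ℤ) → ℤ) :
    Continuous fun α : ℝ => gsum P 0 fun x => eC (α * (f x : ℝ)) := by
  have hP0 : 0 < P := by linarith
  refine continuous_tsum (fun x => continuous_const.mul (continuous_eC.comp (by fun_prop)))
    (summable_gau (t := (P ^ 2)⁻¹) (by positivity) (0 : Fin n → ℝ)) fun x α => ?_
  rw [norm_mul, norm_eC, mul_one, Complex.norm_real, Real.norm_of_nonneg (gau_pos _ _).le]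

theorem integral_gsum_mul {P : ℝ} (hP : 1 ≤ P) (f : (Fin n → ℤ) → ℤ) {T : ℝ → ℂ}
    (hT : Continuous T) (hT1 : ∀ α, ‖T α‖ ≤ 1) :
    HasSum (fun x => (gau (P ^ 2)⁻¹ (toR x) : ℂ) * ∫ α in (0 : ℝ)..1, eC (α * (f x : ℝ)) * T α)
      (∫ α in (0 : ℝ)..1, (gsum P 0 fun x => eC (α * (f x : ℝ))) * T α) := by
  have hP0 : 0 < P := by linarith
  have hsum := summable_gau (t := (P ^ 2)⁻¹) (by positivity) (0 : Fin n → ℝ)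
  simp only [sub_zero] at hsum
  have h1 := intervalIntegral.hasSum_intervalIntegral_of_summable_norm (a := 0) (b := 1)
    (f := fun x : Fin n → ℤ => (⟨fun α : ℝ => (gau (P ^ 2)⁻¹ (toR x) : ℂ) *
      (eC (α * (f x : ℝ)) * T α), continuous_const.mul ((continuous_eC.comp (by fun_prop)).mul hT)⟩ :
        C(ℝ, ℂ))) (Summable.of_nonneg_of_le (fun _ => norm_nonneg _) (fun x => by
      rw [ContinuousMap.norm_le _ (gau_pos (P ^ 2)⁻¹ (toR x)).le]
      rintro ⟨α, hα⟩
      simp only [ContinuousMap.restrict_apply, ContinuousMap.coe_mk]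
      rw [norm_mul, norm_mul, norm_eC, one_mul, Complex.norm_real,
        Real.norm_of_nonneg (gau_pos _ _).le]
      exact mul_le_of_le_one_right (gau_pos _ _).le (hT1 α)) hsum)
  simp only [ContinuousMap.coe_mk, intervalIntegral.integral_const_mul] at h1
  have h2 : ∀ α, (gsum P 0 fun x => eC (α * (f x : ℝ))) * T α =
      ∑' x, (gau (P ^ 2)⁻¹ (toR x) : ℂ) * (eC (α * (f x : ℝ)) * T α) := fun α => by
    simp only [gsum, sub_zero]
    rw [← tsum_mul_right]
    exact tsum_congr fun x => mul_assoc _ _ _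
  simp only [h2]
  exact h1

theorem le_tsum_zero {P : ℝ} (hP : 1 ≤ P) {Q H : ℕ} (hQ : 1 ≤ Q) (hH : 1 ≤ H)
    (f : (Fin n → ℤ) → ℤ) {s : Finset (Fin n → ℤ)}
    (hs : ∀ x ∈ s, (Q : ℤ) ∣ f x ∧ 2 * |f x| ≤ Q * H) :
    (2 * (H : ℝ))⁻¹ * ∑ x ∈ s, gau (P ^ 2)⁻¹ (toR x) -
        ∫ α in (0 : ℝ)..1, ‖gsum P 0 fun x => eC (α * (f x : ℝ))‖ * (1 - fejer Q H α) ≤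
      ∑' x, if f x = 0 then gau (P ^ 2)⁻¹ (toR x) else 0 := by
  have hP0 : 0 < P := by linarith
  have hsum := summable_gau (t := (P ^ 2)⁻¹) (by positivity) (0 : Fin n → ℝ)
  simp only [sub_zero] at hsum
  have hK : ∀ α, ‖((1 - fejer Q H α : ℝ) : ℂ)‖ = 1 - fejer Q H α := fun α => by
    rw [Complex.norm_real, Real.norm_of_nonneg (by linarith [fejer_le_one Q hH α])]
  have h1 := integral_gsum_mul hP f (T := fun α => ((1 - fejer Q H α : ℝ) : ℂ))
    (Complex.continuous_ofReal.comp (continuous_const.sub (continuous_fejer Q H)))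
    fun α => by rw [hK]; linarith [fejer_nonneg Q H α]
  simp only [integral_eC_mul_one_sub_fejer] at h1
  set I := ∫ α in (0 : ℝ)..1, (gsum P 0 fun x => eC (α * (f x : ℝ))) * ((1 - fejer Q H α : ℝ) : ℂ)
  have h2 := Complex.hasSum_re h1
  simp only [← Complex.ofReal_mul, Complex.ofReal_re, mul_sub] at h2
  have h3 : Summable fun x : Fin n → ℤ => gau (P ^ 2)⁻¹ (toR x) * if f x = 0 then 1 else 0 :=
    Summable.of_nonneg_of_le (fun x => mul_nonneg (gau_pos _ _).le (by split_ifs <;> norm_num))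
      (fun x => mul_le_of_le_one_right (gau_pos _ _).le (by split_ifs <;> norm_num)) hsum
  have h4 := h3.hasSum.sub h2
  simp only [sub_sub_cancel] at h4
  have h5 := sum_le_hasSum s (fun x _ => mul_nonneg (gau_pos _ _).le (fejerCoeff_nonneg Q H _)) h4
  have h6 : (2 * (H : ℝ))⁻¹ * ∑ x ∈ s, gau (P ^ 2)⁻¹ (toR x) ≤
      ∑ x ∈ s, gau (P ^ 2)⁻¹ (toR x) * fejerCoeff Q H (f x) := by
    rw [mul_comm, Finset.sum_mul]
    exact Finset.sum_le_sum fun x hx => mul_le_mul_of_nonneg_left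
      (le_fejerCoeff hQ hH (hs x hx).1 (hs x hx).2) (gau_pos _ _).le
  have h7 : -I.re ≤ ∫ α in (0 : ℝ)..1,
      ‖gsum P 0 fun x => eC (α * (f x : ℝ))‖ * (1 - fejer Q H α) := by
    refine (neg_le_abs _).trans ((Complex.abs_re_le_norm _).trans
      ((intervalIntegral.norm_integral_le_integral_norm zero_le_one).trans_eq ?_))
    exact intervalIntegral.integral_congr fun α _ => by simp only [norm_mul, hK]
  simp only [mul_ite, mul_one, mul_zero] at h5
  linarith

end Fejer

section MainTerm

variable {n : ℕ}

theorem exists_finset_main {F : MvPolynomial (Fin n) ℤ} {d : ℕ} (hF : F.IsHomogeneous d)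
    (hd : 1 ≤ d) {ξ : Fin n → ℝ} {i : Fin n} (hξ : aeval ξ F = 0) (hi : aeval ξ (pderiv i F) ≠ 0)
    {κ : ℝ} (hκ : 0 < κ) (hz : ∀ Q : ℕ, 1 ≤ Q → κ * (Q : ℝ) ^ n ≤ zcount F Q * Q) :
    ∃ c C₁ : ℝ, 0 < c ∧ 1 ≤ C₁ ∧ ∀ (C₀ : ℝ) (Q : ℕ), C₁ ≤ C₀ → 1 ≤ Q →
      ∃ P₀ : ℝ, 1 ≤ P₀ ∧ ∀ P, P₀ ≤ P → ∃ (H : ℕ) (s : Finset (Fin n → ℤ)), 1 ≤ H ∧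
        H * Q * C₀ ≤ P ^ d ∧ (∀ x ∈ s, (Q : ℤ) ∣ eval x F ∧ 2 * |eval x F| ≤ Q * H) ∧
        c * (P ^ n / P ^ d) ≤ (2 * (H : ℝ))⁻¹ * ∑ x ∈ s, gau (P ^ 2)⁻¹ (toR x) := by
  obtain ⟨c, B, η₀, hc, hB, hη₀, hbox⟩ := exists_finset_near_zero hF hξ hi
  set E := Real.exp (-(Real.pi * n * B ^ 2)) with hE
  have hE0 : 0 < E := Real.exp_pos _
  refine ⟨E * c * κ / 8, max 1 (4 * η₀)⁻¹, by positivity, le_max_left _ _, fun C₀ Q hC₀ hQ => ?_⟩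
  have hQ0 : (0 : ℝ) < Q := by exact_mod_cast hQ
  have hQ1 : (1 : ℝ) ≤ Q := by exact_mod_cast hQ
  have hC1 : 1 ≤ C₀ := (le_max_left _ _).trans hC₀
  have hC0 : 0 < C₀ := one_pos.trans_le hC1
  have hη : (4 * C₀)⁻¹ ≤ η₀ := by
    have h1 := (le_max_right _ _).trans hC₀
    rw [inv_le_comm₀ (by positivity) (by positivity)] at h1 ⊢
    calc η₀⁻¹ = 4 * (4 * η₀)⁻¹ := by field_simp
      _ ≤ 4 * C₀ := by
        rw [inv_le_comm₀ hC0 (by positivity)] at h1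
        exact mul_le_mul_of_nonneg_left h1 (by norm_num)
  obtain ⟨P₀, hP₀, hbox⟩ := hbox (4 * C₀)⁻¹ Q (by positivity) hη hQ
  refine ⟨max P₀ (C₀ * Q), hP₀.trans (le_max_left _ _), fun P hP => ?_⟩
  have hP1 : 1 ≤ P := (hP₀.trans (le_max_left _ _)).trans hP
  have hP0 : 0 < P := one_pos.trans_le hP1
  choose s hs hscard using hbox P ((le_max_left _ _).trans hP)
  have hPd : 1 ≤ P ^ d / (C₀ * Q) := by
    rw [one_le_div (by positivity)]
    exact ((le_max_right _ _).trans hP).trans (le_self_pow₀ hP1 (by omega))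
  set H := ⌊P ^ d / (C₀ * Q)⌋₊ with hH
  have hH1 : 1 ≤ H := (Nat.one_le_floor_iff _).2 hPd
  have hH0 : (0 : ℝ) < H := by exact_mod_cast hH1
  have hHle : H * (C₀ * Q) ≤ P ^ d :=
    (le_div_iff₀ (by positivity)).1 (Nat.floor_le (by positivity))
  have hHge : P ^ d ≤ 2 * (H * (C₀ * Q)) := by
    have h1 : P ^ d / (C₀ * Q) < H + 1 := Nat.lt_floor_add_one _
    have h2 : (1 : ℝ) ≤ H := by exact_mod_cast hH1
    have h3 : P ^ d / (C₀ * Q) ≤ 2 * H := by linarith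
    rw [div_le_iff₀ (by positivity)] at h3
    linarith
  have : NeZero Q := ⟨by omega⟩
  set Z : Finset (Fin n → ZMod Q) := Finset.univ.filter fun r => aeval r F = 0
  have hZ : Z.card = zcount F Q := by
    rw [zcount, Nat.card_eq_fintype_card, Fintype.card_subtype]
  set lift : (Fin n → ZMod Q) → Fin n → ℤ := fun r j => ((r j).val : ℤ)
  have hlift : ∀ r, ∀ x ∈ s (lift r), (fun j => (x j : ZMod Q)) = r := fun r x hx => by
    ext j
    have h1 := (hs _ x hx).1 j
    rw [← ZMod.intCast_zmod_eq_zero_iff_dvd, Int.cast_sub, sub_eq_zero] at h1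
    rw [h1]
    simp [lift]
  have hdisj : (Z : Set (Fin n → ZMod Q)).PairwiseDisjoint fun r => s (lift r) :=
    fun r _ r' _ hrr => Finset.disjoint_left.2 fun x hx hx' =>
      hrr ((hlift r x hx).symm.trans (hlift r' x hx'))
  refine ⟨H, Z.biUnion fun r => s (lift r), hH1, by linarith, fun x hx => ?_, ?_⟩
  · obtain ⟨r, hr, hx⟩ := Finset.mem_biUnion.1 hx
    refine ⟨?_, ?_⟩
    · rw [← ZMod.intCast_zmod_eq_zero_iff_dvd, ← aeval_zmod, hlift r x hx]
      exact (Finset.mem_filter.1 hr).2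
    · have h1 := (hs _ x hx).2.2
      have h2 : 2 * |((eval x F : ℤ) : ℝ)| ≤ Q * H := by
        calc 2 * |((eval x F : ℤ) : ℝ)| ≤ 2 * ((4 * C₀)⁻¹ * (2 * (H * (C₀ * Q)))) :=
              mul_le_mul_of_nonneg_left (h1.trans (mul_le_mul_of_nonneg_left hHge
                (by positivity))) (by norm_num)
          _ = Q * H := by field_simp; norm_num
      exact_mod_cast h2
  · have hcard : (zcount F Q : ℝ) * (c * (4 * C₀)⁻¹ * (P / Q) ^ n) ≤
        (Z.biUnion fun r => s (lift r)).card := by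
      rw [Finset.card_biUnion fun r hr r' hr' h => hdisj hr hr' h, ← hZ, ← nsmul_eq_mul]
      push_cast
      exact Finset.card_nsmul_le_sum _ _ _ fun r _ => hscard _
    have hsum : ((Z.biUnion fun r => s (lift r)).card : ℝ) * E ≤
        ∑ x ∈ Z.biUnion fun r => s (lift r), gau (P ^ 2)⁻¹ (toR x) := by
      rw [← nsmul_eq_mul]
      refine Finset.card_nsmul_le_sum _ _ _ fun x hx => ?_
      obtain ⟨r, -, hx⟩ := Finset.mem_biUnion.1 hx
      exact exp_le_gau hP0 (hs _ x hx).2.1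
    have hHinv : C₀ * Q / (2 * P ^ d) ≤ (2 * (H : ℝ))⁻¹ := by
      rw [inv_eq_one_div, div_le_div_iff₀ (by positivity) (by positivity)]
      linarith
    have hzQ := hz Q hQ
    rw [← le_div_iff₀ (by positivity)] at hzQ
    calc E * c * κ / 8 * (P ^ n / P ^ d)
        ≤ E * c * (zcount F Q * Q / (Q : ℝ) ^ n) / 8 * (P ^ n / P ^ d) := by gcongr
      _ = C₀ * Q / (2 * P ^ d) * ((zcount F Q : ℝ) * (c * (4 * C₀)⁻¹ * (P / Q) ^ n) * E) := by
          rw [div_pow]; field_simp; ring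
      _ ≤ (2 * (H : ℝ))⁻¹ * ((Z.biUnion fun r => s (lift r)).card * E) := by gcongr
      _ ≤ _ := by gcongr

end MainTerm

section ErrorTerm

variable {n : ℕ}

/-- The majorant on the arc around a fraction, in the variable scaled by `P ^ d`. -/
def arcWeight (y : ℝ) : ℝ := (1 + |y|) ^ (-(3 / 2) : ℝ)

theorem arcWeight_nonneg (y : ℝ) : 0 ≤ arcWeight y := Real.rpow_nonneg (by positivity) _

theorem continuous_arcWeight : Continuous arcWeight :=
  Continuous.rpow_const (by fun_prop) fun y => Or.inl (by positivity)

theorem integrable_arcWeight : Integrable arcWeight := by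
  have := integrable_one_add_norm (E := ℝ) (μ := volume) (r := 3 / 2) (by norm_num)
  exact this

theorem integral_arcWeight_le {A : ℝ} (hA : 0 < A) (u : ℝ) :
    ∫ α in (0 : ℝ)..1, arcWeight ((α - u) * A) ≤ (∫ y, arcWeight y) / A := by
  have h1 := intervalIntegral.integral_comp_mul_sub (a := 0) (b := 1) arcWeight hA.ne' (A * u)
  have h2 : ∀ α, (α - u) * A = A * α - A * u := fun α => by ring
  simp only [h2]
  rw [h1, smul_eq_mul, inv_mul_eq_div]
  refine div_le_div_of_nonneg_right ?_ hA.le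
  rw [intervalIntegral.integral_of_le (by linarith)]
  exact setIntegral_le_integral integrable_arcWeight (ae_of_all _ arcWeight_nonneg)

theorem inv_sq_mul_le_arcWeight {e y k : ℝ} (hk : k ≤ e * (1 + |y|) ^ (1 / 2 : ℝ)) :
    ((1 + |y|) ^ 2)⁻¹ * k ≤ e * arcWeight y := by
  have h0 : 0 < 1 + |y| := by positivity
  calc ((1 + |y|) ^ 2)⁻¹ * k ≤ ((1 + |y|) ^ 2)⁻¹ * (e * (1 + |y|) ^ (1 / 2 : ℝ)) :=
        mul_le_mul_of_nonneg_left hk (by positivity)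
    _ = e * ((1 + |y|) ^ (-2 : ℝ) * (1 + |y|) ^ (1 / 2 : ℝ)) := by
        rw [Real.rpow_neg h0.le, Real.rpow_two]; ring
    _ = _ := by rw [← Real.rpow_add h0, arcWeight]; norm_num

theorem one_sub_fejer_le_sqrt {Q H q : ℕ} (hH : 1 ≤ H) (hq : 1 ≤ q) (hqQ : q ∣ Q) (a : ℤ) (β : ℝ)
    {A C₀ : ℝ} (hC₀ : 0 < C₀) (hA : H * Q * C₀ ≤ A) :
    1 - fejer Q H (a / q + β) ≤ (4 * Real.pi / C₀) ^ (1 / 2 : ℝ) * (1 + |β * A|) ^ (1 / 2 : ℝ) := by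
  have hA0 : 0 ≤ A := le_trans (by positivity) hA
  rw [← Real.mul_rpow (by positivity) (by positivity), ← Real.sqrt_eq_rpow]
  have h0 : 0 ≤ 1 - fejer Q H (a / q + β) := by linarith [fejer_le_one Q hH (a / q + β)]
  refine Real.le_sqrt_of_sq_le ?_
  calc (1 - fejer Q H (a / q + β)) ^ 2 ≤ 1 - fejer Q H (a / q + β) :=
        pow_le_of_le_one h0 (by linarith [fejer_nonneg Q H (a / q + β)]) two_ne_zero
    _ ≤ 4 * Real.pi * (H * Q * |β|) := one_sub_fejer_le hH hq hqQ a β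
    _ = 4 * Real.pi / C₀ * (H * Q * C₀ * |β|) := by field_simp
    _ ≤ 4 * Real.pi / C₀ * (1 + |β * A|) := by
        rw [abs_mul, abs_of_nonneg hA0]
        have := mul_le_mul_of_nonneg_right hA (abs_nonneg β)
        exact mul_le_mul_of_nonneg_left (by linarith) (by positivity)

theorem exists_approx {P D α : ℝ} (hP : 1 ≤ P) (hD : 0 < D) (hα : α ∈ Set.Icc (0 : ℝ) 1) :
    ∃ q ∈ Finset.Icc 1 ⌊P ^ D⌋₊, ∃ a ∈ Finset.range (q + 1), IsCoprime (a : ℤ) q ∧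
      q * |α - (a : ℝ) / q| ≤ P ^ (-D) := by
  have hPD : 1 ≤ P ^ D := Real.one_le_rpow hP hD.le
  have hN : 1 ≤ ⌊P ^ D⌋₊ := (Nat.one_le_floor_iff _).2 hPD
  obtain ⟨r, hr, hrN⟩ := Real.exists_rat_abs_sub_le_and_den_le α hN
  have hq0 : (0 : ℝ) < r.den := by exact_mod_cast r.den_pos
  have hN0 : (1 : ℝ) ≤ ⌊P ^ D⌋₊ := by exact_mod_cast hN
  have hrc : (r : ℝ) = (r.num : ℝ) / r.den := Rat.cast_def r
  have h1 : r.den * |α - (r.num : ℝ) / r.den| ≤ 1 / (⌊P ^ D⌋₊ + 1) := by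
    rw [← hrc]
    calc (r.den : ℝ) * |α - r| ≤ r.den * (1 / ((⌊P ^ D⌋₊ + 1) * r.den)) :=
          mul_le_mul_of_nonneg_left hr hq0.le
      _ = _ := by field_simp
  have h2 : |r.den * α - r.num| < 1 := by
    calc |r.den * α - r.num| = r.den * |α - (r.num : ℝ) / r.den| := by
          rw [← abs_of_pos hq0, ← abs_mul, abs_of_pos hq0]
          congr 1
          field_simp
      _ ≤ _ := h1
      _ < 1 := by rw [div_lt_one (by positivity)]; linarith
  rw [abs_lt] at h2
  have h3 : -1 < r.num := by
    have : (-1 : ℝ) < r.num := by nlinarith [hα.1, mul_nonneg hq0.le hα.1]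
    exact_mod_cast this
  have h4 : r.num < r.den + 1 := by
    have : (r.num : ℝ) < r.den + 1 := by nlinarith [hα.2, mul_le_mul_of_nonneg_left hα.2 hq0.le]
    exact_mod_cast this
  have h5 : ((r.num.toNat : ℕ) : ℤ) = r.num := Int.toNat_of_nonneg (by omega)
  have h6 : ((r.num.toNat : ℕ) : ℝ) = r.num := by exact_mod_cast congrArg (Int.cast (R := ℝ)) h5
  refine ⟨r.den, Finset.mem_Icc.2 ⟨r.den_pos, hrN⟩, r.num.toNat,
    Finset.mem_range.2 (by omega), ?_, ?_⟩
  · rw [h5, Int.isCoprime_iff_nat_coprime]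
    exact r.reduced
  · rw [h6]
    refine h1.trans ?_
    rw [Real.rpow_neg (by linarith), ← one_div]
    exact one_div_le_one_div_of_le (by linarith) (Nat.lt_floor_add_one _).le

theorem integral_error_le {F : MvPolynomial (Fin n) ℤ} {d : ℕ} {D δ C : ℝ} (hD : 0 < D)
    (hC : 0 < C) (hB : GsumBound F d D δ C) {P C₀ : ℝ} {Q H T : ℕ}
    (hP : 1 ≤ P) (hC₀ : 0 < C₀) (hH : 1 ≤ H) (hHQ : H * Q * C₀ ≤ P ^ d)
    (hT : ∀ q, 1 ≤ q → q ≤ T → q ∣ Q) :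
    ∫ α in (0 : ℝ)..1, ‖gsum P 0 fun x => eC (α * ((eval x F : ℤ) : ℝ))‖ * (1 - fejer Q H α) ≤
      C * P ^ n * (P ^ (-((d : ℝ) + δ)) + 2 * (∫ y, arcWeight y) / P ^ d *
        ∑ q ∈ Finset.Icc 1 ⌊P ^ D⌋₊,
          (q : ℝ) ^ (-(1 + δ)) * if q ≤ T then (4 * Real.pi / C₀) ^ (1 / 2 : ℝ) else 1) := by
  have hP0 : 0 < P := by linarith
  set e : ℕ → ℝ := fun q => if q ≤ T then (4 * Real.pi / C₀) ^ (1 / 2 : ℝ) else 1 with he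
  have he0 : ∀ q, 0 ≤ e q := fun q => by
    simp only [he]
    split_ifs
    · positivity
    · exact zero_le_one
  set J := ∫ y, arcWeight y
  have hJ : 0 ≤ J := integral_nonneg arcWeight_nonneg
  set G : ℝ → ℝ := fun α => C * P ^ n * (P ^ (-((d : ℝ) + δ)) + ∑ q ∈ Finset.Icc 1 ⌊P ^ D⌋₊,
    ∑ a ∈ Finset.range (q + 1),
      (q : ℝ) ^ (-(2 + δ)) * e q * arcWeight ((α - (a : ℝ) / q) * P ^ d)) with hG
  have hterm : ∀ (α : ℝ) (q a : ℕ),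
      0 ≤ (q : ℝ) ^ (-(2 + δ)) * e q * arcWeight ((α - (a : ℝ) / q) * P ^ d) := fun α q a =>
    mul_nonneg (mul_nonneg (Real.rpow_nonneg (Nat.cast_nonneg q) _) (he0 q)) (arcWeight_nonneg _)
  have hcw : ∀ (q a : ℕ), Continuous fun α : ℝ =>
      (q : ℝ) ^ (-(2 + δ)) * e q * arcWeight ((α - (a : ℝ) / q) * P ^ d) := fun q a =>
    continuous_const.mul (continuous_arcWeight.comp (by fun_prop))
  have hcs : ∀ q : ℕ, Continuous fun α : ℝ => ∑ a ∈ Finset.range (q + 1),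
      (q : ℝ) ^ (-(2 + δ)) * e q * arcWeight ((α - (a : ℝ) / q) * P ^ d) := fun q =>
    continuous_finsetSum _ fun a _ => hcw q a
  have hcss : Continuous fun α : ℝ => ∑ q ∈ Finset.Icc 1 ⌊P ^ D⌋₊, ∑ a ∈ Finset.range (q + 1),
      (q : ℝ) ^ (-(2 + δ)) * e q * arcWeight ((α - (a : ℝ) / q) * P ^ d) :=
    continuous_finsetSum _ fun q _ => hcs q
  have hGc : Continuous G := continuous_const.mul (continuous_const.add hcss)
  have hle : ∀ α ∈ Set.Icc (0 : ℝ) 1,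
      ‖gsum P 0 fun x => eC (α * ((eval x F : ℤ) : ℝ))‖ * (1 - fejer Q H α) ≤ G α := by
    intro α hα
    obtain ⟨q, hq, a, ha, hcop, hβ⟩ := exists_approx hP hD hα
    have hq1 := (Finset.mem_Icc.1 hq).1
    have hq0 : (0 : ℝ) < q := by exact_mod_cast hq1
    set β := α - (a : ℝ) / q with hβdef
    have hαβ : α = ((a : ℤ) : ℝ) / q + β := by rw [hβdef]; push_cast; ring
    have hqP : (q : ℝ) ≤ P ^ D :=
      (Nat.cast_le.2 (Finset.mem_Icc.1 hq).2).trans (Nat.floor_le (by positivity))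
    have h1 := hB P q a β hP hq1 hcop hqP hβ
    rw [← hαβ] at h1
    have hk0 : 0 ≤ 1 - fejer Q H α := by linarith [fejer_le_one Q hH α]
    have hk1 : 1 - fejer Q H α ≤ 1 := by linarith [fejer_nonneg Q H α]
    have hk : 1 - fejer Q H α ≤ e q * (1 + |β * P ^ d|) ^ (1 / 2 : ℝ) := by
      simp only [he]
      split_ifs with hqT
      · have := one_sub_fejer_le_sqrt (Q := Q) hH hq1 (hT q hq1 hqT) a β hC₀ hHQ
        rwa [← hαβ] at this
      · rw [one_mul]
        exact hk1.trans (Real.one_le_rpow (by linarith [abs_nonneg (β * P ^ d)]) (by norm_num))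
    have h2 := inv_sq_mul_le_arcWeight hk
    rw [abs_mul, abs_of_pos (pow_pos hP0 d)] at h2
    have h3 : (q : ℝ) ^ (-(2 + δ)) * e q * arcWeight (β * P ^ d) ≤
        ∑ q ∈ Finset.Icc 1 ⌊P ^ D⌋₊, ∑ a ∈ Finset.range (q + 1),
          (q : ℝ) ^ (-(2 + δ)) * e q * arcWeight ((α - (a : ℝ) / q) * P ^ d) :=
      (Finset.single_le_sum (f := fun a : ℕ =>
        (q : ℝ) ^ (-(2 + δ)) * e q * arcWeight ((α - (a : ℝ) / q) * P ^ d))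
          (fun a _ => hterm α q a) ha).trans
        (Finset.single_le_sum (f := fun q : ℕ => ∑ a ∈ Finset.range (q + 1),
          (q : ℝ) ^ (-(2 + δ)) * e q * arcWeight ((α - (a : ℝ) / q) * P ^ d))
            (fun q _ => Finset.sum_nonneg fun a _ => hterm α q a) hq)
    have hqr : 0 ≤ (q : ℝ) ^ (-(2 + δ)) := Real.rpow_nonneg hq0.le _
    have hPr : 0 ≤ P ^ (-((d : ℝ) + δ)) := Real.rpow_nonneg hP0.le _
    calc _ ≤ C * P ^ n * (P ^ (-((d : ℝ) + δ)) + (q : ℝ) ^ (-(2 + δ)) *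
          ((1 + |β| * P ^ d) ^ 2)⁻¹) * (1 - fejer Q H α) := mul_le_mul_of_nonneg_right h1 hk0
      _ = C * P ^ n * (P ^ (-((d : ℝ) + δ)) * (1 - fejer Q H α) + (q : ℝ) ^ (-(2 + δ)) *
          (((1 + |β| * P ^ d) ^ 2)⁻¹ * (1 - fejer Q H α))) := by ring
      _ ≤ C * P ^ n * (P ^ (-((d : ℝ) + δ)) + (q : ℝ) ^ (-(2 + δ)) *
          (e q * arcWeight (β * P ^ d))) := by
        refine mul_le_mul_of_nonneg_left (add_le_add (mul_le_of_le_one_right hPr hk1)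
          (mul_le_mul_of_nonneg_left h2 hqr)) (by positivity)
      _ ≤ G α := by
        refine mul_le_mul_of_nonneg_left (add_le_add le_rfl ?_) (by positivity)
        rw [← mul_assoc]
        exact h3
  have hSc := (continuous_gsum_eC hP fun x => eval x F).norm.mul
    (continuous_const (y := (1 : ℝ)).sub (continuous_fejer Q H))
  refine (intervalIntegral.integral_mono_on zero_le_one (hSc.intervalIntegrable _ _)
    (hGc.intervalIntegrable _ _) hle).trans ?_
  simp only [hG]
  rw [intervalIntegral.integral_const_mul,
    intervalIntegral.integral_add (by simp) (hcss.intervalIntegrable _ _),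
    intervalIntegral.integral_const, sub_zero, one_smul,
    intervalIntegral.integral_finsetSum fun q _ => (hcs q).intervalIntegrable _ _]
  refine mul_le_mul_of_nonneg_left (add_le_add le_rfl ?_) (by positivity)
  rw [Finset.mul_sum]
  refine Finset.sum_le_sum fun q hq => ?_
  have hq1 : (1 : ℝ) ≤ q := by exact_mod_cast (Finset.mem_Icc.1 hq).1
  have hq0 : (0 : ℝ) < q := by linarith
  have hqr : 0 ≤ (q : ℝ) ^ (-(2 + δ)) := Real.rpow_nonneg hq0.le _
  rw [intervalIntegral.integral_finsetSum fun a _ => (hcw q a).intervalIntegrable _ _]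
  calc _ ≤ ∑ _a ∈ Finset.range (q + 1), (q : ℝ) ^ (-(2 + δ)) * e q * (J / P ^ d) :=
        Finset.sum_le_sum fun a _ => by
          rw [intervalIntegral.integral_const_mul]
          exact mul_le_mul_of_nonneg_left (integral_arcWeight_le (by positivity) _)
            (mul_nonneg hqr (he0 q))
    _ = ((q : ℝ) + 1) * ((q : ℝ) ^ (-(2 + δ)) * e q * (J / P ^ d)) := by
        rw [Finset.sum_const, Finset.card_range, nsmul_eq_mul]; push_cast; ring
    _ ≤ (2 * q) * ((q : ℝ) ^ (-(2 + δ)) * e q * (J / P ^ d)) :=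
        mul_le_mul_of_nonneg_right (by linarith)
          (mul_nonneg (mul_nonneg hqr (he0 q)) (by positivity))
    _ = 2 * J / P ^ d * ((q : ℝ) ^ (-(1 + δ)) * e q) := by
        rw [show -(1 + δ) = 1 + -(2 + δ) by ring, Real.rpow_add hq0, Real.rpow_one]
        ring

end ErrorTerm

section Conclusion

variable {n : ℕ}

theorem exists_le_tsum_zero {F : MvPolynomial (Fin n) ℤ} {d : ℕ} {D δ C : ℝ}
    (hF : F.IsHomogeneous d) (hd : 1 ≤ d) (hD : 0 < D) (hδ : 0 < δ) (hC : 0 < C)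
    (hB : GsumBound F d D δ C) {ξ : Fin n → ℝ} {i : Fin n} (hξ : aeval ξ F = 0)
    (hi : aeval ξ (pderiv i F) ≠ 0) {κ : ℝ} (hκ : 0 < κ)
    (hz : ∀ Q : ℕ, 1 ≤ Q → κ * (Q : ℝ) ^ n ≤ zcount F Q * Q) :
    ∃ c P₀ : ℝ, 0 < c ∧ 1 ≤ P₀ ∧ ∀ P, P₀ ≤ P → c * (P ^ n / P ^ d) ≤
      ∑' x : Fin n → ℤ, if eval x F = 0 then gau (P ^ 2)⁻¹ (toR x) else 0 := by
  obtain ⟨c, C₁, hc, hC₁, hmain⟩ := exists_finset_main hF hd hξ hi hκ hz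
  set J := ∫ y, arcWeight y with hJdef
  have hJ : 0 ≤ J := integral_nonneg arcWeight_nonneg
  have hsum : Summable fun q : ℕ => (q : ℝ) ^ (-(1 + δ)) :=
    Real.summable_nat_rpow.2 (by linarith)
  have hnn : ∀ q : ℕ, 0 ≤ (q : ℝ) ^ (-(1 + δ)) := fun q => Real.rpow_nonneg (Nat.cast_nonneg q) _
  set Z := ∑' q : ℕ, (q : ℝ) ^ (-(1 + δ))
  have hZ : 0 ≤ Z := tsum_nonneg hnn
  set τ := c / (8 * C * (J + 1)) with hτ
  have hτ0 : 0 < τ := by positivity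
  obtain ⟨T, hT⟩ := exists_sum_rpow_lt hδ hτ0
  set ε := τ / (Z + 1) with hε
  have hε0 : 0 < ε := by positivity
  set C₀ := max C₁ (4 * Real.pi / ε ^ 2)
  have hC0 : 0 < C₀ := one_pos.trans_le (hC₁.trans (le_max_left _ _))
  have hεC : (4 * Real.pi / C₀) ^ (1 / 2 : ℝ) ≤ ε := by
    rw [← Real.sqrt_eq_rpow]
    refine Real.sqrt_le_iff.2 ⟨hε0.le, ?_⟩
    rw [div_le_iff₀ hC0, ← div_le_iff₀' (by positivity)]
    exact le_max_right C₁ (4 * Real.pi / ε ^ 2)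
  have hQ : 1 ≤ T.factorial := T.factorial_pos
  obtain ⟨P₁, hP₁, hmain⟩ := hmain C₀ T.factorial (le_max_left _ _) hQ
  have hev : ∀ᶠ P : ℝ in Filter.atTop, C * P ^ (-δ) < c / 4 := by
    have h1 := (tendsto_rpow_neg_atTop hδ).const_mul C
    rw [mul_zero] at h1
    exact h1.eventually (gt_mem_nhds (by positivity))
  obtain ⟨P₂, hP₂⟩ := Filter.eventually_atTop.1 hev
  refine ⟨c / 4, max P₁ P₂, by positivity, hP₁.trans (le_max_left _ _), fun P hP => ?_⟩
  have hP1 : 1 ≤ P := (hP₁.trans (le_max_left _ _)).trans hP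
  have hP0 : 0 < P := one_pos.trans_le hP1
  obtain ⟨H, s, hH, hHQ, hs, hlow⟩ := hmain P ((le_max_left _ _).trans hP)
  have h1 := le_tsum_zero hP1 hQ hH (fun x => eval x F) hs
  have h2 := integral_error_le hD hC hB hP1 hC0 hH hHQ
    fun q hq hqT => Nat.dvd_factorial hq hqT
  have h3 : ∑ q ∈ Finset.Icc 1 ⌊P ^ D⌋₊, (q : ℝ) ^ (-(1 + δ)) *
      (if q ≤ T then (4 * Real.pi / C₀) ^ (1 / 2 : ℝ) else 1) ≤ 2 * τ := by
    rw [← Finset.sum_filter_add_sum_filter_not (Finset.Icc 1 ⌊P ^ D⌋₊) (fun q : ℕ => q ≤ T)]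
    have h4 : ∑ q ∈ (Finset.Icc 1 ⌊P ^ D⌋₊).filter (fun q => q ≤ T), (q : ℝ) ^ (-(1 + δ)) *
        (if q ≤ T then (4 * Real.pi / C₀) ^ (1 / 2 : ℝ) else 1) ≤ τ := by
      calc _ ≤ ∑ q ∈ (Finset.Icc 1 ⌊P ^ D⌋₊).filter (fun q => q ≤ T),
            (q : ℝ) ^ (-(1 + δ)) * ε := Finset.sum_le_sum fun q hq => by
              rw [if_pos (Finset.mem_filter.1 hq).2]
              exact mul_le_mul_of_nonneg_left hεC (hnn q)
        _ = (∑ q ∈ (Finset.Icc 1 ⌊P ^ D⌋₊).filter (fun q => q ≤ T),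
            (q : ℝ) ^ (-(1 + δ))) * ε := by rw [Finset.sum_mul]
        _ ≤ Z * ε := mul_le_mul_of_nonneg_right
            (hsum.sum_le_tsum _ fun q _ => hnn q) hε0.le
        _ ≤ τ := by
            rw [hε, mul_div_assoc', div_le_iff₀ (by positivity)]
            nlinarith
    have h5 : ∑ q ∈ (Finset.Icc 1 ⌊P ^ D⌋₊).filter (fun q => ¬q ≤ T), (q : ℝ) ^ (-(1 + δ)) *
        (if q ≤ T then (4 * Real.pi / C₀) ^ (1 / 2 : ℝ) else 1) ≤ τ := by
      refine le_of_eq_of_le (Finset.sum_congr rfl fun q hq => ?_)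
        (hT ((Finset.Icc 1 ⌊P ^ D⌋₊).filter fun q => ¬q ≤ T)
          fun q hq => not_le.1 (Finset.mem_filter.1 hq).2).le
      rw [if_neg (Finset.mem_filter.1 hq).2, mul_one]
    linarith
  have h4 : C * P ^ n * (P ^ (-((d : ℝ) + δ)) + 2 * J / P ^ d * (2 * τ)) ≤
      3 * c / 4 * (P ^ n / P ^ d) := by
    have h5 : P ^ (-((d : ℝ) + δ)) = P ^ (-δ) / P ^ d := by
      rw [neg_add, add_comm, Real.rpow_add hP0, Real.rpow_neg hP0.le (d : ℝ), Real.rpow_natCast,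
        div_eq_mul_inv]
    have h6 : C * (2 * J * (2 * τ)) ≤ c / 2 := by
      rw [hτ, show C * (2 * J * (2 * (c / (8 * C * (J + 1))))) = c / 2 * (J / (J + 1)) by
        field_simp; ring]
      exact mul_le_of_le_one_right (by positivity) ((div_le_one (by positivity)).2 (by linarith))
    have h7 := hP₂ P ((le_max_right _ _).trans hP)
    calc _ = (C * P ^ (-δ) + C * (2 * J * (2 * τ))) * (P ^ n / P ^ d) := by rw [h5]; ring
      _ ≤ _ := mul_le_mul_of_nonneg_right (by linarith) (by positivity)
  have h5 := h2.trans ((mul_le_mul_of_nonneg_left (add_le_add le_rfl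
    (mul_le_mul_of_nonneg_left h3 (by positivity))) (by positivity)).trans h4)
  linarith

theorem exists_zero_not_mem_of_le_tsum {F : MvPolynomial (Fin n) ℤ} {d s : ℕ}
    {V : Set (Fin n → ℤ)} (hV : LexCovered V s) (hn : s + d < n) {c P₀ : ℝ} (hc : 0 < c)
    (h : ∀ P, P₀ ≤ P → c * (P ^ n / P ^ d) ≤
      ∑' x : Fin n → ℤ, if eval x F = 0 then gau (P ^ 2)⁻¹ (toR x) else 0) :
    ∃ x, eval x F = 0 ∧ x ∉ V := by
  by_contra! hcon
  obtain ⟨K, hK, hle⟩ := hV.sum_gau_le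
  have htend : Filter.Tendsto (fun l : ℝ => K * (l⁻¹ + l ^ ((2 * s + 2) * d) * Real.exp (-l)))
      Filter.atTop (nhds 0) := by
    have := (tendsto_inv_atTop_zero.add
      (Real.tendsto_pow_mul_exp_neg_atTop_nhds_zero ((2 * s + 2) * d))).const_mul K
    simpa using this
  have hev := (htend.eventually (gt_mem_nhds hc)).and
    ((Filter.eventually_ge_atTop (2 : ℝ)).and (Filter.eventually_ge_atTop P₀))
  obtain ⟨l, hl, hl2, hlP⟩ := hev.exists
  have hl1 : 1 ≤ l := by linarith
  have hl0 : 0 < l := by linarith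
  set P := l ^ (2 * s + 2) with hP
  have hP1 : 1 ≤ P := one_le_pow₀ hl1
  have hP0 : 0 < P := by linarith
  have h1 := h P (hlP.trans (le_self_pow₀ hl1 (by omega)))
  have h2 : ∑' x : Fin n → ℤ, (if eval x F = 0 then gau (P ^ 2)⁻¹ (toR x) else 0) ≤
      K * ((l * P) ^ s + Real.exp (-(l ^ 2 / 2)) * P ^ n) := by
    refine Real.tsum_le_of_sum_le (fun x => ?_) fun T => ?_
    · split_ifs
      · exact (gau_pos _ _).le
      · exact le_rfl
    · rw [← Finset.sum_filter]
      exact hle P l hP1 hl1 _ fun x hx => hcon x (Finset.mem_filter.1 hx).2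
  have hPdn : P ^ n / P ^ d = P ^ (n - d) := by
    rw [div_eq_iff (by positivity), ← pow_add]
    congr 1
    omega
  have h3 : (l * P) ^ s ≤ l⁻¹ * P ^ (n - d) := by
    calc (l * P) ^ s = l⁻¹ * (l ^ (s + 1) * P ^ s) := by
          rw [mul_pow, pow_succ]; field_simp
      _ ≤ l⁻¹ * (P * P ^ s) := by
          refine mul_le_mul_of_nonneg_left (mul_le_mul_of_nonneg_right ?_ (by positivity))
            (by positivity)
          exact pow_le_pow_right₀ hl1 (by omega)
      _ = l⁻¹ * P ^ (s + 1) := by rw [pow_succ]; ring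
      _ ≤ _ := mul_le_mul_of_nonneg_left (pow_le_pow_right₀ hP1 (by omega)) (by positivity)
  have h4 : Real.exp (-(l ^ 2 / 2)) * P ^ n ≤
      l ^ ((2 * s + 2) * d) * Real.exp (-l) * P ^ (n - d) := by
    rw [pow_mul, ← hP, mul_assoc, mul_comm, show P ^ n = P ^ d * P ^ (n - d) by
      rw [← pow_add]; congr 1; omega, mul_assoc, mul_comm (P ^ (n - d))]
    refine mul_le_mul_of_nonneg_left (mul_le_mul_of_nonneg_right ?_ (by positivity)) (by positivity)
    rw [Real.exp_le_exp]
    nlinarith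
  have h5 : c * P ^ (n - d) ≤
      K * (l⁻¹ + l ^ ((2 * s + 2) * d) * Real.exp (-l)) * P ^ (n - d) := by
    rw [← hPdn]
    refine (h1.trans h2).trans ?_
    rw [hPdn, mul_assoc, add_mul]
    exact mul_le_mul_of_nonneg_left (add_le_add h3 h4) hK
  exact absurd (le_of_mul_le_mul_right h5 (by positivity)) (not_le.2 hl)

theorem lt_of_birch_bound {j : ℕ} (hj : 1 ≤ j) {N : ℝ}
    (h : (((j + 2 : ℕ) : ℝ) - √((j + 2 : ℕ) : ℝ) / 2) * 2 ^ (j + 2) ≤ N) :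
    ((j : ℝ) + 2) * (3 * 2 ^ (j + 1) - 2) < 2 * N := by
  have hj1 : (1 : ℝ) ≤ j := by exact_mod_cast hj
  have h2 : (2 : ℝ) ≤ 2 ^ (j + 1) := le_self_pow₀ (by norm_num) (by omega)
  push_cast at h
  rcases Nat.lt_or_ge j 2 with h1 | h1
  · obtain rfl : j = 1 := by omega
    have h3 : √((1 : ℕ) + 2 : ℝ) ≤ 2 := by
      rw [Real.sqrt_le_left (by norm_num)]
      norm_num
    norm_num at h h3 ⊢
    linarith
  · have h3 : √((j : ℝ) + 2) ≤ (j + 2) / 2 := by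
      rw [Real.sqrt_le_left (by positivity)]
      have : (2 : ℝ) ≤ j := by exact_mod_cast h1
      nlinarith
    have h4 : 3 * ((j : ℝ) + 2) / 4 * 2 ^ (j + 2) ≤ N :=
      (mul_le_mul_of_nonneg_right (by linarith) (by positivity)).trans h
    rw [show (2 : ℝ) ^ (j + 2) = 2 * 2 ^ (j + 1) by ring] at h4
    linarith

end Conclusion

theorem exists_zero_of_singDim_eq {n j σ : ℕ} (hj : 1 ≤ j) {F : MvPolynomial (Fin n) ℤ}
    (hF : F.IsHomogeneous (j + 2))
    (hσ : singDim n ℚ (map (Int.castRingHom ℚ) F) = (σ : WithBot (WithTop ℕ)))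
    (hn : (((j + 2 : ℕ) : ℝ) - √((j + 2 : ℕ) : ℝ) / 2) * 2 ^ (j + 2) ≤ (n : ℝ) - σ)
    (hreal : ∃ x : Fin n → ℝ, eval x (map (Int.castRingHom ℝ) F) = 0 ∧
      ∃ i, eval x (pderiv i (map (Int.castRingHom ℝ) F)) ≠ 0)
    (hpadic : ∀ (p : ℕ) [Fact p.Prime], ∃ x : Fin n → ℚ_[p],
      eval x (map (Int.castRingHom ℚ_[p]) F) = 0 ∧
        ∃ i, eval x (pderiv i (map (Int.castRingHom ℚ_[p]) F)) ≠ 0) :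
    ∃ x : Fin n → ℤ, eval x F = 0 ∧ ∃ i, eval x (pderiv i F) ≠ 0 := by
  have hlt := lt_of_birch_bound hj hn
  have hw : (1 : ℝ) ≤ 2 ^ (j + 1) := one_le_pow₀ one_le_two
  have hw4 : (4 : ℝ) ≤ 2 ^ (j + 1) := by
    calc (4 : ℝ) = 2 ^ 2 := by norm_num
      _ ≤ 2 ^ (j + 1) := pow_le_pow_right₀ one_le_two (by omega)
  have hσn : σ + (j + 2) < n := by
    have : ((σ + (j + 2) : ℕ) : ℝ) < n := by
      push_cast
      nlinarith [(Nat.cast_nonneg j : (0 : ℝ) ≤ j)]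
    exact_mod_cast this
  have hN : ((j : ℝ) + 2) * (3 * 2 ^ (j + 1) - 2) < 2 * ((n - σ : ℕ) : ℝ) := by
    rwa [Nat.cast_sub (by omega)]
  have hdim := dimLe_of_ringKrullDim (le_of_eq hσ)
  obtain ⟨D, δ, C, hD, hδ, hC, hB⟩ := gsum_bound hj hF (hasStrata_of_dimLe hF hdim) hN
  have hB' : GsumBound F (j + 2) D δ C := by
    intro P q a β hP hq ha hqP hβ
    push_cast
    exact hB P q a β hP hq ha hqP hβ
  obtain ⟨κ, hκ, hz⟩ := exists_zcount hF hD hδ hC hB' hpadic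
  obtain ⟨ξ, hξ, i, hi⟩ := hreal
  rw [eval_map_int] at hξ
  rw [pderiv_map, eval_map_int] at hi
  obtain ⟨c, P₀, hc, -, h⟩ := exists_le_tsum_zero hF (by omega) hD hδ hC hB' hξ hi hκ hz
  obtain ⟨x, hx, hxV⟩ := exists_zero_not_mem_of_le_tsum (lexCovered_grad hF hdim) hσn hc h
  exact ⟨x, hx, not_forall.1 hxV⟩

end BirchHasse

theorem birch_improvement_general
    (n d : ℕ) (hd : 3 ≤ d) (F : MvPolynomial (Fin n) ℤ) (hF : F.IsHomogeneous d)
    (σ : ℕ)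
    (hσ : singDim n ℚ (MvPolynomial.map (Int.castRingHom ℚ) F) = (σ : WithBot (WithTop ℕ)))
    (hn : ((d : ℝ) - Real.sqrt d / 2) * 2 ^ d ≤ (n : ℝ) - (σ : ℝ))
    (hreal : ∃ x : Fin n → ℝ,
      MvPolynomial.eval x (MvPolynomial.map (Int.castRingHom ℝ) F) = 0 ∧
      ∃ i, MvPolynomial.eval x (MvPolynomial.pderiv i (MvPolynomial.map (Int.castRingHom ℝ) F)) ≠ 0)
    (hpadic : ∀ (p : ℕ) [Fact p.Prime], ∃ x : Fin n → ℚ_[p],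
      MvPolynomial.eval x (MvPolynomial.map (Int.castRingHom ℚ_[p]) F) = 0 ∧
      ∃ i, MvPolynomial.eval x (MvPolynomial.pderiv i (MvPolynomial.map (Int.castRingHom ℚ_[p]) F)) ≠ 0) :
    ∃ x : Fin n → ℤ, MvPolynomial.eval x F = 0 ∧
      ∃ i, MvPolynomial.eval x (MvPolynomial.pderiv i F) ≠ 0 := by
  obtain ⟨j, rfl⟩ := Nat.exists_eq_add_of_le' (show 2 ≤ d by omega)
  exact BirchHasse.exists_zero_of_singDim_eq (by omega) hF hσ hn hreal hpadic

end
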